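/- For every 0 < δ < 1 there exist constants c_δ ≥ 1, c'_δ > 0 and w_0 such that for every integer w ≥ w_0 and ℓ = max(3, ⌈1/δ⌉) (with ℓ ≤ w/2) there is a prime v with w·2^w/c_δ ≤ v ≤ c_δ·w·2^w for which the function f:{0,1}^{v·w} → {0,1} defined by f(x) = ⋀_{y ∈ (ℤ/vℤ)^ℓ} T_{P^{α(y)}}(x), where α(y)_i = Σ_{j=1}^ℓ y_j·i^j (mod v), satisfies: (i) |Pr_{x uniform on {0,1}^{v·w}}[f(x) = 1] − 1/2| ≤ 2^{−c'_δ·w}, and (ii) for every integer 1 ≤ q ≤ 2^{w(1−δ)}, I_q(f) ≤ c_δ·2^{−w}·q. -/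

import Mathlib

open Finset

/-- Probability of event `E` under the uniform distribution on a finite type. -/
noncomputable def uPr {α : Type*} [Fintype α] (E : α → Prop) : ℝ :=
  (Nat.card {x // E x} : ℝ) / (Fintype.card α)

/-- The event that `f` is not determined by the assignment `x` to coordinates outside `Q`. -/
def Undet {n : ℕ} (F : (Fin n → Bool) → Prop) (Q : Finset (Fin n)) (x : Fin n → Bool) : Prop :=
  ∃ y z : Fin n → Bool, (∀ i ∉ Q, y i = x i) ∧ (∀ i ∉ Q, z i = x i) ∧ ¬(F y ↔ F z)

/-- The `i`-th block of the partition `P^α` of `[v·w]` associated to `α ∈ (ℤ/v)^w`: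
`P^α_i = { (k−1)·v + ((i − α_k) mod v) : k ∈ [w] }` (0-indexed). -/
def blockP {v w : ℕ} (α : Fin w → ZMod v) (i : Fin v) : Finset (Fin (v * w)) :=
  Finset.univ.image (fun k : Fin w =>
    (⟨k.1 * v + ((((i.1 : ZMod v) - α k).val) % v), by
      have hv : 0 < v := Nat.lt_of_le_of_lt (Nat.zero_le _) i.2
      have h1 : ((((i.1 : ZMod v) - α k).val) % v) < v := Nat.mod_lt _ hv
      have h2 : k.1 + 1 ≤ w := k.2
      calc k.1 * v + ((((i.1 : ZMod v) - α k).val) % v) < k.1 * v + v := by omega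
        _ = (k.1 + 1) * v := by ring
        _ ≤ w * v := Nat.mul_le_mul h2 (Nat.le_refl v)
        _ = v * w := Nat.mul_comm w v⟩ : Fin (v * w)))

/-- The Reed–Solomon string `α(y) ∈ (ℤ/v)^w`, `α(y)_i = Σ_{j=1}^ℓ y_j i^j`. -/
def alphaRS {v ℓ : ℕ} (w : ℕ) (y : Fin ℓ → ZMod v) : Fin w → ZMod v :=
  fun i => ∑ j : Fin ℓ, y j * ((i.1 + 1 : ℕ) : ZMod v) ^ (j.1 + 1)

/-- The resilient function `f_RS : {0,1}^{v·w} → {0,1}`: the AND over all degree-`ℓ`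
Reed–Solomon codewords `α(y)` of the Tribes function of the partition `P^{α(y)}`. -/
def fRS (v ℓ w : ℕ) (x : Fin (v * w) → Bool) : Prop :=
  ∀ y : Fin ℓ → ZMod v, ∃ i : Fin v, ∀ k ∈ blockP (alphaRS w y) i, x k = true

/-- The additive self-convolution of a sequence. -/
def selfConv (r : ℕ → ℝ) (n : ℕ) : ℝ := ∑ i ∈ range (n + 1), r i * r (n - i)

lemma selfConv_le_sum_sq (r : ℕ → ℝ) (n : ℕ) :
    selfConv r n ≤ ∑ i ∈ range (n + 1), r i ^ 2 := by
  have h : ∑ i ∈ range (n + 1), r (n - i) ^ 2 = ∑ i ∈ range (n + 1), r i ^ 2 := by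
    have := Finset.sum_range_reflect (fun i => r i ^ 2) (n + 1)
    simpa using this
  have : selfConv r n ≤ ∑ i ∈ range (n + 1), (r i ^ 2 / 2 + r (n - i) ^ 2 / 2) := by
    refine sum_le_sum fun i _ => ?_
    nlinarith [sq_nonneg (r i - r (n - i))]
  rw [sum_add_distrib, ← sum_div, ← sum_div, h] at this
  linarith

lemma sum_one_sub_sq_le {r : ℕ → ℝ} {K B : ℕ} {ε : ℝ} (hε : 0 ≤ ε) (hε1 : ε ≤ 1) (hB : 0 < B)
    (hBK : (B : ℝ) ≤ ε * K) (hr : ∀ i, |r i| ≤ 1 + ε)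
    (h2 : |K * ∑ b ∈ range B, r (K + b) + ∑ b ∈ range B, selfConv r (K + b)| ≤ ε * K * B)
    (h3 : ∑ b ∈ range B, r (K + b) ≤ (-1 + ε) * B) :
    ∑ i ∈ range K, (1 - r i ^ 2) ≤ 10 * ε * K := by
  have hBpos : (1 : ℝ) ≤ B := by exact_mod_cast hB
  have hK : (0 : ℝ) ≤ K := Nat.cast_nonneg K
  have hsq : ∀ i, r i ^ 2 ≤ 4 := fun i => by
    have := abs_le.mp (hr i)
    nlinarith
  have hc : ∀ b ∈ range B, selfConv r (K + b) ≤ ∑ i ∈ range K, r i ^ 2 + 4 * B := by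
    intro b hb
    refine (selfConv_le_sum_sq r _).trans ?_
    rw [show K + b + 1 = K + (b + 1) by ring, sum_range_add]
    have : ∑ x ∈ range (b + 1), r (K + x) ^ 2 ≤ ∑ x ∈ range (b + 1), (4 : ℝ) :=
      sum_le_sum fun i _ => hsq _
    simp only [sum_const, card_range, nsmul_eq_mul] at this
    have hb' : ((b + 1 : ℕ) : ℝ) ≤ B := by
      exact_mod_cast mem_range.mp hb
    nlinarith
  have hs := sum_le_sum hc
  simp only [sum_const, card_range, nsmul_eq_mul] at hs
  have h2' := (abs_le.mp h2).1
  have h4 : (K : ℝ) * ∑ b ∈ range B, r (K + b) ≤ K * ((-1 + ε) * B) :=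
    mul_le_mul_of_nonneg_left h3 hK
  have h5 : (B : ℝ) * (K * (1 - 2 * ε)) ≤ B * (∑ i ∈ range K, r i ^ 2 + 4 * B) := by nlinarith
  have h6 := le_of_mul_le_mul_left h5 (by linarith)
  rw [sum_sub_distrib]
  simp only [sum_const, card_range, nsmul_eq_mul, mul_one]
  nlinarith

/-- The triple correlation at level `N`, with last index at most `K`. -/
def tripleCorr (r : ℕ → ℝ) (K N : ℕ) : ℝ := ∑ l ∈ range (K + 1), r l * selfConv r (N - l)

lemma sum_range_id_real (K : ℕ) : ∑ k ∈ range (K + 1), (k : ℝ) = K * (K + 1) / 2 := by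
  have := Finset.sum_range_id_mul_two (K + 1)
  have h : ((∑ k ∈ range (K + 1), k : ℕ) : ℝ) * 2 = (K + 1) * K := by
    have := congrArg (fun n : ℕ => (n : ℝ)) this
    simpa using this
  push_cast at h
  linarith

lemma exists_tripleCorr_le {r : ℕ → ℝ} {K B : ℕ} {ε : ℝ} (hε : 0 ≤ ε) (hε1 : ε ≤ 1 / 100)
    (hB : 0 < B) (hBK : (B : ℝ) ≤ ε * K) (hr : ∀ i, |r i| ≤ 1 + ε)
    (h2 : ∀ k ≤ K, |k * ∑ b ∈ range B, r (k + b) + ∑ b ∈ range B, selfConv r (k + b)|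
      ≤ ε * K * B)
    (h3 : ∑ b ∈ range B, r (K + b) ≤ (-1 + ε) * B) :
    ∃ b < B, tripleCorr r K (K + b) ≤ -((1 / 2 - 20 * ε) * K ^ 2) := by
  have hBpos : (1 : ℝ) ≤ B := by exact_mod_cast hB
  have hK : (0 : ℝ) ≤ K := Nat.cast_nonneg K
  have hK1 : 1 ≤ ε * K := hBpos.trans hBK
  have hmul : ∀ i j, |r i * r j| ≤ 1 + 3 * ε := fun i j => by
    rw [abs_mul]
    calc |r i| * |r j| ≤ (1 + ε) * (1 + ε) :=
          mul_le_mul (hr i) (hr j) (abs_nonneg _) (by linarith)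
      _ ≤ 1 + 3 * ε := by nlinarith
  -- the diagonal correlation
  set g : ℕ → ℝ := fun k => (∑ b ∈ range B, r (k + b)) * r (K - k) with hg
  have hgle : ∀ k, g k ≤ B * (1 + 3 * ε) := fun k => by
    simp only [hg, sum_mul]
    calc _ ≤ ∑ b ∈ range B, (1 + 3 * ε) := sum_le_sum fun b _ => (le_abs_self _).trans (hmul _ _)
      _ = _ := by simp; ring
  have hconv : ∀ b ∈ range B, selfConv r (K + b) - B * 2 ≤
      ∑ k ∈ range (K + 1), r (k + b) * r (K - k) := by
    intro b hb
    have hbB : ((b : ℕ) : ℝ) ≤ B := by exact_mod_cast (mem_range.mp hb).le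
    unfold selfConv
    rw [show K + b + 1 = b + (K + 1) by ring, sum_range_add]
    have h1 : ∑ x ∈ range b, r x * r (K + b - x) ≤ ∑ x ∈ range b, (2 : ℝ) :=
      sum_le_sum fun i _ => (le_abs_self _).trans ((hmul _ _).trans (by linarith))
    simp only [sum_const, card_range, nsmul_eq_mul] at h1
    have h2 : ∑ x ∈ range (K + 1), r (b + x) * r (K + b - (b + x)) =
        ∑ k ∈ range (K + 1), r (k + b) * r (K - k) := by
      refine sum_congr rfl fun x _ => ?_
      rw [add_comm b x, show K + b - (x + b) = K - x by omega]
    rw [h2]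
    nlinarith
  have hS : (B : ℝ) * (K * (1 - 5 * ε)) ≤ ∑ k ∈ range (K + 1), g k := by
    have e : ∑ k ∈ range (K + 1), g k =
        ∑ b ∈ range B, ∑ k ∈ range (K + 1), r (k + b) * r (K - k) := by
      rw [sum_comm]; simp only [hg, sum_mul]
    have := sum_le_sum hconv
    rw [e]
    rw [sum_sub_distrib] at this
    simp only [sum_const, card_range, nsmul_eq_mul] at this
    have h2' := (abs_le.mp (h2 K le_rfl)).1
    have h4 : (K : ℝ) * ∑ b ∈ range B, r (K + b) ≤ K * ((-1 + ε) * B) :=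
      mul_le_mul_of_nonneg_left h3 hK
    nlinarith
  have hkg : (B : ℝ) * (K ^ 2 * (1 / 2 - 13 * ε)) ≤ ∑ k ∈ range (K + 1), (k : ℝ) * g k := by
    have h1 : ∑ k ∈ range (K + 1), (k : ℝ) * (B * (1 + 3 * ε) - g k) ≤
        ∑ k ∈ range (K + 1), (K : ℝ) * (B * (1 + 3 * ε) - g k) := by
      refine sum_le_sum fun k hk => ?_
      have : (k : ℝ) ≤ K := by exact_mod_cast Nat.lt_succ_iff.mp (mem_range.mp hk)
      exact mul_le_mul_of_nonneg_right this (by linarith [hgle k])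
    have e1 : ∑ k ∈ range (K + 1), (k : ℝ) * (B * (1 + 3 * ε) - g k) =
        (K * (K + 1) / 2) * (B * (1 + 3 * ε)) - ∑ k ∈ range (K + 1), (k : ℝ) * g k := by
      rw [← sum_range_id_real, sum_mul, ← sum_sub_distrib]
      exact sum_congr rfl fun _ _ => by ring
    have e2 : ∑ k ∈ range (K + 1), (K : ℝ) * (B * (1 + 3 * ε) - g k) =
        K * ((K + 1) * (B * (1 + 3 * ε)) - ∑ k ∈ range (K + 1), g k) := by
      rw [← mul_sum, sum_sub_distrib]; simp
    rw [e1, e2] at h1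
    have h3 := mul_le_mul_of_nonneg_left hS hK
    have : (K : ℝ) * (B * (1 + 3 * ε)) ≤ K * (B * (2 * (ε * K))) := by
      gcongr; nlinarith
    have hp : 0 ≤ (B : ℝ) * K * ε := by positivity
    have hp2 : 0 ≤ (B : ℝ) * K ^ 2 * ε := by positivity
    nlinarith
  have htr : ∑ k ∈ range (K + 1), (k : ℝ) * g k ≤
      -(∑ b ∈ range B, tripleCorr r K (K + b)) + B * (3 * ε * K ^ 2) := by
    have e : ∑ b ∈ range B, tripleCorr r K (K + b) =
        ∑ k ∈ range (K + 1), r (K - k) * ∑ b ∈ range B, selfConv r (k + b) := by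
      have : ∀ b, tripleCorr r K (K + b) =
          ∑ k ∈ range (K + 1), r (K - k) * selfConv r (k + b) := by
        intro b
        unfold tripleCorr
        rw [← Finset.sum_range_reflect]
        refine sum_congr rfl fun k hk => ?_
        have : k ≤ K := Nat.lt_succ_iff.mp (mem_range.mp hk)
        rw [show K + 1 - 1 - k = K - k by omega, show K + b - (K - k) = k + b by omega]
      simp only [this, mul_sum]
      rw [sum_comm]
    rw [e, ← sum_neg_distrib]
    have : ∀ k ∈ range (K + 1), (k : ℝ) * g k ≤
        -(r (K - k) * ∑ b ∈ range B, selfConv r (k + b)) + (1 + ε) * (ε * K * B) := by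
      intro k hk
      have hk' : k ≤ K := Nat.lt_succ_iff.mp (mem_range.mp hk)
      have h := h2 k hk'
      have : r (K - k) * (k * ∑ b ∈ range B, r (k + b) + ∑ b ∈ range B, selfConv r (k + b)) ≤
          (1 + ε) * (ε * K * B) := by
        refine (le_abs_self _).trans ?_
        rw [abs_mul]
        exact mul_le_mul (hr _) h (abs_nonneg _) (by linarith)
      simp only [hg]
      linarith
    refine (sum_le_sum this).trans ?_
    rw [sum_add_distrib]
    simp only [sum_const, card_range, nsmul_eq_mul]
    push_cast
    have : ((K : ℝ) + 1) * ((1 + ε) * (ε * K * B)) ≤ B * (3 * ε * K ^ 2) := by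
      have hk1 : (K : ℝ) + 1 ≤ K * (1 + ε) := by linarith
      calc ((K : ℝ) + 1) * ((1 + ε) * (ε * K * B)) ≤ K * (1 + ε) * ((1 + ε) * (ε * K * B)) := by
            gcongr
        _ = ((1 + ε) * (1 + ε)) * (B * (ε * K ^ 2)) := by ring
        _ ≤ 3 * (B * (ε * K ^ 2)) := by
            have : (1 + ε) * (1 + ε) ≤ 3 := by nlinarith
            gcongr
        _ = _ := by ring
    linarith
  by_contra! hcon
  have hlt : ∑ b ∈ range B, -((1 / 2 - 20 * ε) * (K : ℝ) ^ 2) <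
      ∑ b ∈ range B, tripleCorr r K (K + b) :=
    sum_lt_sum_of_nonempty ⟨0, mem_range.mpr hB⟩ fun b hb => hcon b (mem_range.mp hb)
  simp only [sum_const, card_range, nsmul_eq_mul] at hlt
  have hp2 : 0 ≤ (B : ℝ) * K ^ 2 * ε := by positivity
  nlinarith

lemma one_sub_sum_le_of_four {x y a b c d p₁ p₂ p₃ p₄ : ℝ} (hx : |x| ≤ 1) (hy : |y| ≤ 1)
    (ha : |a| ≤ 1) (hb : |b| ≤ 1) (hc : |c| ≤ 1) (hd : |d| ≤ 1) {z : ℝ} (hz : |z| ≤ 1)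
    (h₁ : p₁ = x * a * c) (h₂ : p₂ = z * b * c) (h₃ : p₃ = z * a * d) (h₄ : p₄ = y * b * d)
    (hp₁ : p₁ ≤ 1) (hp₂ : p₂ ≤ 1) (hp₃ : p₃ ≤ 1) (hp₄ : p₄ ≤ 1) :
    1 - 2 * ((1 - p₁) + (1 - p₂) + (1 - p₃) + (1 - p₄)) ≤ x * y := by
  have hxy : -1 ≤ x * y := by
    have : |x * y| ≤ 1 := by rw [abs_mul]; exact mul_le_one₀ hx (abs_nonneg _) hy
    exact (abs_le.mp this).1
  by_cases hs : 1 ≤ (1 - p₁) + (1 - p₂) + (1 - p₃) + (1 - p₄)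
  · linarith
  push Not at hs
  have h12 : 1 - (1 - p₁) - (1 - p₂) ≤ p₁ * p₂ := by nlinarith
  have h34 : 1 - (1 - p₃) - (1 - p₄) ≤ p₃ * p₄ := by nlinarith
  have h12' : p₁ * p₂ ≤ 1 := by nlinarith
  have h34' : p₃ * p₄ ≤ 1 := by nlinarith
  have hprod : 1 - ((1 - p₁) + (1 - p₂) + (1 - p₃) + (1 - p₄)) ≤ (p₁ * p₂) * (p₃ * p₄) := by
    nlinarith
  have e : (p₁ * p₂) * (p₃ * p₄) = (x * y) * ((z * a * b * c * d) ^ 2) := by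
    rw [h₁, h₂, h₃, h₄]; ring
  have hS : (z * a * b * c * d) ^ 2 ≤ 1 := by
    rw [sq_le_one_iff_abs_le_one]
    simp only [abs_mul]
    have := mul_le_one₀ hz (abs_nonneg _) ha
    have := mul_le_one₀ this (abs_nonneg _) hb
    have := mul_le_one₀ this (abs_nonneg _) hc
    exact mul_le_one₀ this (abs_nonneg _) hd
  have hS0 : 0 ≤ (z * a * b * c * d) ^ 2 := sq_nonneg _
  rw [e] at hprod
  by_contra! hcon
  have : x * y * (z * a * b * c * d) ^ 2 ≤ max 0 (x * y) := by
    rcases le_total 0 (x * y) with h | h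
    · rw [max_eq_right h]; nlinarith
    · rw [max_eq_left h]; nlinarith
  rcases max_cases 0 (x * y) with ⟨h, _⟩ | ⟨h, _⟩ <;> rw [h] at this <;> linarith

/-- If the triple correlation of a bounded sequence is almost extremal, the sequence correlates
with its even shifts. -/
lemma le_sum_mul_shift {χ : ℕ → ℝ} {K N m : ℕ} (hχ : ∀ i, |χ i| ≤ 1) (hKN : K ≤ N)
    (hm : 6 * m ≤ K) {Δ : ℝ}
    (hΔ : ∑ l ∈ range (K + 1), ∑ i ∈ range (N - l + 1), (1 - χ l * (χ i * χ (N - l - i))) ≤ Δ) :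
    (m : ℝ) ^ 2 - 8 * Δ ≤ ∑ v ∈ range m, ∑ h ∈ range m, χ (2 * v) * χ (2 * (v + h)) := by
  rcases Nat.eq_zero_or_pos m with rfl | hmpos
  · have : 0 ≤ ∑ l ∈ range (K + 1), ∑ i ∈ range (N - l + 1),
        (1 - χ l * (χ i * χ (N - l - i))) := by
      refine sum_nonneg fun l _ => sum_nonneg fun i _ => ?_
      have : |χ l * (χ i * χ (N - l - i))| ≤ 1 := by
        simp only [abs_mul]
        exact mul_le_one₀ (hχ _) (by positivity) (mul_le_one₀ (hχ _) (abs_nonneg _) (hχ _))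
      linarith [(abs_le.mp this).2]
    simp; linarith
  set E : ℕ × ℕ → ℝ := fun x => 1 - χ x.1 * (χ x.2 * χ (N - x.1 - x.2)) with hE
  have hp : ∀ l i, χ l * (χ i * χ (N - l - i)) ≤ 1 := fun l i => by
    have : |χ l * (χ i * χ (N - l - i))| ≤ 1 := by
      simp only [abs_mul]
      exact mul_le_one₀ (hχ _) (by positivity) (mul_le_one₀ (hχ _) (abs_nonneg _) (hχ _))
    exact (abs_le.mp this).2
  have hE0 : ∀ x, 0 ≤ E x := fun x => by simp only [hE]; linarith [hp x.1 x.2]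
  have key : ∀ f : ℕ × ℕ → ℕ × ℕ, Function.Injective f →
      (∀ v < m, ∀ t < m, (f (v, t)).1 ≤ K ∧ (f (v, t)).1 + (f (v, t)).2 ≤ N) →
      ∑ v ∈ range m, ∑ t ∈ range m, E (f (v, t)) ≤ Δ := by
    intro f hf hfr
    refine le_trans ?_ hΔ
    rw [← sum_product', sum_sigma']
    rw [← sum_image (f := E) (g := f) (s := range m ×ˢ range m) (fun _ _ _ _ h => hf h)]
    have : ∑ x ∈ (range (K + 1)).sigma fun l => range (N - l + 1),
        (1 - χ x.1 * (χ x.2 * χ (N - x.1 - x.2))) =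
        ∑ x ∈ ((range (K + 1)).sigma fun l => range (N - l + 1)).image
          (fun x => (x.1, x.2)), E x := by
      rw [sum_image]
      rintro ⟨a, b⟩ _ ⟨c, d⟩ _ h
      simp only [Prod.mk.injEq] at h
      obtain ⟨rfl, rfl⟩ := h
      rfl
    rw [this]
    refine sum_le_sum_of_subset_of_nonneg ?_ fun x _ _ => hE0 x
    intro x hx
    simp only [mem_image, mem_product, mem_range, Prod.exists] at hx
    obtain ⟨v, t, ⟨hv, ht⟩, rfl⟩ := hx
    obtain ⟨h1, h2⟩ := hfr v hv t ht
    simp only [mem_image, mem_sigma, mem_range, Sigma.exists]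
    exact ⟨_, _, ⟨by omega, by omega⟩, rfl⟩
  have hpt : ∀ v < m, ∀ h < m, ∀ t < m, 1 - 2 * (E (t + m, 2 * v) + E (t + m - h, 2 * v + h) +
      E (t + m, 2 * v + h) + E (t + m - h, 2 * v + 2 * h)) ≤ χ (2 * v) * χ (2 * (v + h)) := by
    intro v hv h hh t ht
    simp only [hE]
    rw [mul_add 2 v h]
    refine one_sub_sum_le_of_four (hχ (2 * v)) (hχ (2 * v + 2 * h)) (hχ (t + m)) (hχ (t + m - h))
      (hχ (N - (t + m) - 2 * v)) (hχ (N - (t + m) - (2 * v + h))) (hχ (2 * v + h))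
      (by ring) ?_ (by ring) ?_ (hp _ _) (hp _ _) (hp _ _) (hp _ _)
    · rw [show N - (t + m - h) - (2 * v + h) = N - (t + m) - 2 * v by omega]; ring
    · rw [show N - (t + m - h) - (2 * v + 2 * h) = N - (t + m) - (2 * v + h) by omega]; ring
  have hfix : ∀ h ∈ range m, (m : ℝ) ^ 2 - 8 * Δ ≤
      m * ∑ v ∈ range m, χ (2 * v) * χ (2 * (v + h)) := by
    intro h hh
    have hh := mem_range.mp hh
    have h1 := sum_le_sum fun v (hv : v ∈ range m) => sum_le_sum fun t (ht : t ∈ range m) =>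
      hpt v (mem_range.mp hv) h hh t (mem_range.mp ht)
    simp only [sum_sub_distrib, ← mul_sum, sum_add_distrib, sum_const, card_range,
      nsmul_eq_mul] at h1
    have k1 := key (fun x => (x.2 + m, 2 * x.1)) (by
      rintro ⟨a, b⟩ ⟨c, d⟩ h; simp only [Prod.mk.injEq] at h ⊢; omega)
      (fun v hv t ht => by dsimp only; omega)
    have k2 := key (fun x => (x.2 + m - h, 2 * x.1 + h)) (by
      rintro ⟨a, b⟩ ⟨c, d⟩ h; simp only [Prod.mk.injEq] at h ⊢; omega)
      (fun v hv t ht => by dsimp only; omega)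
    have k3 := key (fun x => (x.2 + m, 2 * x.1 + h)) (by
      rintro ⟨a, b⟩ ⟨c, d⟩ h; simp only [Prod.mk.injEq] at h ⊢; omega)
      (fun v hv t ht => by dsimp only; omega)
    have k4 := key (fun x => (x.2 + m - h, 2 * x.1 + 2 * h)) (by
      rintro ⟨a, b⟩ ⟨c, d⟩ h; simp only [Prod.mk.injEq] at h ⊢; omega)
      (fun v hv t ht => by dsimp only; omega)
    dsimp only at k1 k2 k3 k4
    have e : ∑ x ∈ range m, χ (2 * x) * (m * χ (2 * (x + h))) =
        m * ∑ v ∈ range m, χ (2 * v) * χ (2 * (v + h)) := by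
      rw [mul_sum]; exact sum_congr rfl fun _ _ => by ring
    rw [e] at h1
    linarith
  have := sum_le_sum hfix
  simp only [sum_const, card_range, nsmul_eq_mul, ← mul_sum] at this
  rw [sum_comm] at this
  exact le_of_mul_le_mul_left this (by exact_mod_cast hmpos)

lemma sum_tripleErr_eq (χ : ℕ → ℝ) {K N : ℕ} (hKN : K ≤ N) :
    ∑ l ∈ range (K + 1), ∑ i ∈ range (N - l + 1), (1 - χ l * (χ i * χ (N - l - i))) =
      (K + 1) * (N + 1) - K * (K + 1) / 2 - tripleCorr χ K N := by
  unfold tripleCorr selfConv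
  simp only [sum_sub_distrib, mul_sum, sum_const, card_range, nsmul_eq_mul, mul_one]
  congr 1
  rw [← sum_range_id_real]
  have : ∑ x ∈ range (K + 1), ((N - x + 1 : ℕ) : ℝ) = ∑ x ∈ range (K + 1), ((N + 1 : ℝ) - x) := by
    refine sum_congr rfl fun x hx => ?_
    have : x ≤ N := by have := mem_range.mp hx; omega
    push_cast [Nat.cast_sub this]; ring
  rw [this, sum_sub_distrib]
  simp
  ring

set_option maxHeartbeats 1000000 in
/-- The combinatorial core of the short-interval argument: a sequence which is an approximate
solution of Selberg's convolution equation at two scales cannot be close to `-1` on average on a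
short block. -/
theorem selberg_conv_contradiction {r : ℕ → ℝ} {K B : ℕ} {ε : ℝ} (hε : 0 < ε)
    (hε1 : ε ≤ 1 / 1000000) (hB : 0 < B) (hBK : (B : ℝ) ≤ ε * K)
    (hr : ∀ i, |r i| ≤ 1 + ε)
    (h1 : ∀ m ≤ 2 * K, |∑ i ∈ range m, (r (2 * i) + r (2 * i + 1)) / 2| ≤ ε * K)
    (h2 : |K * ∑ b ∈ range B, (r (2 * (K + b)) + r (2 * (K + b) + 1)) / 2 +
      ∑ b ∈ range B, selfConv (fun i => (r (2 * i) + r (2 * i + 1)) / 2) (K + b)| ≤ ε * K * B)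
    (h2' : ∀ k ≤ 2 * K, |k * ∑ b ∈ range B, r (k + b) + ∑ b ∈ range B, selfConv r (k + b)|
      ≤ ε * (2 * K) * B)
    (h3 : ∑ b ∈ range B, (r (2 * (K + b)) + r (2 * (K + b) + 1)) / 2 ≤ (-1 + ε) * B)
    (h3' : ∑ b ∈ range B, r (2 * K + b) ≤ (-1 + ε) * B) : False := by
  have hBpos : (1 : ℝ) ≤ B := by exact_mod_cast hB
  have hK : (0 : ℝ) ≤ K := Nat.cast_nonneg K
  have hK1 : 1 ≤ ε * K := hBpos.trans hBK
  have hKbig : (1000000 : ℝ) ≤ K := by nlinarith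
  set R : ℕ → ℝ := fun i => (r (2 * i) + r (2 * i + 1)) / 2 with hR
  have hRb : ∀ i, |R i| ≤ 1 + ε := fun i => by
    have a := abs_le.mp (hr (2 * i)); have b := abs_le.mp (hr (2 * i + 1))
    rw [abs_le]; constructor <;> simp only [hR] <;> linarith
  have hpair := sum_one_sub_sq_le (r := R) hε.le (by linarith) hB hBK hRb h2 h3
  obtain ⟨b, hb, htr⟩ := exists_tripleCorr_le (r := r) (K := 2 * K) hε.le (by linarith) hB
    (by push_cast; linarith) hr (by push_cast; exact h2') h3'
  have hbB : (b : ℝ) ≤ ε * K := le_trans (by exact_mod_cast hb.le) hBK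
  push_cast at htr
  set χ : ℕ → ℝ := fun i => -r i / (1 + ε) with hχ
  have h1ε : 0 < 1 + ε := by linarith
  have hχb : ∀ i, |χ i| ≤ 1 := fun i => by
    simp only [hχ, abs_div, abs_neg, abs_of_pos h1ε]
    exact (div_le_one h1ε).mpr (hr i)
  have hχtr : tripleCorr χ (2 * K) (2 * K + b) = -(tripleCorr r (2 * K) (2 * K + b)) /
      (1 + ε) ^ 3 := by
    unfold tripleCorr selfConv
    simp only [mul_sum, hχ, ← sum_neg_distrib, sum_div]
    refine sum_congr rfl fun l _ => sum_congr rfl fun i _ => ?_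
    field_simp
  set m := K / 4 with hm
  have hmle : (m : ℝ) ≤ K / 4 := by
    have : ((4 * m : ℕ) : ℝ) ≤ K := by exact_mod_cast Nat.mul_div_le K 4
    push_cast at this; linarith
  have hmge : (K : ℝ) / 4 - 1 ≤ m := by
    have : K < 4 * m + 4 := by omega
    have : (K : ℝ) < ((4 * m + 4 : ℕ) : ℝ) := by exact_mod_cast this
    push_cast at this; linarith
  have hΔ : ∑ l ∈ range (2 * K + 1), ∑ i ∈ range (2 * K + b - l + 1),
      (1 - χ l * (χ i * χ (2 * K + b - l - i))) ≤ 200 * ε * K ^ 2 := by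
    rw [sum_tripleErr_eq χ (by omega), hχtr]
    push_cast
    have h3 : (1 - 4 * ε) * ((1 / 2 - 20 * ε) * (2 * K) ^ 2) ≤
        -(tripleCorr r (2 * K) (2 * K + b)) / (1 + ε) ^ 3 := by
      rw [le_div_iff₀ (by positivity)]
      have : (1 - 4 * ε) * (1 + ε) ^ 3 ≤ 1 := by nlinarith [pow_pos hε 2, pow_pos hε 3, pow_pos hε 4]
      have h0 : 0 ≤ (1 / 2 - 20 * ε) * (2 * (K:ℝ)) ^ 2 := mul_nonneg (by linarith) (by positivity)
      nlinarith
    have e1 : ((2 * (K:ℝ)) + 1) * (2 * K + b + 1) - 2 * K * (2 * K + 1) / 2 ≤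
        2 * K ^ 2 + 20 * (ε * K ^ 2) := by nlinarith
    have hp : 0 ≤ ε * (K:ℝ) ^ 2 := by positivity
    have hp2 : 0 ≤ ε * (ε * (K:ℝ) ^ 2) := by positivity
    nlinarith
  have hcorr := le_sum_mul_shift (m := m) hχb (by omega) (by omega) hΔ
  -- difference between fine and coarse values
  set d : ℕ → ℝ := fun i => |r (2 * i) - R i| with hd
  have hd2 : ∑ i ∈ range K, d i ^ 2 ≤ 13 * ε * K := by
    have : ∀ i ∈ range K, d i ^ 2 ≤ (1 - R i ^ 2) + 3 * ε := by
      intro i _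
      simp only [hd, sq_abs, hR]
      have a : r (2 * i) ^ 2 ≤ (1 + ε) ^ 2 := sq_le_sq' (abs_le.mp (hr _)).1 (abs_le.mp (hr _)).2
      have b : r (2 * i + 1) ^ 2 ≤ (1 + ε) ^ 2 :=
        sq_le_sq' (abs_le.mp (hr _)).1 (abs_le.mp (hr _)).2
      nlinarith
    have := sum_le_sum this
    rw [sum_add_distrib] at this
    simp only [sum_const, card_range, nsmul_eq_mul] at this
    linarith
  have hd1 : ∑ i ∈ range K, d i ≤ K / 200 := by
    have : ∀ i ∈ range K, d i ≤ 1 / 1000 + 250 * d i ^ 2 := fun i _ => by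
      nlinarith [sq_nonneg (d i - 1 / 500)]
    have := sum_le_sum this
    rw [sum_add_distrib, ← mul_sum] at this
    simp only [sum_const, card_range, nsmul_eq_mul] at this
    nlinarith
  have hd0 : ∀ i, 0 ≤ d i := fun i => abs_nonneg _
  have hprod : ∀ i j, χ (2 * i) * χ (2 * j) ≤ R i * R j + 2 * (d i + d j) + 3 * ε := by
    intro i j
    have e : χ (2 * i) * χ (2 * j) * (1 + ε) ^ 2 = R i * R j + (r (2 * i) - R i) * r (2 * j) +
        R i * (r (2 * j) - R j) := by simp only [hχ]; field_simp; ring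
    have a1 : |(r (2 * i) - R i) * r (2 * j)| ≤ d i * (1 + ε) := by
      rw [abs_mul]; exact mul_le_mul_of_nonneg_left (hr _) (hd0 i)
    have a2 : |R i * (r (2 * j) - R j)| ≤ (1 + ε) * d j := by
      rw [abs_mul]; exact mul_le_mul_of_nonneg_right (hRb _) (hd0 j)
    have b1 := (abs_le.mp a1).2
    have b2 := (abs_le.mp a2).2
    have c := hχb (2 * i)
    have c2 : |χ (2 * i) * χ (2 * j)| ≤ 1 := by
      rw [abs_mul]; exact mul_le_one₀ (hχb _) (abs_nonneg _) (hχb _)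
    have c3 := (abs_le.mp c2).1
    have c4 : -1 * (2 * ε + ε ^ 2) ≤ χ (2 * i) * χ (2 * j) * (2 * ε + ε ^ 2) :=
      mul_le_mul_of_nonneg_right c3 (by positivity)
    have c5 : ε ^ 2 ≤ ε := by nlinarith
    have c6 : d i * (1 + ε) ≤ d i * 2 := mul_le_mul_of_nonneg_left (by linarith) (hd0 i)
    have c7 : (1 + ε) * d j ≤ 2 * d j := mul_le_mul_of_nonneg_right (by linarith) (hd0 j)
    have c8 : χ (2 * i) * χ (2 * j) * (1 + ε) ^ 2 = χ (2 * i) * χ (2 * j) +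
      χ (2 * i) * χ (2 * j) * (2 * ε + ε ^ 2) := by ring
    linarith
  have hsum : ∑ v ∈ range m, ∑ h ∈ range m, χ (2 * v) * χ (2 * (v + h)) ≤
      ∑ v ∈ range m, ∑ h ∈ range m, (R v * R (v + h) + 2 * (d v + d (v + h)) + 3 * ε) :=
    sum_le_sum fun v _ => sum_le_sum fun h _ => hprod _ _
  simp only [sum_add_distrib, ← mul_sum, sum_const, card_range, nsmul_eq_mul] at hsum
  have hRR : ∑ v ∈ range m, R v * ∑ h ∈ range m, R (v + h) ≤ m * (2 * (2 * ε * K)) := by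
    have : ∀ v ∈ range m, R v * ∑ h ∈ range m, R (v + h) ≤ 2 * (2 * ε * K) := by
      intro v hv
      have hv := mem_range.mp hv
      have s1 := abs_le.mp (h1 (v + m) (by omega))
      have s2 := abs_le.mp (h1 v (by omega))
      rw [sum_range_add] at s1
      have : |∑ h ∈ range m, R (v + h)| ≤ 2 * ε * K := by
        rw [abs_le]; simp only [hR]; constructor <;> linarith
      refine (le_abs_self _).trans ?_
      rw [abs_mul]
      exact mul_le_mul ((hRb v).trans (by linarith)) this (abs_nonneg _) (by norm_num)
    have := sum_le_sum this
    simpa using this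
  have hdm : ∑ i ∈ range m, d i ≤ K / 200 :=
    (sum_le_sum_of_subset_of_nonneg (range_subset_range.mpr (by omega)) fun i _ _ => hd0 i).trans hd1
  have hdm2 : ∑ v ∈ range m, ∑ h ∈ range m, d (v + h) ≤ m * (K / 200) := by
    have : ∀ v ∈ range m, ∑ h ∈ range m, d (v + h) ≤ K / 200 := by
      intro v hv
      have hv := mem_range.mp hv
      have := sum_range_add d v m
      have h0 : 0 ≤ ∑ i ∈ range v, d i := sum_nonneg fun i _ => hd0 i
      have : ∑ i ∈ range (v + m), d i ≤ ∑ i ∈ range K, d i :=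
        sum_le_sum_of_subset_of_nonneg (range_subset_range.mpr (by omega)) fun i _ _ => hd0 i
      linarith
    have := sum_le_sum this
    simpa using this
  have hm0 : (0 : ℝ) ≤ m := Nat.cast_nonneg m
  have hεK : ε * K ^ 2 ≤ K ^ 2 / 1000000 := by nlinarith [sq_nonneg (K : ℝ)]
  have q1 : (m : ℝ) * (2 * (2 * ε * K)) ≤ K / 4 * (2 * (2 * ε * K)) := by gcongr
  have q2 : (m : ℝ) * (K / 200) ≤ K / 4 * (K / 200) := by gcongr
  have q3 : (m : ℝ) * (m * (3 * ε)) ≤ K / 4 * (K / 4 * (3 * ε)) := by gcongr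
  have q4 : (m : ℝ) * ∑ i ∈ range m, d i ≤ K / 4 * (K / 200) := by gcongr
  have q5 : ((K : ℝ) * (24 / 100)) ^ 2 ≤ m ^ 2 := by
    gcongr; linarith
  simp only [← mul_sum] at hcorr
  have : 0 ≤ (K : ℝ) ^ 2 := by positivity
  nlinarith

section ElementaryEstimates

open scoped ArithmeticFunction.vonMangoldt ArithmeticFunction.zeta ArithmeticFunction.Moebius
open scoped Nat

lemma log_factorial_le {n : ℕ} (hn : 1 ≤ n) :
    Real.log n ! ≤ n * Real.log n - n + Real.log n + 1 := by
  induction n, hn using Nat.le_induction with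
  | base => simp
  | succ n hn ih =>
    have hn' : (0 : ℝ) < n := by exact_mod_cast hn
    rw [Nat.factorial_succ, Nat.cast_mul, Real.log_mul (by positivity) (by positivity)]
    have h := Real.one_sub_inv_le_log_of_pos (x := ((n + 1 : ℕ) : ℝ) / n) (by positivity)
    rw [Real.log_div (by positivity) (by positivity)] at h
    push_cast at h ⊢
    have e : 1 - ((n + 1 : ℝ) / n)⁻¹ = 1 / (n + 1) := by field_simp; ring
    rw [e] at h
    have : ((n : ℝ) + 1) * (1 / (n + 1)) ≤ (n + 1) * (Real.log (n + 1) - Real.log n) := by gcongr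
    rw [mul_one_div_cancel (by positivity)] at this
    linarith

lemma le_log_factorial {n : ℕ} (hn : 1 ≤ n) : n * Real.log n - n ≤ Real.log n ! := by
  have h := Stirling.le_log_factorial_stirling (n := n) (by omega)
  have : 0 ≤ Real.log n := Real.log_natCast_nonneg n
  have : 0 ≤ Real.log (2 * Real.pi) := Real.log_nonneg (by linarith [Real.pi_gt_three])
  linarith

lemma abs_sum_inv_sub_log_le {n : ℕ} (hn : 1 ≤ n) :
    |∑ k ∈ Ioc 0 n, (1 / k : ℝ) - Real.log n - Real.eulerMascheroniConstant| ≤ 1 / n := by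
  have hn' : (0 : ℝ) < n := by exact_mod_cast hn
  have e : ∑ k ∈ Ioc 0 n, (1 / k : ℝ) = harmonic n := by
    rw [harmonic_eq_sum_Icc]; push_cast
    exact sum_congr (by ext; simp; omega) fun _ _ => by simp
  have h1 := Real.eulerMascheroniSeq_lt_eulerMascheroniConstant n
  have h2 := Real.eulerMascheroniConstant_lt_eulerMascheroniSeq' n
  simp only [Real.eulerMascheroniSeq, Real.eulerMascheroniSeq'] at h1 h2
  rw [if_neg (by omega)] at h2
  have h := Real.log_le_sub_one_of_pos (x := ((n + 1 : ℕ) : ℝ) / n) (by positivity)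
  rw [Real.log_div (by positivity) (by positivity)] at h
  have e2 : ((n + 1 : ℕ) : ℝ) / n - 1 = 1 / n := by push_cast; field_simp; ring
  rw [e2] at h
  push_cast at h
  rw [e, abs_le]
  constructor <;> linarith

lemma sum_vonMangoldt_mul_div (N : ℕ) :
    ∑ n ∈ Ioc 0 N, Λ n * ((N / n : ℕ) : ℝ) = Real.log N ! := by
  rw [← ArithmeticFunction.sum_Ioc_mul_zeta_eq_sum, ArithmeticFunction.vonMangoldt_mul_zeta]
  induction N with
  | zero => simp
  | succ n ih =>
    rw [Finset.sum_Ioc_succ_top (Nat.zero_le n), ih, Nat.factorial_succ, Nat.cast_mul,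
      Real.log_mul (by positivity) (by positivity), add_comm]
    rfl

lemma psi_natCast (N : ℕ) : Chebyshev.psi N = ∑ n ∈ Ioc 0 N, Λ n := by
  simp [Chebyshev.psi]

lemma psi_le_six_mul {x : ℝ} (hx : 0 ≤ x) : Chebyshev.psi x ≤ 6 * x := by
  refine (Chebyshev.psi_le_const_mul_self hx).trans ?_
  have : Real.log 4 = 2 * Real.log 2 := by
    rw [show (4 : ℝ) = 2 ^ 2 by norm_num, Real.log_pow]; norm_num
  have := Real.log_two_lt_d9
  gcongr
  linarith

lemma abs_sum_vonMangoldt_div_sub_log_le {N : ℕ} (hN : 1 ≤ N) :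
    |∑ n ∈ Ioc 0 N, Λ n / n - Real.log N| ≤ 6 := by
  have hN' : (0 : ℝ) < N := by exact_mod_cast hN
  have h := sum_vonMangoldt_mul_div N
  have up : ∑ n ∈ Ioc 0 N, Λ n * ((N / n : ℕ) : ℝ) ≤ N * ∑ n ∈ Ioc 0 N, Λ n / n := by
    rw [mul_sum]
    refine sum_le_sum fun n hn => ?_
    calc _ ≤ Λ n * ((N : ℝ) / n) :=
          mul_le_mul_of_nonneg_left Nat.cast_div_le ArithmeticFunction.vonMangoldt_nonneg
      _ = _ := by ring
  have lo : N * ∑ n ∈ Ioc 0 N, Λ n / n ≤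
      ∑ n ∈ Ioc 0 N, Λ n * ((N / n : ℕ) : ℝ) + Chebyshev.psi N := by
    rw [mul_sum, psi_natCast, ← sum_add_distrib]
    refine sum_le_sum fun n hn => ?_
    have : (N : ℝ) / n ≤ ((N / n : ℕ) : ℝ) + 1 := by
      rw [← Nat.floor_div_eq_div (K := ℝ)]; exact (Nat.lt_floor_add_one _).le
    calc _ = Λ n * ((N : ℝ) / n) := by ring
      _ ≤ Λ n * (((N / n : ℕ) : ℝ) + 1) :=
          mul_le_mul_of_nonneg_left this ArithmeticFunction.vonMangoldt_nonneg
      _ = _ := by ring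
  have hψ := psi_le_six_mul hN'.le
  have h1 := le_log_factorial hN
  have h2 : Real.log N ! ≤ N * Real.log N := by
    have : ((N ! : ℕ) : ℝ) ≤ (N : ℝ) ^ N := by exact_mod_cast Nat.factorial_le_pow N
    simpa using Real.log_le_log (by positivity) this
  rw [h] at up lo
  have a : (N : ℝ) * (∑ n ∈ Ioc 0 N, Λ n / n - Real.log N) ≤ N * 6 := by linarith
  have b : (N : ℝ) * (-6) ≤ N * (∑ n ∈ Ioc 0 N, Λ n / n - Real.log N) := by linarith
  exact abs_le.mpr ⟨le_of_mul_le_mul_left b hN', le_of_mul_le_mul_left a hN'⟩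

lemma sum_psi_div (y : ℝ) :
    ∑ n ∈ Ioc 0 ⌊y⌋₊, Chebyshev.psi (y / n) = Real.log ⌊y⌋₊ ! := by
  rw [← sum_vonMangoldt_mul_div, ← ArithmeticFunction.sum_Ioc_mul_zeta_eq_sum, mul_comm,
    ArithmeticFunction.sum_Ioc_mul_eq_sum_sum]
  refine sum_congr rfl fun n hn => ?_
  simp only [Chebyshev.psi]
  rw [Nat.floor_div_natCast]
  simp [ArithmeticFunction.natCoe_apply, ArithmeticFunction.zeta_apply,
    (mem_Ioc.mp hn).1.ne']

/-- `ψ y - y + γ + 1`, whose sums over `y / n` are logarithmically small. -/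
noncomputable def psiErr (y : ℝ) : ℝ := Chebyshev.psi y - y + Real.eulerMascheroniConstant + 1

lemma abs_sum_psiErr_le {y : ℝ} (hy : 1 ≤ y) :
    |∑ n ∈ Ioc 0 ⌊y⌋₊, psiErr (y / n)| ≤ 2 * Real.log y + 5 := by
  set m := ⌊y⌋₊ with hm
  have hm1 : 1 ≤ m := Nat.le_floor (by simpa using hy)
  have hm0 : (0 : ℝ) < m := by exact_mod_cast hm1
  have hmy : (m : ℝ) ≤ y := Nat.floor_le (by linarith)
  have hym : y < m + 1 := Nat.lt_floor_add_one y
  have e : ∑ n ∈ Ioc 0 m, psiErr (y / n) = Real.log m ! - y * ∑ k ∈ Ioc 0 m, (1 / k : ℝ) +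
      (Real.eulerMascheroniConstant + 1) * m := by
    rw [hm, ← sum_psi_div y, mul_sum, ← sum_sub_distrib]
    have : (Real.eulerMascheroniConstant + 1) * (⌊y⌋₊ : ℝ) =
      ∑ n ∈ Ioc 0 ⌊y⌋₊, (Real.eulerMascheroniConstant + 1) := by
      rw [sum_const, Nat.card_Ioc, nsmul_eq_mul, Nat.sub_zero, mul_comm]
    rw [this, ← sum_add_distrib]
    refine sum_congr rfl fun n _ => ?_
    unfold psiErr; ring
  have hH := abs_sum_inv_sub_log_le hm1
  set D := ∑ k ∈ Ioc 0 m, (1 / k : ℝ) - Real.log m - Real.eulerMascheroniConstant with hD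
  have eD : ∑ k ∈ Ioc 0 m, (1 / k : ℝ) = D + Real.log m + Real.eulerMascheroniConstant := by
    rw [hD]; ring
  rw [e, eD]
  have f1 := le_log_factorial hm1
  have f2 := log_factorial_le hm1
  have hl0 : 0 ≤ Real.log m := Real.log_natCast_nonneg m
  have hly : Real.log m ≤ Real.log y := Real.log_le_log hm0 hmy
  have hyD : |y * D| ≤ 2 := by
    rw [abs_mul, abs_of_nonneg (by linarith)]
    have : (1 : ℝ) ≤ m := by exact_mod_cast hm1
    calc y * |D| ≤ (m + m) * (1 / m) := by gcongr; linarith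
      _ = 2 := by field_simp; norm_num
  have hyD' := abs_le.mp hyD
  have g1 := Real.one_half_lt_eulerMascheroniConstant
  have g2 := Real.eulerMascheroniConstant_lt_two_thirds
  set γ := Real.eulerMascheroniConstant
  have t1 : 0 ≤ (y - m) * Real.log m := mul_nonneg (by linarith) hl0
  have t2 : (y - m) * Real.log m ≤ Real.log m := by
    have := mul_le_mul_of_nonneg_right (show y - m ≤ 1 by linarith) hl0
    linarith
  have t3 : 0 ≤ (y - m) * γ := mul_nonneg (by linarith) (by linarith)
  have t4 : (y - m) * γ ≤ 1 := by nlinarith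
  rw [abs_le]
  constructor <;> nlinarith

lemma log_le_four_mul_rpow {x : ℝ} (hx : 0 ≤ x) : Real.log x ≤ 4 * x ^ (1 / 4 : ℝ) := by
  have := Real.log_le_rpow_div hx (show (0 : ℝ) < 1 / 4 by norm_num)
  linarith

lemma log_sq_le {x : ℝ} (hx : 1 ≤ x) : Real.log x ^ 2 ≤ 16 * √x := by
  have h := log_le_four_mul_rpow (x := x) (by linarith)
  have h0 := Real.log_nonneg hx
  calc Real.log x ^ 2 ≤ (4 * x ^ (1 / 4 : ℝ)) ^ 2 := by gcongr
    _ = 16 * √x := by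
      rw [mul_pow, ← Real.rpow_natCast (x ^ (1 / 4 : ℝ)), ← Real.rpow_mul (by linarith),
        Real.sqrt_eq_rpow]
      norm_num

lemma sum_sqrt_div_le (N : ℕ) : ∑ d ∈ Ioc 0 N, √((N : ℝ) / d) ≤ 2 * N := by
  have h : ∀ M : ℕ, ∑ d ∈ Ioc 0 M, 1 / √(d : ℝ) ≤ 2 * √M := by
    intro M
    induction M with
    | zero => simp
    | succ M ih =>
      rw [sum_Ioc_succ_top (Nat.zero_le M)]
      have h1 : (0 : ℝ) < √((M + 1 : ℕ) : ℝ) := by positivity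
      have h2 : √((M + 1 : ℕ) : ℝ) ^ 2 = M + 1 := by
        rw [Real.sq_sqrt (by positivity)]; push_cast; ring
      have h3 : √(M : ℝ) ^ 2 = M := Real.sq_sqrt (by positivity)
      have h4 : 1 / √((M + 1 : ℕ) : ℝ) ≤ 2 * (√((M + 1 : ℕ) : ℝ) - √M) := by
        rw [div_le_iff₀ h1]
        nlinarith [sq_nonneg (√((M + 1 : ℕ) : ℝ) - √M)]
      linarith
  calc _ = √N * ∑ d ∈ Ioc 0 N, 1 / √(d : ℝ) := by
        rw [mul_sum]; exact sum_congr rfl fun d _ => by rw [Real.sqrt_div (by positivity)]; ring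
    _ ≤ √N * (2 * √N) := by gcongr; exact h N
    _ = 2 * N := by
        have : √(N : ℝ) * √N = N := Real.mul_self_sqrt (by positivity)
        linarith

/-- Selberg's function `Λ log + Λ * Λ`. -/
noncomputable def selbergFn (n : ℕ) : ℝ :=
  Λ n * Real.log n + (ArithmeticFunction.vonMangoldt * ArithmeticFunction.vonMangoldt) n

lemma selbergFn_nonneg (n : ℕ) : 0 ≤ selbergFn n := by
  unfold selbergFn
  rw [ArithmeticFunction.mul_apply]
  exact add_nonneg (mul_nonneg ArithmeticFunction.vonMangoldt_nonneg (Real.log_natCast_nonneg n))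
    (sum_nonneg fun _ _ => mul_nonneg ArithmeticFunction.vonMangoldt_nonneg
      ArithmeticFunction.vonMangoldt_nonneg)

lemma sum_Ioc_sum_Ioc_div (g : ℕ → ℕ → ℝ) (N : ℕ) :
    ∑ d ∈ Ioc 0 N, ∑ n ∈ Ioc 0 (N / d), g d (d * n) =
      ∑ k ∈ Ioc 0 N, ∑ d ∈ k.divisors, g d k := by
  rw [sum_sigma', sum_sigma']
  refine sum_bij' (fun x _ => ⟨x.1 * x.2, x.1⟩) (fun x _ => ⟨x.2, x.1 / x.2⟩) ?_ ?_ ?_ ?_ ?_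
  · rintro ⟨d, n⟩ h
    simp only [mem_sigma, mem_Ioc] at h ⊢
    have := Nat.mul_le_of_le_div _ _ _ h.2.2
    rw [mul_comm] at this
    refine ⟨⟨Nat.mul_pos h.1.1 h.2.1, this⟩, ?_⟩
    rw [Nat.mem_divisors]
    exact ⟨dvd_mul_right _ _, (Nat.mul_pos h.1.1 h.2.1).ne'⟩
  · rintro ⟨k, d⟩ h
    simp only [mem_sigma, mem_Ioc, Nat.mem_divisors] at h ⊢
    have hd := Nat.le_of_dvd h.1.1 h.2.1
    have hd0 := Nat.pos_of_dvd_of_pos h.2.1 h.1.1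
    exact ⟨⟨hd0, hd.trans h.1.2⟩, Nat.div_pos hd hd0, Nat.div_le_div_right h.1.2⟩
  · rintro ⟨d, n⟩ h
    simp only [mem_sigma, mem_Ioc] at h
    simp [Nat.mul_div_cancel_left _ h.1.1]
  · rintro ⟨k, d⟩ h
    simp only [mem_sigma, mem_Ioc, Nat.mem_divisors] at h
    simp [Nat.mul_div_cancel' h.2.1]
  · rintro ⟨d, n⟩ h
    rfl

lemma sum_divisors_moebius_mul_log_div {N : ℝ} (hN : 0 < N) (k : ℕ) :
    ∑ d ∈ k.divisors, (μ d : ℝ) * Real.log (N / d) =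
      (if k = 1 then Real.log N else 0) + Λ k := by
  have h1 : ∑ d ∈ k.divisors, (μ d : ℝ) = if k = 1 then 1 else 0 := by
    have := congrArg (fun f => f k) (ArithmeticFunction.coe_moebius_mul_coe_zeta (R := ℝ))
    simp only [ArithmeticFunction.coe_mul_zeta_apply, ArithmeticFunction.one_apply,
      ArithmeticFunction.intCoe_apply] at this
    exact this
  have h2 := ArithmeticFunction.sum_moebius_mul_log_eq (n := k)
  have : ∀ d ∈ k.divisors, (μ d : ℝ) * Real.log (N / d) =
      (μ d : ℝ) * Real.log N - (μ d : ℝ) * Real.log d := by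
    intro d hd
    have : 0 < d := Nat.pos_of_mem_divisors hd
    rw [Real.log_div hN.ne' (by positivity)]; ring
  rw [sum_congr rfl this, sum_sub_distrib, ← sum_mul, h1]
  simp only [ArithmeticFunction.log_apply] at h2
  rw [h2]
  split_ifs <;> simp

lemma log_natCast_div_le_sum {n N : ℕ} (hn : 0 < n) (hN : n ≤ N) :
    Real.log ((N : ℝ) / n) ≤ ∑ m ∈ Ico n N, 1 / (m : ℝ) := by
  induction N, hN using Nat.le_induction with
  | base => rw [div_self (by positivity)]; simp
  | succ N hN ih =>
    rw [sum_Ico_succ_top hN]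
    have hN0 : (0 : ℝ) < N := by exact_mod_cast hn.trans_le hN
    have hn0 : (0 : ℝ) < n := by exact_mod_cast hn
    rw [Real.log_div (by positivity) (by positivity)] at ih ⊢
    have h := Real.log_le_sub_one_of_pos (x := ((N + 1 : ℕ) : ℝ) / N) (by positivity)
    rw [Real.log_div (by positivity) (by positivity)] at h
    have e2 : ((N + 1 : ℕ) : ℝ) / N - 1 = 1 / N := by push_cast; field_simp; ring
    rw [e2] at h
    linarith

lemma sum_vonMangoldt_mul_log_div_le (N : ℕ) :
    ∑ n ∈ Ioc 0 N, Λ n * Real.log ((N : ℝ) / n) ≤ 6 * N := by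
  calc _ ≤ ∑ n ∈ Ioc 0 N, ∑ m ∈ Ico n N, Λ n * (1 / (m : ℝ)) := by
        refine sum_le_sum fun n hn => ?_
        rw [← mul_sum]
        exact mul_le_mul_of_nonneg_left
          (log_natCast_div_le_sum (mem_Ioc.mp hn).1 (mem_Ioc.mp hn).2)
          ArithmeticFunction.vonMangoldt_nonneg
    _ = ∑ m ∈ Ico 1 N, ∑ n ∈ Ioc 0 m, Λ n * (1 / (m : ℝ)) := by
        refine sum_comm' fun x y => ?_
        simp only [mem_Ioc, mem_Ico]; omega
    _ ≤ ∑ m ∈ Ico 1 N, (6 : ℝ) := by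
        refine sum_le_sum fun m hm => ?_
        have hm0 : (0 : ℝ) < m := by exact_mod_cast (mem_Ico.mp hm).1
        rw [← sum_mul, ← psi_natCast, mul_one_div, div_le_iff₀ hm0]
        exact psi_le_six_mul hm0.le
    _ ≤ 6 * N := by
        rw [sum_const, Nat.card_Ico, nsmul_eq_mul, mul_comm]
        have : ((N - 1 : ℕ) : ℝ) ≤ N := by exact_mod_cast Nat.sub_le N 1
        linarith

lemma abs_sum_mul_psiErr_le {N : ℕ} (hN : 1 ≤ N) :
    |psiErr N * Real.log N + ∑ k ∈ Ioc 0 N, Λ k * psiErr (N / k)| ≤ 500 * N := by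
  have hN0 : (0 : ℝ) < N := by exact_mod_cast hN
  have e : ∑ d ∈ Ioc 0 N, ∑ n ∈ Ioc 0 (N / d),
      ((μ d : ℝ) * Real.log (N / d)) * psiErr (N / (d * n : ℕ)) =
      psiErr N * Real.log N + ∑ k ∈ Ioc 0 N, Λ k * psiErr (N / k) := by
    rw [sum_Ioc_sum_Ioc_div (fun d k => ((μ d : ℝ) * Real.log (N / d)) * psiErr (N / k))]
    have : ∀ k ∈ Ioc 0 N, ∑ d ∈ k.divisors, ((μ d : ℝ) * Real.log (N / d)) * psiErr (N / k) =
        (if k = 1 then Real.log N * psiErr (N / k) else 0) + Λ k * psiErr (N / k) := by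
      intro k hk
      rw [← sum_mul, sum_divisors_moebius_mul_log_div hN0]
      split_ifs <;> ring
    rw [sum_congr rfl this, sum_add_distrib, sum_ite_eq' (Ioc 0 N) 1]
    simp [hN, mul_comm]
  rw [← e]
  have hb : ∀ d ∈ Ioc 0 N, |∑ n ∈ Ioc 0 (N / d),
      ((μ d : ℝ) * Real.log (N / d)) * psiErr (N / (d * n : ℕ))| ≤ 52 * √((N : ℝ) / d) := by
    intro d hd
    obtain ⟨hd0, hdN⟩ := mem_Ioc.mp hd
    have hd0' : (0 : ℝ) < d := by exact_mod_cast hd0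
    have hy : 1 ≤ (N : ℝ) / d := by rw [le_div_iff₀ hd0']; simpa using hdN
    rw [← mul_sum, abs_mul, abs_mul]
    have h1 : |(μ d : ℝ)| ≤ 1 := by exact_mod_cast ArithmeticFunction.abs_moebius_le_one
    have h2 := abs_sum_psiErr_le hy
    rw [Nat.floor_div_eq_div] at h2
    have h3 : ∑ n ∈ Ioc 0 (N / d), psiErr ((N : ℝ) / d / n) =
        ∑ n ∈ Ioc 0 (N / d), psiErr (N / (d * n : ℕ)) :=
      sum_congr rfl fun n _ => by rw [div_div]; push_cast; rfl
    rw [h3] at h2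
    have hl := Real.log_nonneg hy
    have hl2 := log_sq_le hy
    have hl1 : Real.log ((N : ℝ) / d) ≤ 2 * √((N : ℝ) / d) := by
      have := Real.log_le_rpow_div (x := (N : ℝ) / d) (by linarith)
        (show (0 : ℝ) < 1 / 2 by norm_num)
      rw [← Real.sqrt_eq_rpow] at this
      linarith
    rw [abs_of_nonneg hl]
    calc |(μ d : ℝ)| * Real.log (N / d) * |∑ n ∈ Ioc 0 (N / d), psiErr (N / (d * n : ℕ))| ≤
          1 * Real.log (N / d) * (2 * Real.log (N / d) + 5) := by gcongr
      _ = 2 * Real.log (N / d) ^ 2 + 5 * Real.log (N / d) := by ring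
      _ ≤ _ := by linarith [Real.sqrt_nonneg ((N : ℝ) / d)]
  refine (abs_sum_le_sum_abs _ _).trans ((sum_le_sum hb).trans ?_)
  rw [← mul_sum]
  linarith [sum_sqrt_div_le N]

/-- Selberg's symmetry formula. -/
theorem abs_sum_selbergFn_sub_le {N : ℕ} (hN : 1 ≤ N) :
    |∑ n ∈ Ioc 0 N, selbergFn n - 2 * N * Real.log N| ≤ 600 * N := by
  have hN0 : (0 : ℝ) < N := by exact_mod_cast hN
  have hN1 : (1 : ℝ) ≤ N := by exact_mod_cast hN
  have h1 := abs_le.mp (abs_sum_mul_psiErr_le hN)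
  have h2 := abs_le.mp (abs_sum_vonMangoldt_div_sub_log_le hN)
  have h3 := sum_vonMangoldt_mul_log_div_le N
  have e1 : ∑ n ∈ Ioc 0 N, Λ n * Real.log ((N : ℝ) / n) =
      Chebyshev.psi N * Real.log N - ∑ n ∈ Ioc 0 N, Λ n * Real.log n := by
    rw [psi_natCast, sum_mul, ← sum_sub_distrib]
    refine sum_congr rfl fun n hn => ?_
    have : (0 : ℝ) < n := by exact_mod_cast (mem_Ioc.mp hn).1
    rw [Real.log_div (by positivity) (by positivity)]; ring
  have h3' : 0 ≤ ∑ n ∈ Ioc 0 N, Λ n * Real.log ((N : ℝ) / n) := by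
    refine sum_nonneg fun n hn => mul_nonneg ArithmeticFunction.vonMangoldt_nonneg
      (Real.log_nonneg ?_)
    obtain ⟨hd0, hdN⟩ := mem_Ioc.mp hn
    rw [le_div_iff₀ (by exact_mod_cast hd0)]; simpa using hdN
  have e2 : ∑ n ∈ Ioc 0 N, (ArithmeticFunction.vonMangoldt * ArithmeticFunction.vonMangoldt) n =
      ∑ k ∈ Ioc 0 N, Λ k * Chebyshev.psi (N / k) := by
    rw [ArithmeticFunction.sum_Ioc_mul_eq_sum_sum]
    refine sum_congr rfl fun n _ => ?_
    simp only [Chebyshev.psi]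
    rw [Nat.floor_div_eq_div]
  have e3 : ∑ k ∈ Ioc 0 N, Λ k * psiErr (N / k) = ∑ k ∈ Ioc 0 N, Λ k * Chebyshev.psi (N / k) -
      N * ∑ n ∈ Ioc 0 N, Λ n / n + (Real.eulerMascheroniConstant + 1) * Chebyshev.psi N := by
    rw [psi_natCast, mul_sum, mul_sum, ← sum_sub_distrib, ← sum_add_distrib]
    refine sum_congr rfl fun n _ => ?_
    unfold psiErr; ring
  have e4 : ∑ n ∈ Ioc 0 N, selbergFn n = ∑ n ∈ Ioc 0 N, Λ n * Real.log n +
      ∑ k ∈ Ioc 0 N, Λ k * Chebyshev.psi (N / k) := by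
    rw [← e2, ← sum_add_distrib]; rfl
  have hψ := psi_le_six_mul hN0.le
  have hψ0 := Chebyshev.psi_nonneg (N : ℝ)
  have g1 := Real.one_half_lt_eulerMascheroniConstant
  have g2 := Real.eulerMascheroniConstant_lt_two_thirds
  have hl0 : 0 ≤ Real.log N := Real.log_nonneg hN1
  have hl1 : Real.log N ≤ N := Real.log_le_self hN0.le
  rw [e3] at h1
  rw [e4]
  unfold psiErr at h1
  set γ := Real.eulerMascheroniConstant
  have a1 : 0 ≤ (γ + 1) * Chebyshev.psi N := mul_nonneg (by linarith) hψ0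
  have a2 : (γ + 1) * Chebyshev.psi N ≤ 2 * (6 * N) := by gcongr; linarith
  have a3 : 0 ≤ (γ + 1) * Real.log N := mul_nonneg (by linarith) hl0
  have a4 : (γ + 1) * Real.log N ≤ 2 * N := by gcongr; linarith
  have a5 : N * (∑ n ∈ Ioc 0 N, Λ n / n - Real.log N) ≤ N * 6 := by gcongr; exact h2.2
  have a6 : (N : ℝ) * (-6) ≤ N * (∑ n ∈ Ioc 0 N, Λ n / n - Real.log N) := by gcongr; exact h2.1
  rw [abs_le]
  constructor <;> nlinarith

end ElementaryEstimates

section SelbergSieve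

open scoped ArithmeticFunction.Moebius Nat

lemma sum_divisors_filter_dvd_moebius {f r : ℕ} (hr : Squarefree r) (hf : f ∣ r) :
    ∑ d ∈ r.divisors with f ∣ d, (μ d : ℝ) = if r = f then (μ f : ℝ) else 0 := by
  obtain ⟨m, rfl⟩ := hf
  have hr0 : f * m ≠ 0 := hr.ne_zero
  have hf0 : 0 < f := Nat.pos_of_ne_zero (left_ne_zero_of_mul hr0)
  have hm0 : m ≠ 0 := right_ne_zero_of_mul hr0
  have hcop : f.Coprime m := Nat.coprime_of_squarefree_mul hr
  have himg : {d ∈ (f * m).divisors | f ∣ d} = m.divisors.image (f * ·) := by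
    ext d
    simp only [mem_filter, Nat.mem_divisors, mem_image]
    constructor
    · rintro ⟨⟨h1, -⟩, e, rfl⟩
      exact ⟨e, ⟨Nat.dvd_of_mul_dvd_mul_left hf0 h1, hm0⟩, rfl⟩
    · rintro ⟨e, ⟨he, -⟩, rfl⟩
      exact ⟨⟨mul_dvd_mul_left f he, hr0⟩, dvd_mul_right _ _⟩
  rw [himg, sum_image fun a _ b _ h => Nat.eq_of_mul_eq_mul_left hf0 h]
  have h1 : ∀ e ∈ m.divisors, (μ (f * e) : ℝ) = μ f * μ e := fun e he => by
    rw [ArithmeticFunction.isMultiplicative_moebius.map_mul_of_coprime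
      (hcop.coprime_dvd_right (Nat.dvd_of_mem_divisors he))]
    push_cast; ring
  rw [sum_congr rfl h1, ← mul_sum]
  have h2 : ∑ e ∈ m.divisors, (μ e : ℝ) = if m = 1 then 1 else 0 := by
    have := congrArg (fun g : ArithmeticFunction ℤ => g m)
      ArithmeticFunction.moebius_mul_coe_zeta
    simp only [ArithmeticFunction.coe_mul_zeta_apply, ArithmeticFunction.one_apply] at this
    exact_mod_cast this
  rw [h2]
  have h3 : f * m = f ↔ m = 1 := by
    constructor
    · intro h
      exact Nat.eq_of_mul_eq_mul_left hf0 (by rw [h, mul_one])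
    · rintro rfl; simp
  simp [h3]

/-- The sum of `1/φ(r)` over `s`. -/
noncomputable def selbergSum (s : Finset ℕ) : ℝ := ∑ r ∈ s, 1 / (φ r : ℝ)

/-- The Selberg weights supported on `s`. -/
noncomputable def selbergWeight (s : Finset ℕ) (d : ℕ) : ℝ :=
  d * μ d / selbergSum s * ∑ r ∈ s with d ∣ r, 1 / (φ r : ℝ)

variable {s : Finset ℕ}

lemma selbergSum_pos (h1 : 1 ∈ s) : 0 < selbergSum s :=
  lt_of_lt_of_le (by simp) (single_le_sum (f := fun r => 1 / (φ r : ℝ))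
    (fun i _ => by positivity) h1)

lemma selbergWeight_one (h1 : 1 ∈ s) : selbergWeight s 1 = 1 := by
  have := (selbergSum_pos h1).ne'
  simp only [selbergWeight, one_dvd, filter_true, Nat.cast_one]
  rw [← selbergSum]
  simp [this]

lemma abs_selbergWeight_le (h1 : 1 ∈ s) (d : ℕ) : |selbergWeight s d| ≤ d := by
  have h := selbergSum_pos h1
  have h2 : ∑ r ∈ s with d ∣ r, 1 / (φ r : ℝ) ≤ selbergSum s :=
    sum_le_sum_of_subset_of_nonneg (filter_subset _ _) fun _ _ _ => by positivity
  have h3 : 0 ≤ ∑ r ∈ s with d ∣ r, 1 / (φ r : ℝ) := sum_nonneg fun _ _ => by positivity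
  have h4 : |(μ d : ℝ)| ≤ 1 := by exact_mod_cast ArithmeticFunction.abs_moebius_le_one
  rw [selbergWeight, abs_mul, abs_div, abs_mul, Nat.abs_cast, abs_of_pos h, abs_of_nonneg h3,
    div_mul_eq_mul_div, div_le_iff₀ h]
  nlinarith [mul_le_mul_of_nonneg_left h4 (Nat.cast_nonneg (α := ℝ) d), Nat.cast_nonneg (α := ℝ) d,
    mul_nonneg (Nat.cast_nonneg (α := ℝ) d) (abs_nonneg (μ d : ℝ))]

lemma sum_selbergWeight_div (hsq : ∀ d ∈ s, Squarefree d) (hdiv : ∀ d ∈ s, ∀ e, e ∣ d → e ∈ s)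
    {f : ℕ} (hf : f ∈ s) :
    ∑ d ∈ s with f ∣ d, selbergWeight s d / d = μ f / (φ f * selbergSum s) := by
  have h1 : ∀ d ∈ s.filter (f ∣ ·), selbergWeight s d / d =
      1 / selbergSum s * ∑ r ∈ s with d ∣ r, (μ d : ℝ) / φ r := fun d hd => by
    have : (d : ℝ) ≠ 0 := by
      exact_mod_cast (hsq d (mem_filter.1 hd).1).ne_zero
    rw [selbergWeight, mul_div_right_comm]
    simp only [div_eq_mul_inv (μ d : ℝ), ← mul_sum, one_div]
    field_simp
  rw [sum_congr rfl h1, ← mul_sum]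
  simp only [sum_filter]
  have h2 : ∀ d ∈ s, (if f ∣ d then ∑ r ∈ s, (if d ∣ r then (μ d : ℝ) / φ r else 0) else 0) =
      ∑ r ∈ s, if f ∣ d ∧ d ∣ r then (μ d : ℝ) / φ r else 0 := fun d _ => by
    split_ifs with h <;> simp [h]
  rw [sum_congr rfl h2, sum_comm]
  have h3 : ∀ r ∈ s, (∑ d ∈ s, if f ∣ d ∧ d ∣ r then (μ d : ℝ) / φ r else 0) =
      if r = f then (μ f : ℝ) / φ f else 0 := fun r hr => by
    rw [← sum_filter]
    by_cases hfr : f ∣ r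
    · have : s.filter (fun d => f ∣ d ∧ d ∣ r) = r.divisors.filter (f ∣ ·) := by
        ext d
        simp only [mem_filter, Nat.mem_divisors]
        constructor
        · rintro ⟨_, h, h'⟩; exact ⟨⟨h', (hsq r hr).ne_zero⟩, h⟩
        · rintro ⟨⟨h', _⟩, h⟩; exact ⟨hdiv r hr d h', h, h'⟩
      rw [this, ← sum_div, sum_divisors_filter_dvd_moebius (hsq r hr) hfr]
      split_ifs with h
      · rw [h]
      · simp
    · rw [if_neg (by rintro rfl; exact hfr dvd_rfl)]
      refine sum_eq_zero fun d hd => ?_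
      obtain ⟨-, h, h'⟩ := mem_filter.1 hd
      exact absurd (h.trans h') hfr
  rw [sum_congr rfl h3, sum_ite_eq' s f, if_pos hf, one_div, div_mul_eq_div_div]
  ring

lemma sum_selbergWeight_mul_div_lcm (hsq : ∀ d ∈ s, Squarefree d)
    (hdiv : ∀ d ∈ s, ∀ e, e ∣ d → e ∈ s) (h1 : 1 ∈ s) :
    ∑ d ∈ s, ∑ e ∈ s, selbergWeight s d * selbergWeight s e / (d.lcm e : ℝ) =
      1 / selbergSum s := by
  have hG := (selbergSum_pos h1).ne'
  have hterm : ∀ d ∈ s, ∀ e ∈ s, selbergWeight s d * selbergWeight s e / (d.lcm e : ℝ) =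
      ∑ f ∈ s, (φ f : ℝ) * ((if f ∣ d then selbergWeight s d / d else 0) *
        (if f ∣ e then selbergWeight s e / e else 0)) := fun d hd e he => by
    have hd0 : (d : ℝ) ≠ 0 := by exact_mod_cast (hsq d hd).ne_zero
    have he0 : (e : ℝ) ≠ 0 := by exact_mod_cast (hsq e he).ne_zero
    have hl0 : (d.lcm e : ℝ) ≠ 0 := by
      exact_mod_cast Nat.lcm_ne_zero (hsq d hd).ne_zero (hsq e he).ne_zero
    have hg : ((d.gcd e : ℕ) : ℝ) = ∑ f ∈ s, if f ∣ d ∧ f ∣ e then (φ f : ℝ) else 0 := by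
      rw [← sum_filter]
      have : s.filter (fun f => f ∣ d ∧ f ∣ e) = (d.gcd e).divisors := by
        ext f
        simp only [mem_filter, Nat.mem_divisors, Nat.dvd_gcd_iff]
        constructor
        · rintro ⟨_, h⟩; exact ⟨h, by simp [(hsq d hd).ne_zero]⟩
        · rintro ⟨h, _⟩; exact ⟨hdiv d hd f h.1, h⟩
      rw [this]
      exact_mod_cast (Nat.sum_totient (d.gcd e)).symm
    have hgl : (d.gcd e : ℝ) * (d.lcm e : ℝ) = d * e := by exact_mod_cast Nat.gcd_mul_lcm d e
    have : selbergWeight s d * selbergWeight s e / (d.lcm e : ℝ) =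
        (d.gcd e : ℝ) * (selbergWeight s d / d * (selbergWeight s e / e)) := by
      field_simp
      linear_combination (-selbergWeight s d * selbergWeight s e) * hgl
    rw [this, hg, sum_mul]
    refine sum_congr rfl fun f _ => ?_
    by_cases h : f ∣ d <;> by_cases h' : f ∣ e <;> simp [h, h']
  have hmid : ∑ d ∈ s, ∑ e ∈ s, selbergWeight s d * selbergWeight s e / (d.lcm e : ℝ) =
      ∑ f ∈ s, (φ f : ℝ) * (∑ d ∈ s with f ∣ d, selbergWeight s d / d) ^ 2 := by
    rw [sum_congr rfl fun d hd => sum_congr rfl (hterm d hd)]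
    simp_rw [sum_filter, sq, sum_mul_sum, mul_sum]
    exact (sum_congr rfl fun d _ => sum_comm).trans sum_comm
  rw [hmid]
  have hlast : ∀ f ∈ s, (φ f : ℝ) * (∑ d ∈ s with f ∣ d, selbergWeight s d / d) ^ 2 =
      1 / selbergSum s ^ 2 * (1 / φ f) := fun f hf => by
    rw [sum_selbergWeight_div hsq hdiv hf]
    have hφ : (φ f : ℝ) ≠ 0 := by
      exact_mod_cast (Nat.totient_pos.2 (Nat.pos_of_ne_zero (hsq f hf).ne_zero)).ne'
    have hμ : (μ f : ℝ) ^ 2 = 1 := by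
      exact_mod_cast ArithmeticFunction.moebius_sq_eq_one_of_squarefree (hsq f hf)
    field_simp
    exact hμ
  rw [sum_congr rfl hlast, ← mul_sum, ← selbergSum]
  field_simp

/-- **Selberg's upper bound sieve** with an arbitrary divisor-closed support. -/
theorem card_filter_le_selberg (hsq : ∀ d ∈ s, Squarefree d)
    (hdiv : ∀ d ∈ s, ∀ e, e ∣ d → e ∈ s) (h1 : 1 ∈ s) {A : Finset ℕ} {Y : ℝ}
    (hA : ∀ d ∈ s, ∀ e ∈ s, |(#{n ∈ A | d.lcm e ∣ n} : ℝ) - Y / (d.lcm e : ℕ)| ≤ 1) :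
    (#{n ∈ A | ∀ d ∈ s, d ∣ n → d = 1} : ℝ) ≤ Y / selbergSum s + (∑ d ∈ s, (d : ℝ)) ^ 2 := by
  have hle : (#{n ∈ A | ∀ d ∈ s, d ∣ n → d = 1} : ℝ) ≤
      ∑ n ∈ A, (∑ d ∈ s with d ∣ n, selbergWeight s d) ^ 2 := by
    rw [card_eq_sum_ones, Nat.cast_sum, sum_filter]
    refine sum_le_sum fun n _ => ?_
    split_ifs with h
    · have : s.filter (· ∣ n) = {1} := by
        ext d
        simp only [mem_filter, mem_singleton]
        exact ⟨fun hd => h d hd.1 hd.2, by rintro rfl; exact ⟨h1, one_dvd n⟩⟩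
      simp [this, selbergWeight_one h1]
    · positivity
  have heq : ∑ n ∈ A, (∑ d ∈ s with d ∣ n, selbergWeight s d) ^ 2 =
      ∑ d ∈ s, ∑ e ∈ s, selbergWeight s d * selbergWeight s e * #{n ∈ A | d.lcm e ∣ n} := by
    simp_rw [sum_filter, sq, sum_mul_sum]
    rw [sum_comm]
    refine sum_congr rfl fun d _ => ?_
    rw [sum_comm]
    refine sum_congr rfl fun e _ => ?_
    rw [card_eq_sum_ones, Nat.cast_sum, sum_filter, mul_sum]
    refine sum_congr rfl fun n _ => ?_
    by_cases h : d ∣ n <;> by_cases h' : e ∣ n <;> simp [h, h', Nat.lcm_dvd_iff]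
  have hbd : ∑ d ∈ s, ∑ e ∈ s, selbergWeight s d * selbergWeight s e * #{n ∈ A | d.lcm e ∣ n} ≤
      ∑ d ∈ s, ∑ e ∈ s, (Y * (selbergWeight s d * selbergWeight s e / (d.lcm e : ℝ)) +
        (d : ℝ) * e) := by
    refine sum_le_sum fun d hd => sum_le_sum fun e he => ?_
    have hb : |selbergWeight s d * selbergWeight s e *
        ((#{n ∈ A | d.lcm e ∣ n} : ℝ) - Y / (d.lcm e : ℕ))| ≤ (d : ℝ) * e := by
      rw [abs_mul, abs_mul]
      have := mul_le_mul (abs_selbergWeight_le h1 d) (abs_selbergWeight_le h1 e)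
        (abs_nonneg _) (Nat.cast_nonneg d)
      calc _ ≤ (d : ℝ) * e * 1 := mul_le_mul this (hA d hd e he) (abs_nonneg _) (by positivity)
        _ = _ := mul_one _
    have := (abs_le.1 hb).2
    have h3 : selbergWeight s d * selbergWeight s e * (Y / (d.lcm e : ℕ)) =
      Y * (selbergWeight s d * selbergWeight s e / (d.lcm e : ℝ)) := by ring
    linarith [mul_sub (selbergWeight s d * selbergWeight s e)
      (#{n ∈ A | d.lcm e ∣ n} : ℝ) (Y / (d.lcm e : ℕ))]
  refine hle.trans (heq ▸ hbd.trans (le_of_eq ?_))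
  simp_rw [sum_add_distrib, ← mul_sum]
  rw [sum_selbergWeight_mul_div_lcm hsq hdiv h1, ← sum_mul, sq]
  ring

end SelbergSieve

section FundamentalLemma

open scoped ArithmeticFunction.Moebius ArithmeticFunction.vonMangoldt Nat

/-- All prime factors of `n` are at least `z`. -/
def Rough (z n : ℕ) : Prop := ∀ p : ℕ, p.Prime → p ∣ n → z ≤ p

noncomputable instance (z : ℕ) : DecidablePred (Rough z) := fun _ => Classical.propDecidable _

/-- The product `∏_{p < z} (1 - 1/p)`. -/
noncomputable def sieveProd (z : ℕ) : ℝ := ∏ p ∈ Nat.primesBelow z, (1 - 1 / (p : ℝ))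

/-- The product of the primes below `z`. -/
def primeProd (z : ℕ) : ℕ := ∏ p ∈ Nat.primesBelow z, p

lemma primeProd_ne_zero (z : ℕ) : primeProd z ≠ 0 :=
  prod_ne_zero_iff.2 fun _ hp => (Nat.prime_of_mem_primesBelow hp).ne_zero

lemma squarefree_primeProd (z : ℕ) : Squarefree (primeProd z) := by
  refine squarefree_prod_of_pairwise_isCoprime (fun p hp q hq h => ?_)
    fun p hp => (Nat.prime_of_mem_primesBelow hp).squarefree
  exact Nat.coprime_iff_isRelPrime.1 ((Nat.coprime_primes (Nat.prime_of_mem_primesBelow hp)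
    (Nat.prime_of_mem_primesBelow hq)).2 h)

lemma primeFactors_primeProd (z : ℕ) : (primeProd z).primeFactors = Nat.primesBelow z :=
  Nat.primeFactors_prod fun _ hp => Nat.prime_of_mem_primesBelow hp

lemma sieveProd_factor_pos {p : ℕ} (hp : p.Prime) : (0 : ℝ) < 1 - 1 / p := by
  have : (2 : ℝ) ≤ p := by exact_mod_cast hp.two_le
  rw [sub_pos, div_lt_one (by linarith)]; linarith

lemma sieveProd_pos (z : ℕ) : 0 < sieveProd z :=
  prod_pos fun _ hp => sieveProd_factor_pos (Nat.prime_of_mem_primesBelow hp)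

lemma log_le_sum_inv (z : ℕ) (hz : 1 ≤ z) : Real.log z ≤ ∑ m ∈ Ioo 0 z, 1 / (m : ℝ) := by
  obtain ⟨n, rfl⟩ : ∃ n, z = n + 1 := ⟨z - 1, by omega⟩
  refine (log_add_one_le_harmonic n).trans (le_of_eq ?_)
  rw [harmonic_eq_sum_Icc]
  push_cast
  refine sum_congr ?_ fun i _ => by simp
  ext i; simp; omega

lemma sieveProd_le {z : ℕ} (hz : 2 ≤ z) : sieveProd z ≤ 1 / Real.log z := by
  have hlog : 0 < Real.log z := Real.log_pos (by exact_mod_cast hz)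
  let f : ℕ →* ℝ :=
    { toFun := fun n => 1 / (n : ℝ)
      map_one' := by simp
      map_mul' := fun a b => by push_cast; field_simp }
  have hf : ∀ {p : ℕ}, p.Prime → ‖f p‖ < 1 := fun {p} hp => by
    have : (1 : ℝ) < p := by exact_mod_cast hp.one_lt
    change ‖(1 / (p : ℝ))‖ < 1
    rw [Real.norm_of_nonneg (by positivity), div_lt_one (by linarith)]
    exact this
  obtain ⟨-, hsum⟩ := EulerProduct.summable_and_hasSum_smoothNumbers_prod_primesBelow_geometric
    hf z
  have hmem : ∀ m ∈ Ioo 0 z, m ∈ Nat.smoothNumbers z := fun m hm =>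
    Nat.mem_smoothNumbers_of_lt (mem_Ioo.1 hm).1 (mem_Ioo.1 hm).2
  have h1 := sum_le_hasSum ((Ioo 0 z).attach.map
    ⟨fun m => (⟨m.1, hmem m.1 m.2⟩ : Nat.smoothNumbers z), fun a b h => by
      ext; simpa using congrArg Subtype.val h⟩)
    (fun i _ => by change (0 : ℝ) ≤ 1 / (i.1 : ℝ); positivity) hsum
  rw [sum_map, prod_inv_distrib] at h1
  have h2 : Real.log z ≤ (sieveProd z)⁻¹ := by
    refine (log_le_sum_inv z (by omega)).trans (le_trans (le_of_eq ?_) h1)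
    exact (sum_attach (Ioo 0 z) fun m => 1 / (m : ℝ)).symm
  rw [one_div]
  exact (le_inv_comm₀ hlog (sieveProd_pos z)).1 h2

lemma sum_log_div_primesBelow_le {z : ℕ} (hz : 1 ≤ z) :
    ∑ p ∈ Nat.primesBelow z, Real.log p / p ≤ Real.log z + 6 := by
  have h := (abs_le.1 (abs_sum_vonMangoldt_div_sub_log_le hz)).2
  refine le_trans ?_ (by linarith : ∑ n ∈ Ioc 0 z, Λ n / n ≤ _)
  refine (sum_congr rfl fun p hp => ?_).trans_le (sum_le_sum_of_subset_of_nonneg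
    (f := fun n : ℕ => Λ n / n) (s := Nat.primesBelow z) ?_ fun n _ _ => ?_)
  · rw [ArithmeticFunction.vonMangoldt_apply_prime (Nat.prime_of_mem_primesBelow hp)]
  · intro p hp
    exact mem_Ioc.2 ⟨(Nat.prime_of_mem_primesBelow hp).pos, (Nat.lt_of_mem_primesBelow hp).le⟩
  · exact div_nonneg ArithmeticFunction.vonMangoldt_nonneg (Nat.cast_nonneg _)

lemma sum_rough_inv_le {z : ℕ} (hz : 2 ≤ z) (y : ℕ) :
    ∑ d ∈ Ioc 0 y with Rough z d, 1 / (d : ℝ) ≤ (1 + Real.log (y * z)) / Real.log z := by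
  have hlog : 0 < Real.log z := Real.log_pos (by exact_mod_cast hz)
  rw [le_div_iff₀ hlog]
  have h0 : 0 ≤ ∑ d ∈ Ioc 0 y with Rough z d, 1 / (d : ℝ) := sum_nonneg fun _ _ => by positivity
  refine (mul_le_mul_of_nonneg_left (log_le_sum_inv z (by omega)) h0).trans ?_
  rw [sum_mul_sum, ← sum_product']
  have hinj : Set.InjOn (fun x : ℕ × ℕ => x.1 * x.2)
      ((Ioc 0 y).filter (Rough z) ×ˢ Ioo 0 z : Finset (ℕ × ℕ)) := by
    have key : ∀ d d' m m' : ℕ, Rough z d → 0 < m' → m' < z → d * m = d' * m' → d ∣ d' := by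
      intro d d' m m' hd hm hm' h
      have hc : d.Coprime m' := by
        refine Nat.coprime_of_dvd fun p hp h1 h2 => ?_
        exact absurd (hd p hp h1) (by have := Nat.le_of_dvd hm h2; omega)
      exact hc.dvd_of_dvd_mul_right (h ▸ dvd_mul_right d m)
    rintro ⟨d, m⟩ h ⟨d', m'⟩ h' he
    simp only [coe_product, Set.mem_prod, mem_coe, mem_filter, mem_Ioc, mem_Ioo] at h h' he
    have hd : d = d' := Nat.dvd_antisymm (key d d' m m' h.1.2 h'.2.1 h'.2.2 he)
      (key d' d m' m h'.1.2 h.2.1 h.2.2 he.symm)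
    subst hd
    exact Prod.ext rfl (Nat.eq_of_mul_eq_mul_left h.1.1.1 he)
  have h1 : ∑ x ∈ (Ioc 0 y).filter (Rough z) ×ˢ Ioo 0 z, 1 / (x.1 : ℝ) * (1 / (x.2 : ℝ)) =
      ∑ n ∈ ((Ioc 0 y).filter (Rough z) ×ˢ Ioo 0 z).image (fun x : ℕ × ℕ => x.1 * x.2),
        1 / ((n : ℕ) : ℝ) := by
    rw [sum_image hinj]
    exact sum_congr rfl fun x _ => by push_cast; field_simp
  rw [h1]
  have h2 := harmonic_le_one_add_log (y * z)
  rw [harmonic_eq_sum_Icc] at h2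
  push_cast at h2
  refine le_trans ?_ h2
  simp only [one_div]
  refine sum_le_sum_of_subset_of_nonneg (fun n hn => ?_) fun _ _ _ => by positivity
  obtain ⟨⟨d, m⟩, hx, rfl⟩ := mem_image.1 hn
  simp only [mem_product, mem_filter, mem_Ioc, mem_Ioo] at hx
  exact mem_Icc.2 ⟨Nat.mul_pos hx.1.1.1 hx.2.1, Nat.mul_le_mul hx.1.1.2 hx.2.2.le⟩

/-- The function `d ↦ d ^ α / φ d`. -/
noncomputable def rpowDivTotient (α : ℝ) : ArithmeticFunction ℝ :=
  ⟨fun d => (d : ℝ) ^ α / φ d, by simp⟩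

lemma isMultiplicative_rpowDivTotient (α : ℝ) : (rpowDivTotient α).IsMultiplicative := by
  refine ⟨by simp [rpowDivTotient], fun {m n} h => ?_⟩
  simp only [rpowDivTotient, ArithmeticFunction.coe_mk, Nat.totient_mul h]
  push_cast
  rw [Real.mul_rpow (Nat.cast_nonneg _) (Nat.cast_nonneg _)]
  ring

lemma sum_divisors_rpow_div_totient (α : ℝ) (z : ℕ) :
    ∑ d ∈ (primeProd z).divisors, (d : ℝ) ^ α / φ d =
      (sieveProd z)⁻¹ * ∏ p ∈ Nat.primesBelow z, (1 + ((p : ℝ) ^ α - 1) / p) := by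
  have h := (isMultiplicative_rpowDivTotient α).prodPrimeFactors_one_add_of_squarefree
    (squarefree_primeProd z)
  rw [primeFactors_primeProd] at h
  refine h.symm.trans ?_
  rw [sieveProd, ← prod_inv_distrib, ← prod_mul_distrib]
  refine prod_congr rfl fun p hp => ?_
  have hp' := Nat.prime_of_mem_primesBelow hp
  have h1 : (1 : ℝ) < p := by exact_mod_cast hp'.one_lt
  have h2 : (p : ℝ) - 1 ≠ 0 := by linarith
  have h3 : (p : ℝ) ≠ 0 := by linarith
  simp only [rpowDivTotient, ArithmeticFunction.coe_mk, Nat.totient_prime hp',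
    Nat.cast_sub hp'.one_le, Nat.cast_one]
  have h4 : (1 - 1 / (p : ℝ))⁻¹ = p / (p - 1) := by
    rw [one_sub_div h3, inv_div]
  rw [h4]
  field_simp
  ring

lemma prod_rankin_le {z : ℕ} (hz : 2 ≤ z) :
    ∏ p ∈ Nat.primesBelow z, (1 + ((p : ℝ) ^ (1 / Real.log z) - 1) / p) ≤ Real.exp 30 := by
  have hlog : 0 < Real.log z := Real.log_pos (by exact_mod_cast hz)
  have hlog2 : 0.6931471803 < Real.log z := lt_of_lt_of_le Real.log_two_gt_d9
    (Real.log_le_log (by norm_num) (by exact_mod_cast hz))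
  have hterm : ∀ p ∈ Nat.primesBelow z, (1 + ((p : ℝ) ^ (1 / Real.log z) - 1) / p) ≤
      Real.exp (3 / Real.log z * (Real.log p / p)) := fun p hp => by
    have hp' := Nat.prime_of_mem_primesBelow hp
    have hp1 : (1 : ℝ) < p := by exact_mod_cast hp'.one_lt
    have hp0 : (0 : ℝ) < p := by linarith
    have hlp : 0 ≤ Real.log p := Real.log_nonneg hp1.le
    refine le_trans ?_ (Real.add_one_le_exp _)
    rw [add_comm]
    gcongr
    rw [mul_div_assoc', div_le_div_iff_of_pos_right hp0, Real.rpow_def_of_pos hp0]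
    set x := Real.log p * (1 / Real.log z) with hx
    have hx0 : 0 ≤ x := by positivity
    have hx1 : x ≤ 1 := by
      rw [hx, mul_one_div, div_le_one hlog]
      exact Real.log_le_log hp0 (by exact_mod_cast (Nat.lt_of_mem_primesBelow hp).le)
    have h1 : Real.exp x - 1 ≤ x * Real.exp x := by
      have := Real.add_one_le_exp (-x)
      have h2 := mul_le_mul_of_nonneg_right this (Real.exp_pos x).le
      rw [← Real.exp_add, neg_add_cancel, Real.exp_zero] at h2
      linarith
    have h2 : Real.exp x ≤ 3 := (Real.exp_le_exp.2 hx1).trans (Real.exp_one_lt_d9.le.trans (by norm_num))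
    calc Real.exp x - 1 ≤ x * 3 := h1.trans (mul_le_mul_of_nonneg_left h2 hx0)
      _ = 3 / Real.log z * Real.log p := by rw [hx]; ring
  refine (prod_le_prod (fun p hp => ?_) hterm).trans ?_
  · have hp' := Nat.prime_of_mem_primesBelow hp
    have hp1 : (1 : ℝ) < p := by exact_mod_cast hp'.one_lt
    have : (1 : ℝ) ≤ (p : ℝ) ^ (1 / Real.log z) :=
      Real.one_le_rpow hp1.le (by positivity)
    have : 0 ≤ ((p : ℝ) ^ (1 / Real.log z) - 1) / p := div_nonneg (by linarith) (by linarith)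
    linarith
  · rw [← Real.exp_sum, ← mul_sum]
    refine Real.exp_le_exp.2 ?_
    have h := sum_log_div_primesBelow_le (z := z) (by omega)
    calc _ ≤ 3 / Real.log z * (Real.log z + 6) := mul_le_mul_of_nonneg_left h (by positivity)
      _ = 3 + 18 / Real.log z := by field_simp; ring
      _ ≤ 3 + 27 := by
        gcongr
        rw [div_le_iff₀ hlog]; linarith
      _ = 30 := by norm_num

lemma rough_iff_coprime {z n : ℕ} : Rough z n ↔ (primeProd z).Coprime n := by
  rw [primeProd, Nat.coprime_prod_left_iff]
  constructor
  · intro h p hp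
    have hp' := Nat.prime_of_mem_primesBelow hp
    refine (hp'.coprime_iff_not_dvd).2 fun hd => ?_
    exact absurd (h p hp' hd) (not_le.2 (Nat.lt_of_mem_primesBelow hp))
  · intro h p hp hd
    by_contra hlt
    exact (hp.coprime_iff_not_dvd).1 (h p (Nat.mem_primesBelow.2 ⟨not_le.1 hlt, hp⟩)) hd

/-- The divisors of `primeProd z` up to `D`. -/
noncomputable def sieveSupport (z : ℕ) (D : ℝ) : Finset ℕ :=
  {d ∈ (primeProd z).divisors | (d : ℝ) ≤ D}

lemma inv_sieveProd_mul_le_selbergSum {z : ℕ} (hz : 2 ≤ z) {D : ℝ} (hD : 1 ≤ D) :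
    (sieveProd z)⁻¹ * (1 - Real.exp 30 * Real.exp (-(Real.log D / Real.log z))) ≤
      selbergSum (sieveSupport z D) := by
  have hlog : 0 < Real.log z := Real.log_pos (by exact_mod_cast hz)
  set α := 1 / Real.log z with hα
  have hα0 : 0 ≤ α := by positivity
  have hfull : ∑ d ∈ (primeProd z).divisors, 1 / (φ d : ℝ) = (sieveProd z)⁻¹ := by
    have := sum_divisors_rpow_div_totient 0 z
    simpa using this
  have hsplit := sum_filter_add_sum_filter_not (primeProd z).divisors (fun d : ℕ => (d : ℝ) ≤ D)
    (fun d => 1 / (φ d : ℝ))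
  have htail : ∑ d ∈ (primeProd z).divisors with ¬ ((d : ℕ) : ℝ) ≤ D, 1 / (φ d : ℝ) ≤
      (sieveProd z)⁻¹ * (Real.exp 30 * Real.exp (-(Real.log D / Real.log z))) := by
    calc ∑ d ∈ (primeProd z).divisors with ¬ ((d : ℕ) : ℝ) ≤ D, 1 / (φ d : ℝ)
        ≤ ∑ d ∈ (primeProd z).divisors with ¬ ((d : ℕ) : ℝ) ≤ D, D ^ (-α) * ((d : ℝ) ^ α / φ d) := by
          refine sum_le_sum fun d hd => ?_
          have hd' := not_le.1 (mem_filter.1 hd).2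
          rw [← mul_div_assoc]
          gcongr
          rw [Real.rpow_neg (by linarith), ← div_eq_inv_mul, le_div_iff₀ (by positivity), one_mul]
          exact Real.rpow_le_rpow (by linarith) hd'.le hα0
      _ ≤ ∑ d ∈ (primeProd z).divisors, D ^ (-α) * ((d : ℝ) ^ α / φ d) :=
          sum_le_sum_of_subset_of_nonneg (filter_subset _ _) fun _ _ _ => by positivity
      _ = D ^ (-α) * ((sieveProd z)⁻¹ * ∏ p ∈ Nat.primesBelow z, (1 + ((p : ℝ) ^ α - 1) / p)) := by
          rw [← mul_sum, sum_divisors_rpow_div_totient]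
      _ ≤ D ^ (-α) * ((sieveProd z)⁻¹ * Real.exp 30) := by
          have := (inv_pos.2 (sieveProd_pos z)).le
          gcongr
          exact prod_rankin_le hz
      _ = _ := by
          rw [Real.rpow_def_of_pos (by linarith), show Real.log D * -α =
            -(Real.log D / Real.log z) by rw [hα]; ring]
          ring
  rw [selbergSum, sieveSupport]
  rw [hfull] at hsplit
  linarith

lemma coprime_iff_forall_sieveSupport {z : ℕ} {D : ℝ} {n : ℕ} (h : Rough z n) :
    ∀ d ∈ sieveSupport z D, d ∣ n → d = 1 := fun d hd hdn => by
  have h1 : d ∣ primeProd z := Nat.dvd_of_mem_divisors (mem_filter.1 hd).1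
  exact Nat.eq_one_of_dvd_coprimes (rough_iff_coprime.1 h) h1 hdn

/-- Upper bound in the fundamental lemma of the sieve. -/
lemma card_rough_le {z : ℕ} (hz : 2 ≤ z) {D : ℝ} (hD : 1 ≤ D) {A : Finset ℕ} {Y : ℝ} (hY : 0 ≤ Y)
    (hu : Real.exp 30 * Real.exp (-(Real.log D / Real.log z)) ≤ 1 / 2)
    (hA : ∀ e : ℕ, e ∣ primeProd z → |(#{n ∈ A | e ∣ n} : ℝ) - Y / e| ≤ 1) :
    (#{n ∈ A | Rough z n} : ℝ) ≤ Y * sieveProd z +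
      2 * Real.exp 30 * (Y / Real.log z * Real.exp (-(Real.log D / Real.log z))) + D ^ 4 := by
  have hlog : 0 < Real.log z := Real.log_pos (by exact_mod_cast hz)
  set η := Real.exp 30 * Real.exp (-(Real.log D / Real.log z)) with hη
  have hη0 : 0 ≤ η := by positivity
  have hV := sieveProd_pos z
  have h1 : 1 ∈ sieveSupport z D := mem_filter.2
    ⟨Nat.mem_divisors.2 ⟨one_dvd _, primeProd_ne_zero z⟩, by simpa using hD⟩
  have hdvd : ∀ d ∈ sieveSupport z D, d ∣ primeProd z := fun d hd =>
    Nat.dvd_of_mem_divisors (mem_filter.1 hd).1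
  have hsel := card_filter_le_selberg (s := sieveSupport z D) (A := A) (Y := Y)
    (fun d hd => (squarefree_primeProd z).squarefree_of_dvd (hdvd d hd))
    (fun d hd e he => mem_filter.2 ⟨Nat.mem_divisors.2 ⟨he.trans (hdvd d hd), primeProd_ne_zero z⟩,
      le_trans (by exact_mod_cast Nat.le_of_dvd (Nat.pos_of_mem_divisors (mem_filter.1 hd).1) he)
        (mem_filter.1 hd).2⟩) h1
    (fun d hd e he => hA _ (Nat.lcm_dvd (hdvd d hd) (hdvd e he)))
  have hcard : (#{n ∈ A | Rough z n} : ℝ) ≤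
      #{n ∈ A | ∀ d ∈ sieveSupport z D, d ∣ n → d = 1} := by
    exact_mod_cast card_le_card (monotone_filter_right A fun n _ hn =>
      coprime_iff_forall_sieveSupport hn)
  have hG := inv_sieveProd_mul_le_selbergSum hz hD
  rw [← hη] at hG
  have hmain : Y / selbergSum (sieveSupport z D) ≤ Y * sieveProd z * (1 + 2 * η) := by
    rw [div_le_iff₀ (selbergSum_pos h1)]
    have h2 : 1 ≤ sieveProd z * (1 + 2 * η) * ((sieveProd z)⁻¹ * (1 - η)) := by
      have : sieveProd z * (1 + 2 * η) * ((sieveProd z)⁻¹ * (1 - η)) = (1 + 2 * η) * (1 - η) := by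
        field_simp
      rw [this]; nlinarith
    calc Y = Y * 1 := (mul_one Y).symm
      _ ≤ Y * (sieveProd z * (1 + 2 * η) * ((sieveProd z)⁻¹ * (1 - η))) :=
        mul_le_mul_of_nonneg_left h2 hY
      _ ≤ Y * (sieveProd z * (1 + 2 * η) * selbergSum (sieveSupport z D)) := by gcongr
      _ = _ := by ring
  have hsum : ∑ d ∈ sieveSupport z D, (d : ℝ) ≤ D ^ 2 := by
    have hc : (#(sieveSupport z D) : ℝ) ≤ D := by
      have : sieveSupport z D ⊆ Ioc 0 ⌊D⌋₊ := fun d hd => mem_Ioc.2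
        ⟨Nat.pos_of_mem_divisors (mem_filter.1 hd).1, Nat.le_floor (mem_filter.1 hd).2⟩
      have := card_le_card this
      rw [Nat.card_Ioc, Nat.sub_zero] at this
      exact le_trans (by exact_mod_cast this) (Nat.floor_le (by linarith))
    calc ∑ d ∈ sieveSupport z D, (d : ℝ) ≤ #(sieveSupport z D) • D :=
          sum_le_card_nsmul _ _ _ fun d hd => (mem_filter.1 hd).2
      _ = #(sieveSupport z D) * D := nsmul_eq_mul _ _
      _ ≤ D * D := by gcongr
      _ = D ^ 2 := (sq D).symm
  have hsum2 : (∑ d ∈ sieveSupport z D, (d : ℝ)) ^ 2 ≤ D ^ 4 := by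
    calc _ ≤ (D ^ 2) ^ 2 := pow_le_pow_left₀ (sum_nonneg fun _ _ => Nat.cast_nonneg _) hsum 2
      _ = D ^ 4 := by ring
  have hVle : Y * sieveProd z * (2 * η) ≤ Y * (1 / Real.log z) * (2 * η) := by
    gcongr
    exact sieveProd_le hz
  have : Y * (1 / Real.log z) * (2 * η) = 2 * Real.exp 30 * (Y / Real.log z *
      Real.exp (-(Real.log D / Real.log z))) := by rw [hη]; ring
  linarith

end FundamentalLemma

section FundamentalLemmaLower

lemma rough_succ_iff {z n : ℕ} : Rough (z + 1) n ↔ Rough z n ∧ ¬ (z.Prime ∧ z ∣ n) := by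
  constructor
  · intro h
    refine ⟨fun p hp hd => (Nat.le_succ z).trans (h p hp hd), fun ⟨hp, hd⟩ => ?_⟩
    have := h z hp hd
    omega
  · rintro ⟨h, hn⟩ p hp hd
    have := h p hp hd
    rcases this.eq_or_lt with rfl | h'
    · exact absurd ⟨hp, hd⟩ hn
    · exact h'

lemma sieveProd_eq_one_sub (z : ℕ) :
    sieveProd z = 1 - ∑ p ∈ Nat.primesBelow z, sieveProd p / p := by
  induction z with
  | zero => simp [sieveProd]
  | succ z ih =>
    rw [sieveProd, Nat.primesBelow_succ]
    split_ifs with h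
    · rw [prod_insert (by simp [Nat.mem_primesBelow]), sum_insert (by simp [Nat.mem_primesBelow]),
        ← sieveProd]
      linear_combination ih
    · rw [← sieveProd, ih]

lemma card_eq_card_rough_add (A : Finset ℕ) (z : ℕ) :
    #A = #{n ∈ A | Rough z n} + ∑ p ∈ Nat.primesBelow z, #{n ∈ {n ∈ A | p ∣ n} | Rough p n} := by
  induction z with
  | zero => simp [Rough]
  | succ z ih =>
    rw [Nat.primesBelow_succ]
    simp only [rough_succ_iff]
    split_ifs with h
    · have h1 := card_filter_add_card_filter_not (s := {n ∈ A | Rough z n}) (fun n => z ∣ n)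
      rw [filter_filter, filter_filter] at h1
      have h2 : {n ∈ {n ∈ A | z ∣ n} | Rough z n} = {n ∈ A | Rough z n ∧ z ∣ n} := by
        rw [filter_filter]
        exact filter_congr fun n _ => and_comm
      rw [sum_insert (by simp [Nat.mem_primesBelow]), h2]
      simp only [h, true_and]
      omega
    · simpa [h] using ih

/-- The **fundamental lemma of the sieve**. -/
theorem abs_card_rough_sub_le {z : ℕ} (hz : 2 ≤ z) {D : ℝ} (hD : 1 ≤ D)
    (hu : 31 * Real.log z ≤ Real.log D) {A : Finset ℕ} {Y : ℝ} (hY : 0 ≤ Y)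
    (hA : ∀ e : ℕ, e ∣ primeProd z → |(#{n ∈ A | e ∣ n} : ℝ) - Y / e| ≤ 1) :
    |(#{n ∈ A | Rough z n} : ℝ) - Y * sieveProd z| ≤
      160 * Real.exp 30 * (Y / Real.log z * Real.exp (-(Real.log D / Real.log z) / 2)) +
        z * D ^ 4 + 1 := by
  have hz2 : (2 : ℝ) ≤ z := by exact_mod_cast hz
  have hlog2 : 0.6931471803 < Real.log z := lt_of_lt_of_le Real.log_two_gt_d9
    (Real.log_le_log (by norm_num) hz2)
  have hlog : 0 < Real.log z := by linarith
  have hlogD : 0 < Real.log D := by nlinarith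
  set u := Real.log D / Real.log z with hu'
  have hu31 : 31 ≤ u := by rw [hu', le_div_iff₀ hlog]; exact hu
  have hsmall : ∀ x : ℝ, 31 ≤ x → Real.exp 30 * Real.exp (-x) ≤ 1 / 2 := fun x hx => by
    rw [← Real.exp_add]
    calc Real.exp (30 + -x) ≤ Real.exp (-1) := Real.exp_le_exp.2 (by linarith)
      _ ≤ 1 / 2 := by
        rw [Real.exp_neg, one_div]
        exact inv_anti₀ (by norm_num) (by linarith [Real.add_one_le_exp (1 : ℝ)])
  have hD4 : (1 : ℝ) ≤ D ^ 4 := one_le_pow₀ hD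
  have hE : 0 ≤ Y / Real.log z * Real.exp (-u / 2) := by positivity
  rw [abs_le]
  constructor
  · have hid : (#A : ℝ) = #{n ∈ A | Rough z n} +
        ∑ p ∈ Nat.primesBelow z, (#{n ∈ {n ∈ A | p ∣ n} | Rough p n} : ℝ) := by
      exact_mod_cast card_eq_card_rough_add A z
    have hcardA : Y - 1 ≤ #A := by
      have := (abs_le.1 (hA 1 (one_dvd _))).1
      simp only [one_dvd, filter_true, Nat.cast_one, div_one] at this
      linarith
    have hp : ∀ p ∈ Nat.primesBelow z, (#{n ∈ {n ∈ A | p ∣ n} | Rough p n} : ℝ) ≤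
        Y * (sieveProd p / p) + 16 * Real.exp 30 * Y * Real.exp (-u / 2) / Real.log D ^ 2 *
          (Real.log p / p) + D ^ 4 := fun p hp => by
      have hpp := Nat.prime_of_mem_primesBelow hp
      have hp2 : (2 : ℝ) ≤ p := by exact_mod_cast hpp.two_le
      have hp0 : (0 : ℝ) < p := by linarith
      have hlp : 0 < Real.log p := Real.log_pos (by linarith)
      have hpz : Real.log p ≤ Real.log z :=
        Real.log_le_log hp0 (by exact_mod_cast (Nat.lt_of_mem_primesBelow hp).le)
      set x := Real.log D / Real.log p with hx
      have hux : u ≤ x := div_le_div_of_nonneg_left hlogD.le hlp hpz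
      have h := card_rough_le hpp.two_le hD (A := {n ∈ A | p ∣ n}) (Y := Y / p) (by positivity)
        (hsmall x (hu31.trans hux)) (fun e he => ?_)
      · have hex : Real.exp (-x) ≤ Real.exp (-u / 2) * (8 / x ^ 2) := by
          have hx0 : 0 < x := by linarith
          have h1 := Real.quadratic_le_exp_of_nonneg (x := x / 2) (by linarith)
          have h2 : Real.exp (-(x / 2)) ≤ 8 / x ^ 2 := by
            rw [Real.exp_neg, ← one_div, div_le_div_iff₀ (Real.exp_pos _) (by positivity)]
            nlinarith
          calc Real.exp (-x) = Real.exp (-(x / 2)) * Real.exp (-(x / 2)) := by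
                rw [← Real.exp_add]; ring_nf
            _ ≤ Real.exp (-u / 2) * (8 / x ^ 2) :=
              mul_le_mul (Real.exp_le_exp.2 (by linarith)) h2 (Real.exp_pos _).le
                (Real.exp_pos _).le
        have h3 : 2 * Real.exp 30 * (Y / p / Real.log p * Real.exp (-x)) ≤
            16 * Real.exp 30 * Y * Real.exp (-u / 2) / Real.log D ^ 2 * (Real.log p / p) := by
          calc 2 * Real.exp 30 * (Y / p / Real.log p * Real.exp (-x))
              ≤ 2 * Real.exp 30 * (Y / p / Real.log p * (Real.exp (-u / 2) * (8 / x ^ 2))) := by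
                gcongr
            _ = _ := by rw [hx]; field_simp; ring
        have h4 : Y / p * sieveProd p = Y * (sieveProd p / p) := by ring
        linarith
      · have hcop : p.Coprime e := by
          refine (hpp.coprime_iff_not_dvd).2 fun hpe => ?_
          have := (hpp.prime.dvd_finsetProd_iff (fun q => q)).1 (hpe.trans he)
          obtain ⟨q, hq, hpq⟩ := this
          have := (Nat.prime_dvd_prime_iff_eq hpp (Nat.prime_of_mem_primesBelow hq)).1 hpq
          exact absurd (Nat.lt_of_mem_primesBelow hq) (by omega)
        have hsub : p * e ∣ primeProd z := by
          refine hcop.mul_dvd_of_dvd_of_dvd (dvd_prod_of_mem _ hp) (he.trans ?_)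
          refine prod_dvd_prod_of_subset _ _ _ fun q hq => Nat.mem_primesBelow.2
            ⟨(Nat.lt_of_mem_primesBelow hq).trans (Nat.lt_of_mem_primesBelow hp),
              Nat.prime_of_mem_primesBelow hq⟩
        have := hA _ hsub
        rw [filter_filter]
        have h5 : {n ∈ A | p ∣ n ∧ e ∣ n} = {n ∈ A | p * e ∣ n} := by
          refine filter_congr fun n _ => ⟨fun h => hcop.mul_dvd_of_dvd_of_dvd h.1 h.2, fun h =>
            ⟨(dvd_mul_right p e).trans h, (dvd_mul_left e p).trans h⟩⟩
        rw [h5, div_div]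
        exact_mod_cast this
    have hsum := sum_le_sum hp
    rw [sum_add_distrib, sum_add_distrib, ← mul_sum, ← mul_sum, sum_const, nsmul_eq_mul] at hsum
    have hV := sieveProd_eq_one_sub z
    have hcard : (#(Nat.primesBelow z) : ℝ) * D ^ 4 ≤ z * D ^ 4 := by
      gcongr
      calc #(Nat.primesBelow z) ≤ #(range z) := card_le_card (filter_subset _ _)
        _ = z := card_range z
    have hmain : 16 * Real.exp 30 * Y * Real.exp (-u / 2) / Real.log D ^ 2 *
        ∑ p ∈ Nat.primesBelow z, Real.log p / p ≤
        160 * Real.exp 30 * (Y / Real.log z * Real.exp (-u / 2)) := by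
      have h1 := sum_log_div_primesBelow_le (z := z) (by omega)
      have h2 : (Real.log z + 6) / Real.log D ^ 2 ≤ 10 / Real.log z := by
        rw [div_le_div_iff₀ (by positivity) hlog]
        nlinarith
      calc _ ≤ 16 * Real.exp 30 * Y * Real.exp (-u / 2) / Real.log D ^ 2 * (Real.log z + 6) := by
            gcongr
        _ = 16 * Real.exp 30 * Y * Real.exp (-u / 2) * ((Real.log z + 6) / Real.log D ^ 2) := by ring
        _ ≤ 16 * Real.exp 30 * Y * Real.exp (-u / 2) * (10 / Real.log z) := by gcongr
        _ = _ := by ring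
    have hYV : Y * sieveProd z = Y - Y * ∑ p ∈ Nat.primesBelow z, sieveProd p / p := by
      rw [hV]; ring
    linarith
  · have h := card_rough_le hz hD hY (hsmall u hu31) hA
    have h1 : Y / Real.log z * Real.exp (-u) ≤ Y / Real.log z * Real.exp (-u / 2) := by
      gcongr
      linarith
    have h2 : D ^ 4 ≤ z * D ^ 4 := by nlinarith
    have h3 : 0 < Real.exp 30 := Real.exp_pos _
    nlinarith

end FundamentalLemmaLower

section ShortIntervals

open scoped ArithmeticFunction.Moebius ArithmeticFunction.vonMangoldt ArithmeticFunction.zeta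

lemma selbergFn_eq_sum_moebius {n : ℕ} (hn : 0 < n) :
    selbergFn n = ∑ d ∈ n.divisors, (μ d : ℝ) * Real.log ((n / d : ℕ) : ℝ) ^ 2 := by
  have h : ∀ m : ℕ, m > 0 → ∑ d ∈ m.divisors, selbergFn d = Real.log m ^ 2 := fun m hm => by
    simp only [selbergFn, sum_add_distrib]
    have h2 : ∑ d ∈ m.divisors, (Λ * Λ) d = ∑ d ∈ m.divisors, Λ d * Real.log ((m / d : ℕ) : ℝ) := by
      have h3 : (Λ * Λ) * (ζ : ArithmeticFunction ℝ) = Λ * ArithmeticFunction.log := by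
        rw [mul_assoc, ArithmeticFunction.vonMangoldt_mul_zeta]
      have h4 := congrArg (fun g : ArithmeticFunction ℝ => g m) h3
      simp only [ArithmeticFunction.coe_mul_zeta_apply] at h4
      rw [h4, ArithmeticFunction.mul_apply, Nat.sum_divisorsAntidiagonal
        (fun d e => Λ d * ArithmeticFunction.log e)]
      rfl
    rw [h2, ← sum_add_distrib]
    have h5 : ∀ d ∈ m.divisors, Λ d * Real.log d + Λ d * Real.log ((m / d : ℕ) : ℝ) =
        Λ d * Real.log m := fun d hd => by
      have hdm := Nat.dvd_of_mem_divisors hd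
      have hd0 : (d : ℝ) ≠ 0 := by exact_mod_cast (Nat.pos_of_mem_divisors hd).ne'
      have hm0 : (m : ℝ) ≠ 0 := by exact_mod_cast hm.ne'
      rw [Nat.cast_div hdm hd0, Real.log_div hm0 hd0]
      ring
    rw [sum_congr rfl h5, ← sum_mul, ArithmeticFunction.vonMangoldt_sum, sq]
  have h6 := (ArithmeticFunction.sum_eq_iff_sum_mul_moebius_eq (f := selbergFn)
    (g := fun m => Real.log m ^ 2)).1 h n hn
  rw [← h6, Nat.sum_divisorsAntidiagonal (fun d e => (μ d : ℝ) * Real.log (e : ℝ) ^ 2)]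

lemma Rough.of_dvd {z m n : ℕ} (h : Rough z n) (hd : m ∣ n) : Rough z m :=
  fun p hp hpm => h p hp (hpm.trans hd)

lemma rough_mul_iff {z m n : ℕ} : Rough z (m * n) ↔ Rough z m ∧ Rough z n :=
  ⟨fun h => ⟨h.of_dvd (dvd_mul_right m n), h.of_dvd (dvd_mul_left n m)⟩,
    fun h p hp hd => (hp.dvd_mul.1 hd).elim (h.1 p hp) (h.2 p hp)⟩

/-- The integers `k` with `d * k ∈ (X, X + h]`. -/
def quotInterval (X h d : ℕ) : Finset ℕ := {k ∈ Ioc 0 (X + h) | d * k ∈ Ioc X (X + h)}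

lemma abs_card_quotInterval_sub_le (X h : ℕ) {d e : ℕ} (hd : 0 < d) (he : 0 < e) :
    |(#{k ∈ quotInterval X h d | e ∣ k} : ℝ) - (h / d : ℝ) / e| ≤ 1 := by
  have hde : 0 < d * e := Nat.mul_pos hd he
  have himg : {k ∈ quotInterval X h d | e ∣ k} =
      (Ioc (X / (d * e)) ((X + h) / (d * e))).image (e * ·) := by
    ext k
    simp only [quotInterval, mem_filter, mem_Ioc, mem_image, Nat.div_lt_iff_lt_mul hde,
      Nat.le_div_iff_mul_le hde]
    constructor
    · rintro ⟨⟨-, h1, h2⟩, m, rfl⟩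
      exact ⟨m, ⟨by linarith, by linarith⟩, rfl⟩
    · rintro ⟨m, ⟨h1, h2⟩, rfl⟩
      have hm : 0 < m := Nat.pos_of_ne_zero (by rintro rfl; simp at h1)
      refine ⟨⟨⟨Nat.mul_pos he hm, ?_⟩, by linarith, by linarith⟩, dvd_mul_right _ _⟩
      nlinarith [Nat.mul_pos he hm]
  rw [himg, card_image_of_injective _ fun a b h => Nat.eq_of_mul_eq_mul_left he h, Nat.card_Ioc,
    Nat.cast_sub (Nat.div_le_div_right (Nat.le_add_right X h))]
  have hc : (0 : ℝ) < (d * e : ℕ) := by exact_mod_cast hde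
  have fl : ∀ a : ℕ, ((a / (d * e) : ℕ) : ℝ) ≤ a / (d * e : ℕ) ∧
      (a : ℝ) / (d * e : ℕ) < ((a / (d * e) : ℕ) : ℝ) + 1 := fun a => by
    rw [le_div_iff₀ hc, div_lt_iff₀ hc]
    exact ⟨by exact_mod_cast Nat.div_mul_le_self a _,
      by exact_mod_cast Nat.lt_mul_of_div_lt (Nat.lt_succ_self _) hde⟩
  obtain ⟨h1, h2⟩ := fl X
  obtain ⟨h3, h4⟩ := fl (X + h)
  have h5 : (h / d : ℝ) / e = ((X + h : ℕ) : ℝ) / (d * e : ℕ) - (X : ℝ) / (d * e : ℕ) := by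
    rw [div_div]; push_cast; ring
  rw [h5, abs_le]
  constructor <;> linarith

/-- The sum of Selberg's function over the rough integers of `(X, X + h]`. -/
noncomputable def roughSelberg (z X h : ℕ) : ℝ := ∑ n ∈ Ioc X (X + h) with Rough z n, selbergFn n

lemma roughSelberg_eq (z X h : ℕ) {D : ℕ} (hD : D ≤ X + h) :
    roughSelberg z X h =
      ∑ d ∈ Ioc 0 D with Rough z d, (μ d : ℝ) *
        ∑ k ∈ quotInterval X h d with Rough z k, Real.log k ^ 2 +
      ∑ d ∈ Ioc D (X + h) with Rough z d, (μ d : ℝ) *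
        ∑ k ∈ quotInterval X h d with Rough z k, Real.log k ^ 2 := by
  have hg := sum_Ioc_sum_Ioc_div (fun d n => if n ∈ Ioc X (X + h) ∧ Rough z n then
    (μ d : ℝ) * Real.log ((n / d : ℕ) : ℝ) ^ 2 else 0) (X + h)
  have h1 : roughSelberg z X h = ∑ k ∈ Ioc 0 (X + h), ∑ d ∈ k.divisors,
      (if k ∈ Ioc X (X + h) ∧ Rough z k then
        (μ d : ℝ) * Real.log ((k / d : ℕ) : ℝ) ^ 2 else 0) := by
    have h2 : ∀ k ∈ Ioc 0 (X + h), ∑ d ∈ k.divisors, (if k ∈ Ioc X (X + h) ∧ Rough z k then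
        (μ d : ℝ) * Real.log ((k / d : ℕ) : ℝ) ^ 2 else 0) =
        if k ∈ Ioc X (X + h) ∧ Rough z k then selbergFn k else 0 := fun k hk => by
      split_ifs with hc
      · exact (selbergFn_eq_sum_moebius (mem_Ioc.1 hk).1).symm
      · simp
    rw [sum_congr rfl h2, ← sum_filter, roughSelberg]
    congr 1
    ext k
    simp only [mem_filter, mem_Ioc]
    constructor
    · rintro ⟨⟨a, b⟩, c⟩; exact ⟨⟨by omega, b⟩, ⟨a, b⟩, c⟩
    · rintro ⟨_, a, c⟩; exact ⟨a, c⟩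
  rw [h1, ← hg]
  have h3 : ∀ d ∈ Ioc 0 (X + h), ∑ n ∈ Ioc 0 ((X + h) / d),
      (if d * n ∈ Ioc X (X + h) ∧ Rough z (d * n) then
        (μ d : ℝ) * Real.log ((d * n / d : ℕ) : ℝ) ^ 2 else 0) =
      if Rough z d then (μ d : ℝ) * ∑ k ∈ quotInterval X h d with Rough z k, Real.log k ^ 2
      else 0 := fun d hd => by
    have hd0 : 0 < d := (mem_Ioc.1 hd).1
    simp only [rough_mul_iff, Nat.mul_div_cancel_left _ hd0]
    split_ifs with hr
    · rw [mul_sum, ← sum_filter]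
      congr 1
      ext k
      simp only [quotInterval, mem_filter, mem_Ioc, hr, true_and, Nat.le_div_iff_mul_le hd0]
      constructor
      · rintro ⟨⟨a, b⟩, ⟨c, e⟩, f⟩
        exact ⟨⟨⟨a, by nlinarith⟩, c, e⟩, f⟩
      · rintro ⟨⟨⟨a, b⟩, c, e⟩, f⟩
        exact ⟨⟨a, by linarith⟩, ⟨c, e⟩, f⟩
    · exact sum_eq_zero fun n _ => if_neg fun h => hr h.2.1
  rw [sum_congr rfl h3, ← sum_filter, ← sum_union (disjoint_filter_filter (by
    rw [disjoint_left]; intro a ha hb; simp only [mem_Ioc] at ha hb; omega)), ← filter_union]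
  congr 2
  ext a; simp only [mem_union, mem_Ioc]; omega

/-- The main term in the comparison of short intervals. -/
noncomputable def selbergMain (z X D : ℕ) : ℝ :=
  sieveProd z * ∑ d ∈ Ioc 0 D with Rough z d, (μ d : ℝ) * (Real.log ((X : ℝ) / d) ^ 2 / d)

lemma abs_sum_log_sq_sub_le {z X h d : ℕ} (hz : 2 ≤ z) (hX : 1 ≤ X) (hh : h ≤ X) (hd : 0 < d)
    (hdX : d ≤ X) {D₀ M : ℝ} (hD₀ : 1 ≤ D₀) (hu : 31 * Real.log z ≤ Real.log D₀)
    (hM1 : 1 ≤ M) (hM : Real.log (2 * X) ≤ M) {κ : ℝ}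
    (hκ : 160 * Real.exp 30 * Real.exp (-(Real.log D₀ / Real.log z) / 2) ≤ κ) :
    |∑ k ∈ quotInterval X h d with Rough z k, Real.log k ^ 2 -
        h / d * sieveProd z * Real.log ((X : ℝ) / d) ^ 2| ≤
      3 * M ^ 2 * (κ * (h / d / Real.log z) + (z * D₀ ^ 4 + 1)) + 2 * M * (h / d / Real.log z) := by
  have hlog : 0 < Real.log z := Real.log_pos (by exact_mod_cast hz)
  have hd' : (1 : ℝ) ≤ d := by exact_mod_cast hd
  have hX' : (1 : ℝ) ≤ X := by exact_mod_cast hX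
  have hdX' : (d : ℝ) ≤ X := by exact_mod_cast hdX
  have hh' : (h : ℝ) ≤ X := by exact_mod_cast hh
  have hh0 : (0 : ℝ) ≤ h / d := by positivity
  set E := κ * (h / d / Real.log z) + (z * D₀ ^ 4 + 1) with hE
  set S := (#{k ∈ quotInterval X h d | Rough z k} : ℝ) with hS
  set a := Real.log ((X : ℝ) / d) with ha
  have ha0 : 0 ≤ a := Real.log_nonneg (by rwa [le_div_iff₀ (by linarith), one_mul])
  have haM : a ≤ M := by
    refine le_trans (Real.log_le_log (by positivity) ?_) hM
    rw [div_le_iff₀ (by linarith)]; nlinarith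
  have hFL : |S - h / d * sieveProd z| ≤ E := by
    have h1 := abs_card_rough_sub_le hz hD₀ hu (A := quotInterval X h d) hh0 fun e he =>
      abs_card_quotInterval_sub_le X h hd (Nat.pos_of_dvd_of_pos he
        (Nat.pos_of_ne_zero (primeProd_ne_zero z)))
    have h2 : 160 * Real.exp 30 * ((h : ℝ) / d / Real.log z *
        Real.exp (-(Real.log D₀ / Real.log z) / 2)) ≤ κ * (h / d / Real.log z) := by
      calc _ = 160 * Real.exp 30 * Real.exp (-(Real.log D₀ / Real.log z) / 2) *
            (h / d / Real.log z) := by ring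
        _ ≤ _ := mul_le_mul_of_nonneg_right hκ (by positivity)
    exact h1.trans (by rw [hE]; linarith)
  have hterm : ∀ k ∈ (quotInterval X h d).filter (Rough z), |Real.log k ^ 2 - a ^ 2| ≤ 2 * M := by
    intro k hk
    simp only [quotInterval, mem_filter, mem_Ioc] at hk
    obtain ⟨⟨⟨hk0, hkX⟩, h1, h2⟩, -⟩ := hk
    have hk0' : (0 : ℝ) < k := by exact_mod_cast hk0
    have h1' : (X : ℝ) < d * k := by exact_mod_cast h1
    have h2' : (d : ℝ) * k ≤ X + h := by exact_mod_cast h2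
    have hlow : a ≤ Real.log k := by
      refine Real.log_le_log (by positivity) ?_
      rw [div_le_iff₀ (by linarith)]; linarith
    have hup : Real.log k ≤ a + Real.log 2 := by
      rw [ha, ← Real.log_mul (by positivity) (by norm_num)]
      refine Real.log_le_log hk0' ?_
      rw [div_mul_eq_mul_div, le_div_iff₀ (by linarith)]; linarith
    have hkM : Real.log k ≤ M := by
      refine le_trans (Real.log_le_log hk0' ?_) hM
      nlinarith
    have hl2 := Real.log_two_lt_d9
    rw [abs_of_nonneg (by nlinarith)]
    nlinarith
  have hdiff : |∑ k ∈ quotInterval X h d with Rough z k, Real.log k ^ 2 - S * a ^ 2| ≤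
      S * (2 * M) := by
    have : S * a ^ 2 = ∑ k ∈ quotInterval X h d with Rough z k, a ^ 2 := by simp [hS]
    rw [this, ← sum_sub_distrib]
    refine (abs_sum_le_sum_abs _ _).trans ((sum_le_card_nsmul _ _ _ hterm).trans ?_)
    rw [nsmul_eq_mul]
  have hV := sieveProd_le hz
  have hhV : h / d * sieveProd z ≤ h / d / Real.log z := by
    calc _ ≤ (h : ℝ) / d * (1 / Real.log z) := mul_le_mul_of_nonneg_left hV hh0
      _ = _ := by ring
  have hS2 : S ≤ h / d / Real.log z + E := by linarith [(abs_le.1 hFL).2]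
  have hE0 : 0 ≤ E := (abs_nonneg _).trans hFL
  have h3 : |S * a ^ 2 - h / d * sieveProd z * a ^ 2| ≤ E * M ^ 2 := by
    rw [← sub_mul, abs_mul, abs_of_nonneg (sq_nonneg a)]
    exact mul_le_mul hFL (pow_le_pow_left₀ ha0 haM 2) (sq_nonneg a) hE0
  calc _ ≤ S * (2 * M) + E * M ^ 2 := by
        have := abs_sub_le (∑ k ∈ quotInterval X h d with Rough z k, Real.log k ^ 2) (S * a ^ 2)
          (h / d * sieveProd z * a ^ 2)
        linarith
    _ ≤ (h / d / Real.log z + E) * (2 * M) + E * M ^ 2 := by gcongr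
    _ ≤ _ := by nlinarith [mul_nonneg hE0 (mul_nonneg (by linarith : 0 ≤ M) (sub_nonneg.2 hM1))]

lemma abs_roughSelberg_sub_le {z X h D E : ℕ} (hz : 2 ≤ z) (hX : 1 ≤ X) (hh : h ≤ X)
    (hDX : D ≤ X) (hDE : ∀ k : ℕ, k * (D + 1) ≤ 2 * X → k ≤ E)
    {D₀ M M' κ : ℝ} (hD₀ : 1 ≤ D₀) (hu : 31 * Real.log z ≤ Real.log D₀)
    (hM1 : 1 ≤ M) (hM : Real.log (2 * X) ≤ M) (hM' : Real.log E ≤ M')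
    (hκ : 160 * Real.exp 30 * Real.exp (-(Real.log D₀ / Real.log z) / 2) ≤ κ) :
    |roughSelberg z X h - h * selbergMain z X D| ≤
      (3 * M ^ 2 * κ + 2 * M) * (h / Real.log z) * ((1 + Real.log (D * z)) / Real.log z) +
        3 * M ^ 2 * (D * (z * D₀ ^ 4 + 1)) +
      M' ^ 2 * ((1 + κ) * (h / Real.log z) * ((1 + Real.log (E * z)) / Real.log z) +
        E * (z * D₀ ^ 4 + 1)) := by
  have hlog : 0 < Real.log z := Real.log_pos (by exact_mod_cast hz)
  set E₀ := z * D₀ ^ 4 + 1 with hE₀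
  have hE₀0 : 0 ≤ E₀ := by positivity
  have hκ0 : 0 ≤ κ := le_trans (by positivity) hκ
  have hμ : ∀ d : ℕ, |(μ d : ℝ)| ≤ 1 := fun d => by
    exact_mod_cast ArithmeticFunction.abs_moebius_le_one
  rw [roughSelberg_eq z X h (D := D) (by omega)]
  have hsmall : |∑ d ∈ Ioc 0 D with Rough z d, (μ d : ℝ) *
        ∑ k ∈ quotInterval X h d with Rough z k, Real.log k ^ 2 - h * selbergMain z X D| ≤
      (3 * M ^ 2 * κ + 2 * M) * (h / Real.log z) * ((1 + Real.log (D * z)) / Real.log z) +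
        3 * M ^ 2 * (D * E₀) := by
    have h1 : h * selbergMain z X D = ∑ d ∈ Ioc 0 D with Rough z d, (μ d : ℝ) *
        (h / d * sieveProd z * Real.log ((X : ℝ) / d) ^ 2) := by
      rw [selbergMain, mul_sum, mul_sum]
      exact sum_congr rfl fun d _ => by ring
    rw [h1, ← sum_sub_distrib]
    calc _ ≤ ∑ d ∈ Ioc 0 D with Rough z d, ((3 * M ^ 2 * κ + 2 * M) * (h / Real.log z) * (1 / d) +
          3 * M ^ 2 * E₀) := by
          refine (abs_sum_le_sum_abs _ _).trans (sum_le_sum fun d hd => ?_)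
          obtain ⟨hd0, hd1⟩ := mem_Ioc.1 (mem_filter.1 hd).1
          rw [← mul_sub, abs_mul]
          calc _ ≤ 1 * _ := mul_le_mul (hμ d) (abs_sum_log_sq_sub_le hz hX hh hd0 (hd1.trans hDX)
                hD₀ hu hM1 hM hκ) (abs_nonneg _) zero_le_one
            _ = _ := by rw [← hE₀]; ring
      _ = (3 * M ^ 2 * κ + 2 * M) * (h / Real.log z) * ∑ d ∈ Ioc 0 D with Rough z d, 1 / (d : ℝ) +
          3 * M ^ 2 * (#{d ∈ Ioc 0 D | Rough z d} * E₀) := by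
          rw [sum_add_distrib, ← mul_sum, sum_const, nsmul_eq_mul]; ring
      _ ≤ _ := by
          have h2 := sum_rough_inv_le hz D
          have h3 : (#{d ∈ Ioc 0 D | Rough z d} : ℝ) ≤ D := by
            exact_mod_cast (card_filter_le _ _).trans (Nat.card_Ioc 0 D).le
          gcongr
  have hlarge : |∑ d ∈ Ioc D (X + h) with Rough z d, (μ d : ℝ) *
        ∑ k ∈ quotInterval X h d with Rough z k, Real.log k ^ 2| ≤
      M' ^ 2 * ((1 + κ) * (h / Real.log z) * ((1 + Real.log (E * z)) / Real.log z) + E * E₀) := by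
    calc _ ≤ ∑ d ∈ Ioc D (X + h) with Rough z d,
          ∑ k ∈ quotInterval X h d with Rough z k, M' ^ 2 := by
          refine (abs_sum_le_sum_abs _ _).trans (sum_le_sum fun d hd => ?_)
          obtain ⟨hd0, hd1⟩ := mem_Ioc.1 (mem_filter.1 hd).1
          rw [abs_mul]
          have hs : ∑ k ∈ quotInterval X h d with Rough z k, Real.log k ^ 2 ≤
              ∑ k ∈ quotInterval X h d with Rough z k, M' ^ 2 := by
            refine sum_le_sum fun k hk => ?_
            simp only [quotInterval, mem_filter, mem_Ioc] at hk
            obtain ⟨⟨⟨hk0, -⟩, -, h2⟩, -⟩ := hk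
            have hkE : k ≤ E := hDE k (by nlinarith)
            exact pow_le_pow_left₀ (Real.log_natCast_nonneg k) (le_trans (Real.log_le_log
              (by exact_mod_cast hk0) (by exact_mod_cast hkE)) hM') 2
          have hnn : 0 ≤ ∑ k ∈ quotInterval X h d with Rough z k, Real.log k ^ 2 :=
            sum_nonneg fun k _ => sq_nonneg _
          rw [abs_of_nonneg hnn]
          calc _ ≤ 1 * _ := mul_le_mul (hμ d) hs hnn zero_le_one
            _ = _ := one_mul _
      _ ≤ ∑ k ∈ Ioc 0 E with Rough z k, ∑ d ∈ quotInterval X h k with Rough z d, M' ^ 2 := by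
          rw [sum_sigma', sum_sigma']
          refine (sum_le_sum_of_subset_of_nonneg (s := ((Ioc D (X + h)).filter (Rough z)).sigma
            fun d => (quotInterval X h d).filter (Rough z))
            (t := (((Ioc 0 E).filter (Rough z)).sigma fun k =>
              (quotInterval X h k).filter (Rough z)).map
              ⟨fun x => ⟨x.2, x.1⟩, fun x y hxy => ?_⟩) ?_ fun _ _ _ => sq_nonneg _).trans ?_
          · cases x; cases y; simp at hxy; simp [hxy]
          · rintro ⟨d, k⟩ hx
            simp only [mem_sigma, quotInterval, mem_filter, mem_Ioc] at hx
            obtain ⟨⟨⟨h1, h2⟩, h3⟩, ⟨⟨h4, h5⟩, h6, h7⟩, h8⟩ := hx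
            refine mem_map.2 ⟨⟨k, d⟩, ?_, rfl⟩
            simp only [mem_sigma, quotInterval, mem_filter, mem_Ioc]
            exact ⟨⟨⟨h4, hDE k (by nlinarith)⟩, h8⟩,
              ⟨⟨by omega, h2⟩, by linarith, by linarith⟩, h3⟩
          · rw [sum_map]
      _ ≤ ∑ k ∈ Ioc 0 E with Rough z k,
          M' ^ 2 * ((1 + κ) * (h / Real.log z) * (1 / k) + E₀) := by
          refine sum_le_sum fun k hk => ?_
          have hk0 := (mem_Ioc.1 (mem_filter.1 hk).1).1
          have hk0' : (0 : ℝ) < k := by exact_mod_cast hk0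
          rw [sum_const, nsmul_eq_mul, mul_comm]
          refine mul_le_mul_of_nonneg_left ?_ (sq_nonneg _)
          have hY : (0 : ℝ) ≤ h / k := by positivity
          have h1 := (abs_le.1 (abs_card_rough_sub_le hz hD₀ hu (A := quotInterval X h k) hY
            fun e he => abs_card_quotInterval_sub_le X h hk0 (Nat.pos_of_dvd_of_pos he
              (Nat.pos_of_ne_zero (primeProd_ne_zero z))))).2
          have h2 : 160 * Real.exp 30 * ((h : ℝ) / k / Real.log z *
              Real.exp (-(Real.log D₀ / Real.log z) / 2)) ≤ κ * (h / k / Real.log z) := by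
            calc _ = 160 * Real.exp 30 * Real.exp (-(Real.log D₀ / Real.log z) / 2) *
                  (h / k / Real.log z) := by ring
              _ ≤ _ := mul_le_mul_of_nonneg_right hκ (by positivity)
          have h3 : h / k * sieveProd z ≤ h / k / Real.log z := by
            calc _ ≤ (h : ℝ) / k * (1 / Real.log z) :=
                  mul_le_mul_of_nonneg_left (sieveProd_le hz) hY
              _ = _ := by ring
          have h4 : (1 + κ) * (h / Real.log z) * (1 / k) =
              h / k / Real.log z + κ * (h / k / Real.log z) := by ring
          linarith
      _ = M' ^ 2 * ((1 + κ) * (h / Real.log z) * ∑ k ∈ Ioc 0 E with Rough z k, 1 / (k : ℝ) +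
          #{k ∈ Ioc 0 E | Rough z k} * E₀) := by
          rw [← mul_sum, sum_add_distrib, ← mul_sum, sum_const, nsmul_eq_mul]
      _ ≤ _ := by
          have h2 := sum_rough_inv_le hz E
          have h3 : (#{d ∈ Ioc 0 E | Rough z d} : ℝ) ≤ E := by
            exact_mod_cast (card_filter_le _ _).trans (Nat.card_Ioc 0 E).le
          gcongr
  rw [add_sub_right_comm]
  exact (abs_add_le _ _).trans (add_le_add hsmall hlarge)

end ShortIntervals

section LongIntervals

open scoped ArithmeticFunction.vonMangoldt

lemma sum_not_rough_vonMangoldt_mul_le (z N : ℕ) {f : ℕ → ℝ} (hf : ∀ n, 0 ≤ f n) :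
    ∑ n ∈ Ioc 0 N with ¬ Rough z n, Λ n * f n ≤
      ∑ p ∈ Nat.primesBelow z, ∑ k ∈ Icc 1 (Nat.log p N), Real.log p * f (p ^ k) := by
  rw [sum_sigma']
  have h1 : ∀ x ∈ (Nat.primesBelow z).sigma fun p => Icc 1 (Nat.log p N),
      Real.log x.1 * f (x.1 ^ x.2) = Λ (x.1 ^ x.2) * f (x.1 ^ x.2) := by
    rintro ⟨p, k⟩ hx
    simp only [mem_sigma, mem_Icc] at hx
    rw [ArithmeticFunction.vonMangoldt_apply_pow (Nat.one_le_iff_ne_zero.1 hx.2.1),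
      ArithmeticFunction.vonMangoldt_apply_prime (Nat.prime_of_mem_primesBelow hx.1)]
  rw [sum_congr rfl h1]
  have hnn : ∀ n, 0 ≤ Λ n * f n := fun n =>
    mul_nonneg ArithmeticFunction.vonMangoldt_nonneg (hf n)
  have hinj : Set.InjOn (fun x : (_ : ℕ) × ℕ => x.1 ^ x.2)
      ((Nat.primesBelow z).sigma fun p => Icc 1 (Nat.log p N) : Finset ((_ : ℕ) × ℕ)) := by
    rintro ⟨p, k⟩ hx ⟨q, l⟩ hy h
    simp only [coe_sigma, Set.mem_sigma_iff, mem_coe, mem_Icc] at hx hy h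
    have hp := Nat.prime_of_mem_primesBelow hx.1
    have hq := Nat.prime_of_mem_primesBelow hy.1
    have hpq : p = q := (Nat.prime_dvd_prime_iff_eq hp hq).1
      (hp.dvd_of_dvd_pow (h ▸ dvd_pow_self p (by omega)))
    subst hpq
    simp [Nat.pow_right_injective hp.two_le h]
  rw [← sum_image (f := fun n => Λ n * f n) hinj, ← sum_filter_ne_zero]
  refine sum_le_sum_of_subset_of_nonneg (fun n hn => ?_) fun n _ _ => hnn n
  simp only [mem_filter, mem_Ioc] at hn
  obtain ⟨⟨⟨hn0, hnN⟩, hr⟩, hne⟩ := hn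
  have hpp : IsPrimePow n := ArithmeticFunction.vonMangoldt_ne_zero_iff.1 (left_ne_zero_of_mul hne)
  obtain ⟨p, k, hp, hk, rfl⟩ := (isPrimePow_nat_iff n).1 hpp
  simp only [Rough, not_forall, not_le] at hr
  obtain ⟨q, hq, hqd, hqz⟩ := hr
  have hpq : q = p := (Nat.prime_dvd_prime_iff_eq hq hp).1 (hq.dvd_of_dvd_pow hqd)
  subst hpq
  refine mem_image.2 ⟨⟨q, k⟩, ?_, rfl⟩
  simp only [mem_sigma, mem_Icc]
  exact ⟨Nat.mem_primesBelow.2 ⟨hqz, hp⟩, hk, Nat.le_log_of_pow_le hp.one_lt hnN⟩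

lemma sum_not_rough_vonMangoldt_le (z : ℕ) {N : ℕ} (hN : 1 ≤ N) :
    ∑ n ∈ Ioc 0 N with ¬ Rough z n, Λ n ≤ z * Real.log N := by
  have h := sum_not_rough_vonMangoldt_mul_le z N (f := fun _ => 1) (fun _ => zero_le_one)
  simp only [mul_one] at h
  refine h.trans ?_
  have h1 : ∀ p ∈ Nat.primesBelow z, ∑ k ∈ Icc 1 (Nat.log p N), Real.log p ≤ Real.log N := by
    intro p hp
    rw [sum_const, nsmul_eq_mul, Nat.card_Icc, Nat.add_sub_cancel, ← Real.log_pow]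
    refine Real.log_le_log ?_ (by exact_mod_cast Nat.pow_log_le_self p (by omega))
    have := (Nat.prime_of_mem_primesBelow hp).pos
    positivity
  refine (sum_le_card_nsmul _ _ _ h1).trans ?_
  rw [nsmul_eq_mul]
  have : (#(Nat.primesBelow z) : ℝ) ≤ z := by
    exact_mod_cast (card_le_card (filter_subset _ _)).trans (card_range z).le
  exact mul_le_mul_of_nonneg_right this (Real.log_natCast_nonneg N)

lemma sum_not_rough_vonMangoldt_div_le {z : ℕ} (hz : 1 ≤ z) (N : ℕ) :
    ∑ n ∈ Ioc 0 N with ¬ Rough z n, Λ n / n ≤ 2 * (Real.log z + 6) := by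
  have h := sum_not_rough_vonMangoldt_mul_le z N (f := fun n => (n : ℝ)⁻¹)
    (fun _ => by positivity)
  simp only [← div_eq_mul_inv] at h
  refine h.trans (le_trans ?_ (mul_le_mul_of_nonneg_left (sum_log_div_primesBelow_le hz)
    zero_le_two))
  rw [mul_sum]
  refine sum_le_sum fun p hp => ?_
  have hpp := Nat.prime_of_mem_primesBelow hp
  have hp2 : (2 : ℝ) ≤ p := by exact_mod_cast hpp.two_le
  have hlp : 0 ≤ Real.log p := Real.log_natCast_nonneg p
  have hx : (p : ℝ)⁻¹ < 1 := inv_lt_one_of_one_lt₀ (by linarith)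
  have hgeo : ∑ k ∈ Icc 1 (Nat.log p N), ((p : ℝ)⁻¹) ^ k ≤ 2 / p := by
    have h1 : ∑ k ∈ Icc 1 (Nat.log p N), ((p : ℝ)⁻¹) ^ k =
        (p : ℝ)⁻¹ * ∑ k ∈ range (Nat.log p N), ((p : ℝ)⁻¹) ^ k := by
      rw [mul_sum, range_eq_Ico, ← Ico_add_one_right_eq_Icc, sum_Ico_eq_sum_range,
        sum_Ico_eq_sum_range]
      simp [pow_add]
    rw [h1]
    have h2 : ∑ k ∈ range (Nat.log p N), ((p : ℝ)⁻¹) ^ k ≤ 2 := by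
      have h3 := geom_sum_mul_neg ((p : ℝ)⁻¹) (Nat.log p N)
      have h4 : (p : ℝ)⁻¹ ≤ 1 / 2 := by
        rw [one_div]; exact inv_anti₀ (by norm_num) hp2
      have h5 : 0 ≤ ((p : ℝ)⁻¹) ^ (Nat.log p N) := by positivity
      have h6 : 0 ≤ ∑ k ∈ range (Nat.log p N), ((p : ℝ)⁻¹) ^ k :=
        sum_nonneg fun _ _ => by positivity
      nlinarith
    calc _ ≤ (p : ℝ)⁻¹ * 2 := by gcongr
      _ = 2 / p := by ring
  calc ∑ k ∈ Icc 1 (Nat.log p N), Real.log p / ((p ^ k : ℕ) : ℝ)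
      = Real.log p * ∑ k ∈ Icc 1 (Nat.log p N), ((p : ℝ)⁻¹) ^ k := by
        rw [mul_sum]
        exact sum_congr rfl fun k _ => by push_cast; rw [div_eq_mul_inv, inv_pow]
    _ ≤ Real.log p * (2 / p) := by gcongr
    _ = _ := by ring

lemma sum_not_rough_conv_le {z : ℕ} (hz : 1 ≤ z) (N : ℕ) :
    ∑ n ∈ Ioc 0 N with ¬ Rough z n,
      (ArithmeticFunction.vonMangoldt * ArithmeticFunction.vonMangoldt) n ≤
      24 * N * (Real.log z + 6) := by
  have hg := sum_Ioc_sum_Ioc_div (fun d n => if ¬ Rough z n then Λ d * Λ (n / d) else 0) N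
  have h1 : ∑ n ∈ Ioc 0 N with ¬ Rough z n,
      (ArithmeticFunction.vonMangoldt * ArithmeticFunction.vonMangoldt) n =
      ∑ k ∈ Ioc 0 N, ∑ d ∈ k.divisors, if ¬ Rough z k then Λ d * Λ (k / d) else 0 := by
    rw [sum_filter]
    refine sum_congr rfl fun k _ => ?_
    split_ifs with hc
    · simp
    · rw [ArithmeticFunction.mul_apply, Nat.sum_divisorsAntidiagonal (fun d e => Λ d * Λ e)]
  rw [h1, ← hg]
  have hΛ : ∀ n, 0 ≤ Λ n := fun n => ArithmeticFunction.vonMangoldt_nonneg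
  have hhalf : ∑ d ∈ Ioc 0 N, ∑ m ∈ Ioc 0 (N / d), (if ¬ Rough z d then Λ d * Λ m else 0) ≤
      12 * N * (Real.log z + 6) := by
    calc _ ≤ ∑ d ∈ Ioc 0 N, if ¬ Rough z d then 6 * N * (Λ d / d) else 0 := by
          refine sum_le_sum fun d hd => ?_
          split_ifs with hc
          · simp
          · rw [← mul_sum, ← psi_natCast]
            have h2 := psi_le_six_mul (x := ((N / d : ℕ) : ℝ)) (by positivity)
            have h3 : ((N / d : ℕ) : ℝ) ≤ N / d := Nat.cast_div_le
            calc Λ d * Chebyshev.psi ((N / d : ℕ) : ℝ) ≤ Λ d * (6 * (N / d)) :=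
                  mul_le_mul_of_nonneg_left (by linarith) (hΛ d)
              _ = _ := by ring
      _ = 6 * N * ∑ d ∈ Ioc 0 N with ¬ Rough z d, Λ d / d := by
          rw [← sum_filter, mul_sum]
      _ ≤ 6 * N * (2 * (Real.log z + 6)) := by
          gcongr
          exact sum_not_rough_vonMangoldt_div_le hz N
      _ = _ := by ring
  have hswap : ∑ d ∈ Ioc 0 N, ∑ m ∈ Ioc 0 (N / d), (if ¬ Rough z m then Λ d * Λ m else 0) =
      ∑ d ∈ Ioc 0 N, ∑ m ∈ Ioc 0 (N / d), (if ¬ Rough z d then Λ d * Λ m else 0) := by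
    rw [sum_comm' (t' := Ioc 0 N) (s' := fun m => Ioc 0 (N / m))]
    · refine sum_congr rfl fun d _ => sum_congr rfl fun m _ => ?_
      simp only [mul_comm]
    · intro a b
      simp only [mem_Ioc]
      constructor
      · rintro ⟨⟨h1, h2⟩, h3, h4⟩
        rw [Nat.le_div_iff_mul_le h1] at h4
        refine ⟨⟨h1, ?_⟩, h3, by nlinarith⟩
        rw [Nat.le_div_iff_mul_le h3]; linarith
      · rintro ⟨⟨h1, h2⟩, h3, h4⟩
        rw [Nat.le_div_iff_mul_le h3] at h2
        refine ⟨⟨h1, by nlinarith⟩, h3, ?_⟩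
        rw [Nat.le_div_iff_mul_le h1]; linarith
  calc _ ≤ ∑ d ∈ Ioc 0 N, ∑ m ∈ Ioc 0 (N / d), ((if ¬ Rough z d then Λ d * Λ m else 0) +
        (if ¬ Rough z m then Λ d * Λ m else 0)) := by
        refine sum_le_sum fun d hd => sum_le_sum fun m _ => ?_
        rw [Nat.mul_div_cancel_left _ (mem_Ioc.1 hd).1]
        simp only [rough_mul_iff]
        have := mul_nonneg (hΛ d) (hΛ m)
        by_cases h : Rough z d <;> by_cases h' : Rough z m <;> simp [h, h', this]
    _ ≤ _ := by
        simp_rw [sum_add_distrib]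
        rw [hswap]; linarith

lemma abs_roughSelberg_self_sub_le {z X : ℕ} (hz : 1 ≤ z) (hX : 1 ≤ X) :
    |roughSelberg z X X - 2 * X * Real.log X| ≤
      1804 * X + z * Real.log (2 * X) ^ 2 + 48 * X * (Real.log z + 6) := by
  have hX' : (1 : ℝ) ≤ X := by exact_mod_cast hX
  have h1 := abs_le.1 (abs_sum_selbergFn_sub_le hX)
  have h2 := abs_le.1 (abs_sum_selbergFn_sub_le (N := 2 * X) (by omega))
  have h3 : ∑ n ∈ Ioc 0 (2 * X), selbergFn n = ∑ n ∈ Ioc 0 X, selbergFn n +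
      (roughSelberg z X X + ∑ n ∈ Ioc X (2 * X) with ¬ Rough z n, selbergFn n) := by
    rw [roughSelberg, ← two_mul, sum_filter_add_sum_filter_not,
      ← sum_union (by rw [disjoint_left]; intro a ha hb; simp only [mem_Ioc] at ha hb; omega)]
    congr 1
    ext a; simp only [mem_union, mem_Ioc]; omega
  have h4 : 0 ≤ ∑ n ∈ Ioc X (2 * X) with ¬ Rough z n, selbergFn n :=
    sum_nonneg fun n _ => selbergFn_nonneg n
  have h5 : ∑ n ∈ Ioc X (2 * X) with ¬ Rough z n, selbergFn n ≤
      z * Real.log (2 * X) ^ 2 + 48 * X * (Real.log z + 6) := by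
    calc _ ≤ ∑ n ∈ Ioc 0 (2 * X) with ¬ Rough z n, selbergFn n :=
          sum_le_sum_of_subset_of_nonneg (filter_subset_filter _
            (Ioc_subset_Ioc_left (Nat.zero_le _))) fun n _ _ => selbergFn_nonneg n
      _ = ∑ n ∈ Ioc 0 (2 * X) with ¬ Rough z n, Λ n * Real.log n +
          ∑ n ∈ Ioc 0 (2 * X) with ¬ Rough z n,
            (ArithmeticFunction.vonMangoldt * ArithmeticFunction.vonMangoldt) n := by
          rw [← sum_add_distrib]; rfl
      _ ≤ _ := by
          have h6 := sum_not_rough_conv_le hz (2 * X)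
          have h7 := sum_not_rough_vonMangoldt_le z (N := 2 * X) (by omega)
          have h8 : ∑ n ∈ Ioc 0 (2 * X) with ¬ Rough z n, Λ n * Real.log n ≤
              (∑ n ∈ Ioc 0 (2 * X) with ¬ Rough z n, Λ n) * Real.log (2 * X : ℕ) := by
            rw [sum_mul]
            refine sum_le_sum fun n hn => ?_
            obtain ⟨h9, h10⟩ := mem_Ioc.1 (mem_filter.1 hn).1
            exact mul_le_mul_of_nonneg_left (Real.log_le_log (by exact_mod_cast h9)
              (by exact_mod_cast h10)) ArithmeticFunction.vonMangoldt_nonneg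
          have h11 := mul_le_mul_of_nonneg_right h7 (Real.log_natCast_nonneg (2 * X))
          push_cast at h6 h8 h11 ⊢
          linarith
  have h6 : Real.log (2 * X : ℝ) = Real.log 2 + Real.log X :=
    Real.log_mul (by norm_num) (by linarith)
  push_cast at h2
  rw [h3] at h2
  have h7 := Real.log_two_lt_d9
  have h8 := Real.log_two_gt_d9
  have h9 : 2 * (2 * (X : ℝ)) * Real.log (2 * X) = 4 * X * Real.log 2 + 4 * X * Real.log X := by
    rw [h6]; ring
  rw [h9] at h2
  rw [abs_le]
  constructor <;> nlinarith

end LongIntervals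

section ShortAsymptotics

open Real Filter

lemma log_ceil_exp_bounds {x : ℝ} (hx : 1 ≤ x) :
    x ≤ Real.log ⌈exp x⌉₊ ∧ Real.log ⌈exp x⌉₊ ≤ 2 * x ∧ (⌈exp x⌉₊ : ℝ) ≤ 2 * exp x ∧
      2 ≤ ⌈exp x⌉₊ := by
  have h1 : (1 : ℝ) ≤ exp x := one_le_exp (by linarith)
  have h2 : exp x ≤ ⌈exp x⌉₊ := Nat.le_ceil _
  have h3 : (⌈exp x⌉₊ : ℝ) ≤ 2 * exp x := by
    have := (Nat.ceil_lt_add_one (exp_pos x).le).le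
    linarith
  refine ⟨(le_log_iff_exp_le (by linarith)).2 h2, ?_, h3, ?_⟩
  · rw [log_le_iff_le_exp (by linarith), two_mul x, exp_add]
    nlinarith [add_one_le_exp x]
  · have : (1 : ℝ) < ⌈exp x⌉₊ := by linarith [add_one_le_exp x]
    exact_mod_cast this

set_option maxHeartbeats 1000000 in
lemma abs_roughSelberg_sub_main_le {t L : ℝ} (ht : 0 < t) (ht1 : t ≤ 1 / 992)
    (hL1 : 1 ≤ t ^ 5 * L) {X h : ℕ} (hX : exp (4 * (t ^ 4 * L)) ≤ X)
    (hX2 : X ≤ exp (2 * L)) (hh : X * exp (-(t ^ 4 * L)) ≤ h) (hhX : h ≤ X)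
    (hκ1 : 160 * exp 30 * exp (-(1 / (64 * t))) ≤ 1) :
    |roughSelberg ⌈exp (t ^ 5 * L)⌉₊ X h -
        h * selbergMain ⌈exp (t ^ 5 * L)⌉₊ X ⌊X * exp (-(2 * (t ^ 4 * L)))⌋₊| ≤
      h * (108 * (160 * exp 30 * exp (-(1 / (64 * t)))) / t ^ 10 * L + 24 / t ^ 10 +
        90 * t ^ 2 * L + 135 * L ^ 2 * exp (-(t ^ 4 * L / 2))) := by
  obtain ⟨hz1, hz2, hz3, hz4⟩ := log_ceil_exp_bounds hL1
  set z := ⌈exp (t ^ 5 * L)⌉₊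
  set κ := 160 * exp 30 * exp (-(1 / (64 * t))) with hκ
  set D := ⌊X * exp (-(2 * (t ^ 4 * L)))⌋₊
  have hL0 : 0 < L := by
    by_contra hc
    have : t ^ 5 * L ≤ 0 := mul_nonpos_of_nonneg_of_nonpos (by positivity) (by linarith)
    linarith
  have h54 : 992 * (t ^ 5 * L) ≤ t ^ 4 * L := by
    have : t ^ 5 * L = t * (t ^ 4 * L) := by ring
    rw [this]
    have h0 : 0 < t ^ 4 * L := by positivity
    nlinarith
  have h40 : 992 * (t ^ 4 * L) ≤ L := by
    have h4 : t ^ 4 ≤ t := by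
      calc t ^ 4 ≤ t ^ 1 := pow_le_pow_of_le_one ht.le (by linarith) (by norm_num)
        _ = t := pow_one t
    nlinarith
  have hX0 : (1 : ℝ) ≤ X := le_trans (one_le_exp (by positivity)) hX
  have hX1 : 1 ≤ X := by exact_mod_cast hX0
  have hlogX : Real.log X ≤ 2 * L := (log_le_iff_le_exp (by linarith)).2 hX2
  have hDle : (D : ℝ) ≤ X * exp (-(2 * (t ^ 4 * L))) := Nat.floor_le (by positivity)
  have hDX : (D : ℝ) ≤ X := hDle.trans <| by
    have : exp (-(2 * (t ^ 4 * L))) ≤ 1 := exp_le_one_iff.2 (by linarith)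
    nlinarith
  have hD1 : (1 : ℝ) ≤ D := by
    have : 1 ≤ D := by
      apply Nat.le_floor
      rw [Nat.cast_one]
      calc (1 : ℝ) ≤ exp (4 * (t ^ 4 * L)) * exp (-(2 * (t ^ 4 * L))) := by
            rw [← exp_add]; exact one_le_exp (by linarith)
        _ ≤ _ := by gcongr
    exact_mod_cast this
  set E := ⌊2 * exp (2 * (t ^ 4 * L))⌋₊
  have hEle : (E : ℝ) ≤ 2 * exp (2 * (t ^ 4 * L)) := Nat.floor_le (by positivity)
  have hE1 : (1 : ℝ) ≤ E := by
    have : 1 ≤ E := by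
      apply Nat.le_floor
      rw [Nat.cast_one]
      linarith [add_one_le_exp (2 * (t ^ 4 * L))]
    exact_mod_cast this
  have hDE : ∀ k : ℕ, k * (D + 1) ≤ 2 * X → k ≤ E := by
    intro k hk
    apply Nat.le_floor
    have hk' : (k : ℝ) * (D + 1) ≤ 2 * X := by exact_mod_cast hk
    have hD := (Nat.lt_floor_add_one (X * exp (-(2 * (t ^ 4 * L))))).le
    have h1 : (k : ℝ) * (X * exp (-(2 * (t ^ 4 * L)))) ≤ 2 * X :=
      le_trans (by gcongr) hk'
    rw [exp_neg] at h1
    have h2 : (k : ℝ) * X ≤ (2 * exp (2 * (t ^ 4 * L))) * X := by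
      have he := exp_pos (2 * (t ^ 4 * L))
      rw [← mul_assoc, ← div_eq_mul_inv, div_le_iff₀ he] at h1
      linarith
    exact le_of_mul_le_mul_right h2 (by linarith)
  have hz0 : 0 < Real.log z := by linarith
  have hzpos : (0 : ℝ) < z := by exact_mod_cast (by omega : 0 < z)
  have key := abs_roughSelberg_sub_le hz4 hX1 hhX (by exact_mod_cast hDX) hDE
    (D₀ := exp (t ^ 4 * L / 16)) (M := 3 * L) (M' := 3 * (t ^ 4 * L)) (κ := κ)
    (one_le_exp (by positivity)) (by rw [log_exp]; linarith) (by linarith)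
    (by rw [log_mul (by norm_num) (by positivity)]; linarith [log_two_lt_d9])
    (by
      calc Real.log E ≤ Real.log (2 * exp (2 * (t ^ 4 * L))) := log_le_log (by linarith) hEle
        _ = Real.log 2 + 2 * (t ^ 4 * L) := by rw [log_mul (by norm_num) (exp_pos _).ne', log_exp]
        _ ≤ _ := by linarith [log_two_lt_d9])
    (by
      rw [hκ, log_exp]
      gcongr
      rw [neg_div, neg_le_neg_iff, div_div, div_div]
      rw [div_le_div_iff₀ (by positivity) (by positivity)]
      have : Real.log z * t ≤ 2 * (t ^ 4 * L) * t ^ 2 := by nlinarith [mul_le_mul_of_nonneg_right hz2 ht.le]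
      nlinarith)
  refine key.trans ?_
  have hlogD : Real.log (D * z) ≤ 3 * L := by
    rw [log_mul (by positivity) (by positivity)]
    have := log_le_log (by linarith) hDX
    linarith
  have hlogE : Real.log (E * z) ≤ 4 * (t ^ 4 * L) := by
    rw [log_mul (by positivity) (by positivity)]
    have : Real.log E ≤ Real.log (2 * exp (2 * (t ^ 4 * L))) := log_le_log (by linarith) hEle
    rw [log_mul (by norm_num) (exp_pos _).ne', log_exp] at this
    linarith [log_two_lt_d9]
  have hκ0 : 0 < κ := by positivity
  have hz2' : (2 : ℝ) ≤ z := by exact_mod_cast hz4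
  have hqD : 0 ≤ (1 + Real.log (D * z)) / Real.log z :=
    div_nonneg (by linarith [log_nonneg (x := (D : ℝ) * z) (by nlinarith)]) hz0.le
  have hqE : 0 ≤ (1 + Real.log (E * z)) / Real.log z :=
    div_nonneg (by linarith [log_nonneg (x := (E : ℝ) * z) (by nlinarith)]) hz0.le
  have hh0 : (0 : ℝ) ≤ h := Nat.cast_nonneg h
  have hA : (3 * (3 * L) ^ 2 * κ + 2 * (3 * L)) * (h / Real.log z) *
      ((1 + Real.log (D * z)) / Real.log z) ≤ h * (108 * κ / t ^ 10 * L + 24 / t ^ 10) := by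
    calc _ ≤ (3 * (3 * L) ^ 2 * κ + 2 * (3 * L)) * (h / (t ^ 5 * L)) * (4 * L / (t ^ 5 * L)) := by
          gcongr
          linarith
      _ = _ := by field_simp; ring
  have hB : (3 * (t ^ 4 * L)) ^ 2 * ((1 + κ) * (h / Real.log z) *
      ((1 + Real.log (E * z)) / Real.log z)) ≤ h * (90 * t ^ 2 * L) := by
    calc _ ≤ (3 * (t ^ 4 * L)) ^ 2 * ((1 + 1) * (h / (t ^ 5 * L)) * (5 * (t ^ 4 * L) / (t ^ 5 * L))) := by
          gcongr
          linarith
      _ = _ := by field_simp; ring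
  have hW : (z : ℝ) * exp (t ^ 4 * L / 16) ^ 4 + 1 ≤ 3 * exp (t ^ 4 * L / 2) := by
    have h1 : (z : ℝ) * exp (t ^ 4 * L / 16) ^ 4 ≤ 2 * exp (t ^ 4 * L / 2) := by
      calc (z : ℝ) * exp (t ^ 4 * L / 16) ^ 4 ≤ 2 * exp (t ^ 5 * L) * exp (t ^ 4 * L / 16) ^ 4 := by
            gcongr
        _ = 2 * exp (t ^ 5 * L + 4 * (t ^ 4 * L / 16)) := by
            rw [exp_add, ← exp_nat_mul]; push_cast; ring_nf
        _ ≤ _ := by gcongr; linarith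
    linarith [one_le_exp (show 0 ≤ t ^ 4 * L / 2 by positivity)]
  have hE' : (E : ℝ) ≤ 2 * (X * exp (-(2 * (t ^ 4 * L)))) := by
    refine hEle.trans ?_
    have : exp (2 * (t ^ 4 * L)) = exp (4 * (t ^ 4 * L)) * exp (-(2 * (t ^ 4 * L))) := by
      rw [← exp_add]; ring_nf
    rw [this]; gcongr
  have hP : (X : ℝ) * exp (-(2 * (t ^ 4 * L))) * exp (t ^ 4 * L / 2) ≤
      h * exp (-(t ^ 4 * L / 2)) := by
    calc (X : ℝ) * exp (-(2 * (t ^ 4 * L))) * exp (t ^ 4 * L / 2)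
        = X * exp (-(t ^ 4 * L)) * exp (-(t ^ 4 * L / 2)) := by
          rw [mul_assoc, mul_assoc, ← exp_add, ← exp_add]; ring_nf
      _ ≤ _ := by gcongr
  have hC : 3 * (3 * L) ^ 2 * (D * (z * exp (t ^ 4 * L / 16) ^ 4 + 1)) +
      (3 * (t ^ 4 * L)) ^ 2 * (E * (z * exp (t ^ 4 * L / 16) ^ 4 + 1)) ≤
      h * (135 * L ^ 2 * exp (-(t ^ 4 * L / 2))) := by
    have ht4 : t ^ 4 * L ≤ L := by linarith [show 0 < t ^ 4 * L by positivity]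
    calc _ ≤ 3 * (3 * L) ^ 2 * ((X * exp (-(2 * (t ^ 4 * L)))) * (3 * exp (t ^ 4 * L / 2))) +
        (3 * L) ^ 2 * ((2 * (X * exp (-(2 * (t ^ 4 * L))))) * (3 * exp (t ^ 4 * L / 2))) := by
          gcongr
      _ = 135 * L ^ 2 * (X * exp (-(2 * (t ^ 4 * L))) * exp (t ^ 4 * L / 2)) := by ring
      _ ≤ 135 * L ^ 2 * (h * exp (-(t ^ 4 * L / 2))) := by gcongr
      _ = _ := by ring
  linarith

lemma exists_short_parameters {ε : ℝ} (hε : 0 < ε) : ∃ t : ℝ, 0 < t ∧ t ≤ 1 / 992 ∧ t ≤ ε ∧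
    16 * t ^ 4 ≤ ε ∧ 1600 * t ^ 5 ≤ ε ∧ 160 * exp 30 * exp (-(1 / (64 * t))) ≤ 1 ∧
    108 * (160 * exp 30 * exp (-(1 / (64 * t)))) / t ^ 10 + 90 * t ^ 2 ≤ ε / 8 := by
  have hlim (k : ℕ) : Tendsto (fun s : ℝ => s ^ k * exp (-(s / 64))) atTop (nhds 0) := by
    have h := (tendsto_pow_mul_exp_neg_atTop_nhds_zero k).comp
      (tendsto_id.atTop_div_const (show (0 : ℝ) < 64 by norm_num))
    have h2 := h.const_mul ((64 : ℝ) ^ k)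
    rw [mul_zero] at h2
    refine h2.congr fun s => ?_
    simp only [Function.comp, id, div_pow]
    field_simp
  have e1 := ((hlim 0).const_mul (160 * exp 30)).eventually (gt_mem_nhds (by simp : _ < (1 : ℝ)))
  have e2 := ((hlim 10).const_mul (108 * (160 * exp 30))).eventually
    (gt_mem_nhds (by rw [mul_zero]; positivity : _ < ε / 16))
  obtain ⟨s, h1, h2, h3, h4⟩ := (e1.and (e2.and ((eventually_ge_atTop 2000).and
    (eventually_ge_atTop (2000 / ε))))).exists
  have hs : 0 < s := by linarith
  have hsε : s⁻¹ ≤ ε / 2000 := by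
    rw [inv_le_comm₀ hs (by positivity), inv_div]; exact h4
  have hs1 : s⁻¹ ≤ 1 / 2000 := by rw [inv_le_comm₀ hs (by positivity)]; linarith
  have hs0 : 0 < s⁻¹ := by positivity
  have hp (k : ℕ) : s⁻¹ ^ (k + 1) ≤ s⁻¹ :=
    pow_le_of_le_one hs0.le (by linarith) (by omega)
  have hexp : exp (-(1 / (64 * s⁻¹))) = exp (-(s / 64)) := by
    congr 2; field_simp
  refine ⟨s⁻¹, by positivity, by linarith, by linarith, ?_, ?_, ?_, ?_⟩
  · linarith [hp 3]
  · linarith [hp 4]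
  · rw [hexp]; simpa using h1.le
  · rw [hexp, inv_pow s 10, div_inv_eq_mul]
    have := hp 1
    norm_num at this
    nlinarith

set_option maxHeartbeats 1000000 in
/-- Selberg's formula in short intervals for the numbers without small prime factors. -/
theorem exists_abs_roughSelberg_sub_le {ε : ℝ} (hε : 0 < ε) (hε1 : ε ≤ 1) :
    ∃ t : ℝ, 0 < t ∧ t ≤ 1 / 992 ∧ t ≤ ε ∧ 16 * t ^ 4 ≤ ε ∧ ∀ᶠ L : ℝ in atTop, ∀ X H : ℕ,
      exp (ε * L) ≤ X → X ≤ exp (2 * L) → X * exp (-(t ^ 4 * L)) ≤ H → H ≤ X →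
      |roughSelberg ⌈exp (t ^ 5 * L)⌉₊ X H - 2 * H * Real.log X| ≤ ε * H * L := by
  obtain ⟨t, ht, ht1, htε, h16, h1600, hκ1, hbig⟩ := exists_short_parameters hε
  refine ⟨t, ht, ht1, htε, h16, ?_⟩
  have hlim (a c : ℝ) (ha : 0 < a) : Tendsto (fun L : ℝ => c * (L * exp (-(a * L)))) atTop (nhds 0) := by
    have h := (tendsto_pow_mul_exp_neg_atTop_nhds_zero 1).comp
      (tendsto_id.const_mul_atTop ha)
    have h2 := h.const_mul (c / a)
    rw [mul_zero] at h2
    refine h2.congr fun s => ?_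
    simp only [Function.comp, id]
    field_simp
  have e1 := (hlim (t ^ 4 / 2) 135 (by positivity)).eventually
    (gt_mem_nhds (by positivity : 0 < ε / 16))
  have e2 := (hlim (ε / 2) 18 (by positivity)).eventually
    (gt_mem_nhds (by positivity : 0 < ε / 16))
  have h5 : 0 < t ^ 5 := by positivity
  filter_upwards [e1, e2, eventually_ge_atTop (1 / t ^ 5),
    eventually_ge_atTop (24 / t ^ 10 * (16 / ε)), eventually_ge_atTop ((1804 + 288) * (16 / ε)),
    eventually_ge_atTop 1] with L h1 h2 h3 h4 h6 hL1 X H hX hX2 hH hHX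
  have hL : 0 < L := by linarith
  rw [div_le_iff₀ h5, mul_comm] at h3
  have h4' : 24 / t ^ 10 ≤ ε / 16 * L := by
    have := mul_le_mul_of_nonneg_right h4 (show 0 ≤ ε / 16 by positivity)
    have he : 24 / t ^ 10 * (16 / ε) * (ε / 16) = 24 / t ^ 10 := by field_simp
    linarith
  have h6' : 1804 + 288 ≤ ε / 16 * L := by
    have := mul_le_mul_of_nonneg_right h6 (show 0 ≤ ε / 16 by positivity)
    have he : (1804 + 288) * (16 / ε) * (ε / 16) = 1804 + 288 := by field_simp
    linarith
  have hXL : exp (4 * (t ^ 4 * L)) ≤ X := le_trans (exp_le_exp.2 (by nlinarith)) hX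
  have hX0 : (1 : ℝ) ≤ X := le_trans (one_le_exp (by positivity)) hX
  have hX1 : 1 ≤ X := by exact_mod_cast hX0
  have hlogX : Real.log X ≤ 2 * L := (log_le_iff_le_exp (by linarith)).2 hX2
  set z := ⌈exp (t ^ 5 * L)⌉₊ with hz
  set m := selbergMain z X ⌊X * exp (-(2 * (t ^ 4 * L)))⌋₊ with hm
  have hη : 108 * (160 * exp 30 * exp (-(1 / (64 * t)))) / t ^ 10 * L + 24 / t ^ 10 +
        90 * t ^ 2 * L + 135 * L ^ 2 * exp (-(t ^ 4 * L / 2)) ≤ ε / 4 * L := by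
    have a1 := mul_le_mul_of_nonneg_right hbig hL.le
    have a2 := mul_le_mul_of_nonneg_right h1.le hL.le
    have a3 : t ^ 4 / 2 * L = t ^ 4 * L / 2 := by ring
    rw [a3] at a2
    nlinarith
  have b1 := abs_roughSelberg_sub_main_le ht ht1 h3 hXL hX2 hH hHX hκ1
  have b2 := abs_roughSelberg_sub_main_le ht ht1 h3 hXL hX2 (h := X)
    (by have : exp (-(t ^ 4 * L)) ≤ 1 := exp_le_one_iff.2 (by simp; positivity)
        nlinarith) le_rfl hκ1
  obtain ⟨hz1, hz2, hz3, hz4⟩ := log_ceil_exp_bounds h3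
  have b3 := abs_roughSelberg_self_sub_le (z := z) (X := X) (by omega) hX1
  have hH0 : (0 : ℝ) ≤ H := Nat.cast_nonneg H
  have c1 : |roughSelberg z X H - H * m| ≤ H * (ε / 4 * L) := b1.trans (by gcongr)
  have c2 : |roughSelberg z X X - X * m| ≤ X * (ε / 4 * L) := b2.trans (by gcongr)
  have c3 : |roughSelberg z X X - 2 * X * Real.log X| ≤ X * (ε / 4 * L) := by
    refine b3.trans ?_
    have hl2 : Real.log (2 * X) ≤ 3 * L := by
      rw [log_mul (by norm_num) (by positivity)]; linarith [log_two_lt_d9]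
    have hl0 : 0 ≤ Real.log (2 * X) := log_nonneg (by linarith)
    have d1 : (z : ℝ) * Real.log (2 * X) ^ 2 ≤ X * (ε / 16 * L) := by
      have hzX : (z : ℝ) ≤ 2 * (X * exp (-(ε / 2 * L))) := by
        calc (z : ℝ) ≤ 2 * exp (t ^ 5 * L) := hz3
          _ ≤ 2 * (exp (ε * L) * exp (-(ε / 2 * L))) := by
              rw [← exp_add]; gcongr; nlinarith
          _ ≤ _ := by gcongr
      calc (z : ℝ) * Real.log (2 * X) ^ 2 ≤ 2 * (X * exp (-(ε / 2 * L))) * (3 * L) ^ 2 := by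
            gcongr
        _ = X * (18 * (L * exp (-(ε / 2 * L))) * L) := by ring
        _ ≤ _ := by gcongr
    have d2 : 48 * (X : ℝ) * (Real.log z + 6) ≤ 48 * X * (2 * (t ^ 5 * L) + 6) := by gcongr
    have d3 : t ^ 5 * L ≤ ε / 1600 * L := by
      have := mul_le_mul_of_nonneg_right h1600 hL.le
      linarith
    have d4 : 1804 + ε / 16 * L + 48 * (2 * (t ^ 5 * L) + 6) ≤ ε / 4 * L := by
      have : 0 < ε * L := by positivity
      linarith
    have := mul_le_mul_of_nonneg_left d4 (show (0 : ℝ) ≤ X by linarith)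
    linarith
  have hq : |2 * (H : ℝ) * Real.log X - H * m| ≤ H * (ε / 2 * L) := by
    have : |2 * (X : ℝ) * Real.log X - X * m| ≤ X * (ε / 2 * L) := by
      have e1 := abs_sub_le (2 * (X : ℝ) * Real.log X) (roughSelberg z X X) (X * m)
      rw [abs_sub_comm (2 * (X : ℝ) * Real.log X) (roughSelberg z X X)] at e1
      linarith
    have e1 : 2 * (X : ℝ) * Real.log X - X * m = X * (2 * Real.log X - m) := by ring
    have e2 : 2 * (H : ℝ) * Real.log X - H * m = H * (2 * Real.log X - m) := by ring
    rw [e1, abs_mul, abs_of_pos (by linarith : (0 : ℝ) < X)] at this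
    rw [e2, abs_mul, abs_of_nonneg hH0]
    gcongr
    exact le_of_mul_le_mul_left this (by linarith)
  have := abs_sub_le (roughSelberg z X H) (H * m) (2 * H * Real.log X)
  rw [abs_sub_comm (H * m) (2 * H * Real.log X)] at this
  have : 0 ≤ H * (ε * L) := by positivity
  linarith

end ShortAsymptotics

section Cells

open scoped ArithmeticFunction.vonMangoldt

/-- The index `i` of the logarithmic cell `[exp (i κ), exp ((i + 1) κ))` containing `n`. -/
noncomputable def cellIdx (κ : ℝ) (n : ℕ) : ℕ := ⌊Real.log n / κ⌋₊

/-- The first integer in the `m`-th logarithmic cell. -/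
noncomputable def cellBd (κ : ℝ) (m : ℕ) : ℕ := ⌈Real.exp (m * κ)⌉₊

open Classical in
/-- The von Mangoldt function divided by `n`, restricted to rough numbers. -/
noncomputable def roughMass (z n : ℕ) : ℝ := if Rough z n then Λ n / n else 0

/-- The total `roughMass` of a logarithmic cell, truncated below `T`. -/
noncomputable def cellSum (κ : ℝ) (z T i : ℕ) : ℝ :=
  ∑ n ∈ Ico 1 T with cellIdx κ n = i, roughMass z n

lemma roughMass_nonneg (z n : ℕ) : 0 ≤ roughMass z n := by
  unfold roughMass
  split_ifs
  · exact div_nonneg ArithmeticFunction.vonMangoldt_nonneg (Nat.cast_nonneg n)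
  · exact le_rfl

lemma cellSum_nonneg (κ : ℝ) (z T i : ℕ) : 0 ≤ cellSum κ z T i :=
  sum_nonneg fun n _ => roughMass_nonneg z n

lemma one_le_cellBd (κ : ℝ) (m : ℕ) : 1 ≤ cellBd κ m := Nat.ceil_pos.2 (Real.exp_pos _)

variable {κ : ℝ}

lemma cellBd_mono (hκ : 0 < κ) : Monotone (cellBd κ) := fun m n h => by
  unfold cellBd
  gcongr

lemma cellIdx_lt_iff (hκ : 0 < κ) {n : ℕ} (hn : 1 ≤ n) (m : ℕ) :
    cellIdx κ n < m ↔ n < cellBd κ m := by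
  have hn' : (1 : ℝ) ≤ n := by exact_mod_cast hn
  rw [cellIdx, cellBd, Nat.floor_lt (div_nonneg (Real.log_nonneg hn') hκ.le), Nat.lt_ceil,
    div_lt_iff₀ hκ, Real.log_lt_iff_lt_exp (by linarith)]

lemma le_cellIdx_iff (hκ : 0 < κ) {n : ℕ} (hn : 1 ≤ n) (m : ℕ) :
    m ≤ cellIdx κ n ↔ cellBd κ m ≤ n := by
  rw [← not_lt, cellIdx_lt_iff hκ hn, not_lt]

lemma cellIdx_mul (hκ : 0 < κ) {m n : ℕ} (hm : 1 ≤ m) (hn : 1 ≤ n) :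
    cellIdx κ m + cellIdx κ n ≤ cellIdx κ (m * n) ∧
      cellIdx κ (m * n) ≤ cellIdx κ m + cellIdx κ n + 1 := by
  have hm' : (1 : ℝ) ≤ m := by exact_mod_cast hm
  have hn' : (1 : ℝ) ≤ n := by exact_mod_cast hn
  have h1 := div_nonneg (Real.log_nonneg hm') hκ.le
  have h2 := div_nonneg (Real.log_nonneg hn') hκ.le
  have a1 := Nat.floor_le h1
  have a2 := Nat.floor_le h2
  have b1 := Nat.lt_floor_add_one (Real.log m / κ)
  have b2 := Nat.lt_floor_add_one (Real.log n / κ)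
  have e : Real.log (m * n : ℕ) / κ = Real.log m / κ + Real.log n / κ := by
    rw [Nat.cast_mul, Real.log_mul (by linarith) (by linarith), add_div]
  unfold cellIdx
  rw [e]
  constructor
  · apply Nat.le_floor
    push_cast
    linarith
  · apply Nat.le_of_lt_succ
    rw [Nat.floor_lt (by linarith)]
    push_cast
    linarith

lemma sum_range_cellSum (hκ : 0 < κ) {z T m : ℕ} (hm : cellBd κ m ≤ T) :
    ∑ i ∈ range m, cellSum κ z T i = ∑ n ∈ Ico 1 (cellBd κ m), roughMass z n := by
  have : Ico 1 (cellBd κ m) = {n ∈ Ico 1 T | cellIdx κ n < m} := by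
    ext n
    simp only [mem_Ico, mem_filter]
    constructor
    · rintro ⟨h1, h2⟩
      exact ⟨⟨h1, h2.trans_le hm⟩, (cellIdx_lt_iff hκ h1 m).2 h2⟩
    · rintro ⟨⟨h1, _⟩, h2⟩
      exact ⟨h1, (cellIdx_lt_iff hκ h1 m).1 h2⟩
  rw [this, ← sum_fiberwise_of_maps_to (t := range m) (g := cellIdx κ)
    (fun n hn => mem_range.2 (mem_filter.1 hn).2)]
  refine sum_congr rfl fun i hi => ?_
  rw [cellSum, filter_filter]
  refine sum_congr (filter_congr fun n _ => ?_) fun _ _ => rfl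
  have := mem_range.1 hi
  constructor
  · rintro rfl; exact ⟨this, rfl⟩
  · exact fun h => h.2

lemma sum_shift_cellSum (hκ : 0 < κ) {z T k B : ℕ} (hm : cellBd κ (k + B) ≤ T) :
    ∑ b ∈ range B, cellSum κ z T (k + b) =
      ∑ n ∈ Ico (cellBd κ k) (cellBd κ (k + B)), roughMass z n := by
  have h1 := sum_range_cellSum (z := z) hκ hm
  have hk := cellBd_mono hκ (Nat.le_add_right k B)
  have h2 := sum_range_cellSum (z := z) hκ (hk.trans hm)
  rw [sum_range_add, h2, ← sum_Ico_consecutive _ (one_le_cellBd κ k) hk] at h1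
  linarith

lemma selfConv_cellSum (κ : ℝ) (z T s : ℕ) :
    selfConv (cellSum κ z T) s = ∑ m ∈ Ico 1 T, ∑ n ∈ Ico 1 T,
      if cellIdx κ m + cellIdx κ n = s then roughMass z m * roughMass z n else 0 := by
  have : ∀ i, cellSum κ z T i = ∑ n ∈ Ico 1 T, if cellIdx κ n = i then roughMass z n else 0 :=
    fun i => by rw [cellSum, sum_filter]
  simp only [selfConv, this, sum_mul_sum]
  rw [sum_comm]
  refine sum_congr rfl fun m _ => ?_
  rw [sum_comm]
  refine sum_congr rfl fun n _ => ?_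
  split_ifs with h
  · rw [sum_eq_single (cellIdx κ m)]
    · rw [if_pos rfl, if_pos (by omega)]
    · intro i _ hi
      rw [if_neg (Ne.symm hi), zero_mul]
    · intro hi; exact absurd (mem_range.2 (by omega)) hi
  · refine sum_eq_zero fun i hi => ?_
    have := mem_range.1 hi
    by_cases h1 : cellIdx κ m = i
    · rw [if_neg (c := cellIdx κ n = s - i) (by omega), mul_zero]
    · rw [if_neg h1, zero_mul]

lemma sum_selberg_div_eq {z T P Q : ℕ} (hP : 1 ≤ P) (hQ : Q ≤ T) :
    ∑ n ∈ Ico P Q with Rough z n, selbergFn n / n =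
      ∑ n ∈ Ico P Q, roughMass z n * Real.log n +
        ∑ m ∈ Ico 1 T, ∑ n ∈ Ico 1 T,
          if m * n ∈ Ico P Q then roughMass z m * roughMass z n else 0 := by
  classical
  have h1 : ∀ N ∈ Ico P Q, (if Rough z N then selbergFn N / N else 0) =
      roughMass z N * Real.log N +
        ∑ x ∈ N.divisorsAntidiagonal, roughMass z x.1 * roughMass z x.2 := by
    intro N hN
    have hN0 : N ≠ 0 := by have := mem_Ico.1 hN; omega
    have h2 : ∀ x ∈ N.divisorsAntidiagonal, roughMass z x.1 * roughMass z x.2 =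
        if Rough z N then Λ x.1 * Λ x.2 / N else 0 := by
      intro x hx
      have hx' := (Nat.mem_divisorsAntidiagonal.1 hx).1
      simp only [roughMass, ← hx', rough_mul_iff]
      by_cases h : Rough z x.1 <;> by_cases h' : Rough z x.2 <;> simp [h, h', div_mul_div_comm]
    rw [sum_congr rfl h2]
    simp only [roughMass]
    split_ifs
    · rw [selbergFn, ArithmeticFunction.mul_apply, ← sum_div]
      ring
    · simp
  rw [sum_filter, sum_congr rfl h1, sum_add_distrib]
  congr 1
  rw [← sum_product', ← sum_filter, ← sum_fiberwise_of_maps_to (t := Ico P Q)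
    (g := fun x : ℕ × ℕ => x.1 * x.2) (fun x hx => (mem_filter.1 hx).2)]
  refine sum_congr rfl fun N hN => sum_congr ?_ fun _ _ => rfl
  ext ⟨a, b⟩
  have hN' := mem_Ico.1 hN
  simp only [Nat.mem_divisorsAntidiagonal, mem_filter, mem_product, mem_Ico]
  constructor
  · rintro ⟨rfl, h0⟩
    have ha : 0 < a := Nat.pos_of_ne_zero (left_ne_zero_of_mul h0)
    have hb : 0 < b := Nat.pos_of_ne_zero (right_ne_zero_of_mul h0)
    have := Nat.le_mul_of_pos_right a hb
    have := Nat.le_mul_of_pos_left b ha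
    omega
  · rintro ⟨⟨_, _⟩, h⟩
    exact ⟨h, by omega⟩

end Cells

section Cells

variable {κ : ℝ}

lemma sum_ite_mul_mem_Ico_bounds (hκ : 0 < κ) {z T k B : ℕ} (hk : 1 ≤ k) (hB : 1 ≤ B) :
    (∑ m ∈ Ico 1 T, ∑ n ∈ Ico 1 T,
        if m * n ∈ Ico (cellBd κ k) (cellBd κ (k + B)) then roughMass z m * roughMass z n else 0) ≤
      ∑ b ∈ range B, selfConv (cellSum κ z T) (k + b) + selfConv (cellSum κ z T) (k - 1) ∧
    ∑ b ∈ range B, selfConv (cellSum κ z T) (k + b) ≤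
      (∑ m ∈ Ico 1 T, ∑ n ∈ Ico 1 T,
        if m * n ∈ Ico (cellBd κ k) (cellBd κ (k + B)) then roughMass z m * roughMass z n else 0) +
        selfConv (cellSum κ z T) (k + B - 1) := by
  have hsum : ∀ (c : ℕ) (x : ℝ), ∑ b ∈ range B, (if c = k + b then x else 0) =
      if k ≤ c ∧ c < k + B then x else 0 := by
    intro c x
    split_ifs with h
    · rw [sum_eq_single (c - k), if_pos (by omega)]
      · intro b _ hb; rw [if_neg (by omega)]
      · intro hb; exact absurd (mem_range.2 (by omega)) hb
    · refine sum_eq_zero fun b hb => ?_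
      have := mem_range.1 hb
      rw [if_neg (by omega)]
  have hC : ∑ b ∈ range B, selfConv (cellSum κ z T) (k + b) = ∑ m ∈ Ico 1 T, ∑ n ∈ Ico 1 T,
      if k ≤ cellIdx κ m + cellIdx κ n ∧ cellIdx κ m + cellIdx κ n < k + B then
        roughMass z m * roughMass z n else 0 := by
    simp only [selfConv_cellSum]
    rw [sum_comm]
    refine sum_congr rfl fun m _ => ?_
    rw [sum_comm]
    exact sum_congr rfl fun n _ => hsum _ _
  rw [hC, selfConv_cellSum, selfConv_cellSum, ← sum_add_distrib, ← sum_add_distrib]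
  have key : ∀ m ∈ Ico 1 T, ∀ n ∈ Ico 1 T, 0 ≤ roughMass z m * roughMass z n ∧
      (m * n ∈ Ico (cellBd κ k) (cellBd κ (k + B)) ↔
        k ≤ cellIdx κ (m * n) ∧ cellIdx κ (m * n) < k + B) ∧
      cellIdx κ m + cellIdx κ n ≤ cellIdx κ (m * n) ∧
      cellIdx κ (m * n) ≤ cellIdx κ m + cellIdx κ n + 1 := by
    intro m hm n hn
    have hm1 := (mem_Ico.1 hm).1
    have hn1 := (mem_Ico.1 hn).1
    have hmn : 1 ≤ m * n := Nat.mul_pos hm1 hn1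
    refine ⟨mul_nonneg (roughMass_nonneg z m) (roughMass_nonneg z n), ?_, cellIdx_mul hκ hm1 hn1⟩
    rw [mem_Ico, le_cellIdx_iff hκ hmn, cellIdx_lt_iff hκ hmn]
  constructor
  · refine sum_le_sum fun m hm => ?_
    rw [← sum_add_distrib]
    refine sum_le_sum fun n hn => ?_
    obtain ⟨h0, h1, h2, h3⟩ := key m hm n hn
    simp only [h1]
    split_ifs <;> first | omega | linarith
  · refine sum_le_sum fun m hm => ?_
    rw [← sum_add_distrib]
    refine sum_le_sum fun n hn => ?_
    obtain ⟨h0, h1, h2, h3⟩ := key m hm n hn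
    simp only [h1]
    split_ifs <;> first | omega | linarith

lemma abs_selfConv_sub_le {a b : ℕ → ℝ} (ha : ∀ i, 0 ≤ a i) (hb : ∀ i, 0 ≤ b i) {c A A' : ℝ}
    {i₀ i₁ s : ℕ} (hs : s < i₁) (hs₀ : 2 * i₀ ≤ s) (hab : ∀ i, i₀ ≤ i → i < i₁ → a i = b i)
    (hc : ∀ i, i₀ ≤ i → i < i₁ → a i ≤ c) (hA : ∑ i ∈ range i₀, a i ≤ A)
    (hA' : ∑ i ∈ range i₀, b i ≤ A') :
    |selfConv a s - selfConv b s| ≤ 2 * c * (A + A') := by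
  have hc0 : 0 ≤ c := (ha i₀).trans (hc i₀ le_rfl (by omega))
  have hsum : ∑ i ∈ range (s + 1), (if i < i₀ then (a i + b i) * c else 0) ≤ c * (A + A') := by
    rw [← sum_filter]
    have : {i ∈ range (s + 1) | i < i₀} = range i₀ := by
      ext i; simp only [mem_filter, mem_range]; omega
    rw [this, ← sum_mul, sum_add_distrib, mul_comm]
    gcongr
  have hsum' : ∑ i ∈ range (s + 1), (if s - i < i₀ then (a (s - i) + b (s - i)) * c else 0) ≤
      c * (A + A') := by
    rw [← sum_range_reflect] at hsum
    refine le_trans (le_of_eq ?_) hsum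
    refine sum_congr rfl fun i hi => ?_
    have : s + 1 - 1 - i = s - i := by omega
    rw [this]
  rw [selfConv, selfConv, ← sum_sub_distrib]
  calc _ ≤ ∑ i ∈ range (s + 1), |a i * a (s - i) - b i * b (s - i)| := abs_sum_le_sum_abs _ _
    _ ≤ ∑ i ∈ range (s + 1), ((if i < i₀ then (a i + b i) * c else 0) +
        (if s - i < i₀ then (a (s - i) + b (s - i)) * c else 0)) := by
        refine sum_le_sum fun i hi => ?_
        have hi' := mem_range.1 hi
        by_cases h1 : i < i₀
        · rw [if_pos h1, if_neg (by omega), add_zero]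
          have e := hab (s - i) (by omega) (by omega)
          rw [← e, ← sub_mul, abs_mul, abs_of_nonneg (ha _)]
          refine mul_le_mul ?_ (hc _ (by omega) (by omega)) (ha _)
            (add_nonneg (ha _) (hb _))
          rw [abs_le]; constructor <;> linarith [ha i, hb i]
        · by_cases h2 : s - i < i₀
          · rw [if_neg h1, if_pos h2, zero_add]
            have e := hab i (by omega) (by omega)
            rw [← e, ← mul_sub, abs_mul, abs_of_nonneg (ha _), mul_comm]
            refine mul_le_mul ?_ (hc _ (by omega) (by omega)) (ha _)
              (add_nonneg (ha _) (hb _))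
            rw [abs_le]; constructor <;> linarith [ha (s - i), hb (s - i)]
          · rw [if_neg h1, if_neg h2, hab i (by omega) (by omega),
              hab (s - i) (by omega) (by omega)]
            simp
    _ ≤ _ := by rw [sum_add_distrib]; linarith

lemma selfConv_le_of_le {a : ℕ → ℝ} (ha : ∀ i, 0 ≤ a i) {c A : ℝ}
    {i₀ i₁ s : ℕ} (hs : s < i₁) (hs₀ : 2 * i₀ ≤ s)
    (hc : ∀ i, i₀ ≤ i → i < i₁ → a i ≤ c) (hA : ∑ i ∈ range i₀, a i ≤ A) :
    selfConv a s ≤ 2 * c * A + (s + 1) * c ^ 2 := by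
  have hc0 : 0 ≤ c := (ha i₀).trans (hc i₀ le_rfl (by omega))
  have h := abs_selfConv_sub_le ha (b := fun i => if i < i₀ then 0 else a i) (c := c) (A := A)
    (A' := 0) (i₀ := i₀) (i₁ := i₁) (s := s)
    (fun i => by split_ifs; exacts [le_rfl, ha i]) hs hs₀
    (fun i hi _ => by rw [if_neg (by omega)]) hc hA
    (by rw [sum_eq_zero]; intro i hi; rw [if_pos (mem_range.1 hi)])
  have h2 : selfConv (fun i => if i < i₀ then 0 else a i) s ≤ (s + 1) * c ^ 2 := by
    rw [selfConv]
    calc _ ≤ ∑ i ∈ range (s + 1), c ^ 2 := by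
          refine sum_le_sum fun i hi => ?_
          have := mem_range.1 hi
          rw [sq]
          split_ifs
          · simp; positivity
          · simp; positivity
          · simp; positivity
          · exact mul_le_mul (hc _ (by omega) (by omega)) (hc _ (by omega) (by omega)) (ha _) hc0
      _ = _ := by simp
  have := abs_le.1 h
  linarith

lemma selfConv_mul_one_add (κ : ℝ) (r : ℕ → ℝ) (s : ℕ) :
    selfConv (fun i => κ * (1 + r i)) s =
      κ ^ 2 * ((s + 1) + 2 * ∑ i ∈ range (s + 1), r i + selfConv r s) := by
  have h : ∑ i ∈ range (s + 1), r (s - i) = ∑ i ∈ range (s + 1), r i := by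
    rw [← sum_range_reflect r (s + 1)]
    exact sum_congr rfl fun i hi => by congr 1
  have : ∀ i, κ * (1 + r i) * (κ * (1 + r (s - i))) =
      κ ^ 2 * (1 + r i + r (s - i) + r i * r (s - i)) := fun i => by ring
  simp only [selfConv, this]
  rw [← mul_sum, sum_add_distrib, sum_add_distrib, sum_add_distrib, h]
  simp only [sum_const, card_range, nsmul_eq_mul, Nat.cast_add, Nat.cast_one, mul_one]
  ring

/-- The relative deviation of the mass of the `i`-th cell from its expected value, set to zero
outside `[i₀, i₁)`. -/
noncomputable def cellDev (κ : ℝ) (z i₀ i₁ i : ℕ) : ℝ :=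
  if i₀ ≤ i ∧ i < i₁ then cellSum κ z (cellBd κ i₁) i / κ - 1 else 0

lemma abs_sum_cellDev_le (hκ : 0 < κ) {z i₀ i₁ : ℕ} {ρ : ℝ}
    (hM : ∀ m ≤ i₁, |∑ n ∈ Ico 1 (cellBd κ m), roughMass z n - m * κ| ≤ ρ) (hi : i₀ ≤ i₁) (m : ℕ) :
    |∑ i ∈ range m, cellDev κ z i₀ i₁ i| ≤ 2 * ρ / κ := by
  have hρ : 0 ≤ ρ := (abs_nonneg _).trans (hM 0 (Nat.zero_le _))
  have hmain : ∀ m, i₀ ≤ m → m ≤ i₁ → |∑ i ∈ range m, cellDev κ z i₀ i₁ i| ≤ 2 * ρ / κ := by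
    intro m h0 h1
    have hz : ∑ i ∈ range m, cellDev κ z i₀ i₁ i =
        ∑ i ∈ Ico i₀ m, (cellSum κ z (cellBd κ i₁) i / κ - 1) := by
      rw [range_eq_Ico, ← sum_Ico_consecutive _ (Nat.zero_le _) h0, sum_eq_zero, zero_add]
      · refine sum_congr rfl fun i hi => ?_
        have := mem_Ico.1 hi
        rw [cellDev, if_pos (by omega)]
      · intro i hi
        have := mem_Ico.1 hi
        rw [cellDev, if_neg (by omega)]
    have e1 := sum_range_cellSum (z := z) hκ (cellBd_mono hκ h1)
    have e0 := sum_range_cellSum (z := z) hκ (cellBd_mono hκ hi)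
    rw [hz, sum_sub_distrib, ← sum_div, sum_Ico_eq_sub _ h0, e1, e0]
    simp only [sum_const, Nat.card_Ico, nsmul_eq_mul, mul_one, Nat.cast_sub h0]
    have a1 := abs_le.1 (hM m h1)
    have a0 := abs_le.1 (hM i₀ hi)
    rw [abs_le, ← neg_div, div_le_iff₀ hκ, le_div_iff₀ hκ, sub_mul, div_mul_cancel₀ _ hκ.ne']
    constructor <;> linarith
  rcases lt_or_ge m i₀ with h | h
  · rw [sum_eq_zero]
    · rw [abs_zero]; positivity
    · intro i hi
      have := mem_range.1 hi
      rw [cellDev, if_neg (by omega)]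
  · rcases le_or_gt m i₁ with h1 | h1
    · exact hmain m h h1
    · have : ∑ i ∈ range m, cellDev κ z i₀ i₁ i = ∑ i ∈ range i₁, cellDev κ z i₀ i₁ i := by
        rw [← sum_range_add_sum_Ico _ h1.le, add_eq_left]
        refine sum_eq_zero fun i hi => ?_
        have := mem_Ico.1 hi
        rw [cellDev, if_neg (by omega)]
      rw [this]
      exact hmain i₁ hi le_rfl

lemma abs_cellDev_le (hκ : 0 < κ) {z i₀ i₁ : ℕ} {C : ℝ} (hC : 1 ≤ C)
    (hA : ∀ i, i₀ ≤ i → i < i₁ → cellSum κ z (cellBd κ i₁) i ≤ (1 + C) * κ) (i : ℕ) :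
    |cellDev κ z i₀ i₁ i| ≤ C := by
  rw [cellDev]
  split_ifs with h
  · have h1 := hA i h.1 h.2
    have h2 := cellSum_nonneg κ z (cellBd κ i₁) i
    have h3 : cellSum κ z (cellBd κ i₁) i / κ ≤ 1 + C := by rwa [div_le_iff₀ hκ]
    have h4 : 0 ≤ cellSum κ z (cellBd κ i₁) i / κ := by positivity
    rw [abs_le]; constructor <;> linarith
  · rw [abs_zero]; linarith

theorem abs_cellDev_selberg_le (hκ : 0 < κ) {z N B i₀ i₁ k : ℕ} {ρ : ℝ} (hρ0 : 0 < ρ) (hρ : ρ ≤ 1)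
    (hM : ∀ m ≤ i₁, |∑ n ∈ Ico 1 (cellBd κ m), roughMass z n - m * κ| ≤ ρ * N * κ)
    (hS : i₀ ≤ k → |∑ n ∈ Ico (cellBd κ k) (cellBd κ (k + B)) with Rough z n, selbergFn n / n -
      2 * (B * κ) * (k * κ)| ≤ ρ * (B * κ) * (N * κ))
    (hA : ∀ i, i₀ ≤ i → i < i₁ → cellSum κ z (cellBd κ i₁) i ≤ 3 * κ)
    (hi₀ : i₀ ≤ ρ * N) (hB : B ≤ ρ * N) (hBρ : 1 ≤ ρ * B) (hi₁ : i₁ ≤ 2 * N) (hi : i₀ ≤ i₁)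
    (hk : k + B ≤ i₁) :
    |k * ∑ b ∈ range B, cellDev κ z i₀ i₁ (k + b) +
      ∑ b ∈ range B, selfConv (cellDev κ z i₀ i₁) (k + b)| ≤ 100 * ρ * N * B := by
  set r := cellDev κ z i₀ i₁ with hr
  set T := cellBd κ i₁ with hT
  set a := cellSum κ z T with ha
  have hB0 : (0 : ℝ) < B := by
    by_contra hc
    have : (B : ℝ) = 0 := le_antisymm (not_lt.1 hc) (Nat.cast_nonneg B)
    rw [this] at hBρ; linarith
  have hB1 : 1 ≤ B := by exact_mod_cast hB0
  have hN0 : (0 : ℝ) < N := by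
    have : 0 < ρ * N := hB0.trans_le hB
    exact pos_of_mul_pos_right this hρ0.le
  have hr2 : ∀ i, |r i| ≤ 2 := abs_cellDev_le hκ (by norm_num) (fun i h h' => by
    have := hA i h h'; norm_num; linarith)
  have hk0 : (0 : ℝ) ≤ k := Nat.cast_nonneg k
  rcases Nat.lt_or_ge (2 * i₀) k with hk2 | hk2
  swap
  · have hk' : (k : ℝ) ≤ 2 * i₀ := by exact_mod_cast hk2
    have b1 : |k * ∑ b ∈ range B, r (k + b)| ≤ (2 * (ρ * N)) * (B * 2) := by
      rw [abs_mul, abs_of_nonneg hk0]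
      refine mul_le_mul (by linarith) ?_ (abs_nonneg _) (by positivity)
      refine (abs_sum_le_sum_abs _ _).trans ((sum_le_sum fun b _ => hr2 (k + b)).trans ?_)
      simp
    have b2 : |∑ b ∈ range B, selfConv r (k + b)| ≤ B * (4 * (4 * (ρ * N))) := by
      refine (abs_sum_le_sum_abs _ _).trans ?_
      have : ∀ b ∈ range B, |selfConv r (k + b)| ≤ 4 * (4 * (ρ * N)) := by
        intro b hb
        have hb' : (b : ℝ) + 1 ≤ B := by exact_mod_cast mem_range.1 hb
        refine (abs_sum_le_sum_abs _ _).trans ?_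
        calc _ ≤ ∑ i ∈ range (k + b + 1), (4 : ℝ) := by
              refine sum_le_sum fun i _ => ?_
              rw [abs_mul]
              calc |r i| * |r (k + b - i)| ≤ 2 * 2 :=
                    mul_le_mul (hr2 _) (hr2 _) (abs_nonneg _) (by norm_num)
                _ = 4 := by norm_num
          _ = ((k : ℝ) + (b + 1)) * 4 := by simp; ring
          _ ≤ _ := by nlinarith
      refine (sum_le_sum this).trans ?_
      simp
    have h0 : 0 ≤ ρ * N * B := by positivity
    calc _ ≤ _ := abs_add_le _ _
      _ ≤ (2 * (ρ * N)) * (B * 2) + B * (4 * (4 * (ρ * N))) := add_le_add b1 b2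
      _ ≤ _ := by linarith
  have hS' := abs_le.1 (hS (by omega))
  have hT1 : cellBd κ (k + B) ≤ T := cellBd_mono hκ hk
  rw [sum_selberg_div_eq (one_le_cellBd κ k) hT1] at hS'
  obtain ⟨hc1, hc2⟩ := sum_ite_mul_mem_Ico_bounds hκ (z := z) (T := T) (k := k) (B := B)
    (by omega) hB1
  set S₂ := ∑ m ∈ Ico 1 T, ∑ n ∈ Ico 1 T,
        if m * n ∈ Ico (cellBd κ k) (cellBd κ (k + B)) then roughMass z m * roughMass z n else 0
  set S₁ := ∑ n ∈ Ico (cellBd κ k) (cellBd κ (k + B)), roughMass z n * Real.log n with hS₁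
  have ha0 : ∀ i, 0 ≤ a i := cellSum_nonneg κ z T
  have hAi : ∑ i ∈ range i₀, a i ≤ 2 * (ρ * N * κ) := by
    rw [ha, sum_range_cellSum hκ (cellBd_mono hκ hi)]
    have h1 := abs_le.1 (hM i₀ hi)
    have h2 := mul_le_mul_of_nonneg_right hi₀ hκ.le
    linarith
  have hshift : ∑ b ∈ range B, a (k + b) = ∑ n ∈ Ico (cellBd κ k) (cellBd κ (k + B)),
      roughMass z n := sum_shift_cellSum hκ hT1
  have hak : ∀ b ∈ range B, a (k + b) = κ * (1 + r (k + b)) := by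
    intro b hb
    have := mem_range.1 hb
    rw [hr, cellDev, if_pos (by omega)]
    field_simp
    ring
  have hashift : ∑ b ∈ range B, a (k + b) = κ * (B + ∑ b ∈ range B, r (k + b)) := by
    rw [sum_congr rfl hak, ← mul_sum, sum_add_distrib]; simp
  have hale : ∑ b ∈ range B, a (k + b) ≤ B * (3 * κ) := by
    refine (sum_le_sum fun b hb => hA (k + b) (by omega) (by have := mem_range.1 hb; omega)).trans ?_
    simp
  have hS₁le : k * κ * ∑ b ∈ range B, a (k + b) ≤ S₁ ∧
      S₁ ≤ (k + B) * κ * ∑ b ∈ range B, a (k + b) := by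
    rw [hshift, mul_sum, mul_sum]
    have hlog : ∀ n ∈ Ico (cellBd κ k) (cellBd κ (k + B)), k * κ ≤ Real.log n ∧
        Real.log n ≤ (k + B) * κ := by
      intro n hn
      obtain ⟨h1, h2⟩ := mem_Ico.1 hn
      have hn1 : 1 ≤ n := (one_le_cellBd κ k).trans h1
      have hn0 : (0 : ℝ) < n := by exact_mod_cast hn1
      constructor
      · rw [Real.le_log_iff_exp_le hn0]; exact Nat.ceil_le.1 h1
      · rw [Real.log_le_iff_le_exp hn0]
        have := (Nat.lt_ceil.1 h2).le
        push_cast at this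
        exact this
    constructor
    · refine sum_le_sum fun n hn => ?_
      rw [mul_comm]; exact mul_le_mul_of_nonneg_left (hlog n hn).1 (roughMass_nonneg z n)
    · refine sum_le_sum fun n hn => ?_
      rw [mul_comm (_ * κ)]; exact mul_le_mul_of_nonneg_left (hlog n hn).2 (roughMass_nonneg z n)
  have hedge : ∀ s, 2 * i₀ ≤ s → s < i₁ → selfConv a s ≤ 30 * N * κ ^ 2 := by
    intro s h1 h2
    have h3 := selfConv_le_of_le ha0 h2 h1 hA hAi
    have h4 : (s : ℝ) + 1 ≤ 2 * N := by exact_mod_cast (by omega : s + 1 ≤ 2 * N)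
    have h5 : ρ * (N * κ ^ 2) ≤ N * κ ^ 2 := mul_le_of_le_one_left (by positivity) hρ
    have h6 := mul_le_mul_of_nonneg_right h4 (show 0 ≤ (3 * κ) ^ 2 by positivity)
    linarith
  have hb : ∀ b ∈ range B, |selfConv a (k + b) - κ ^ 2 * (k + selfConv r (k + b))| ≤
      κ ^ 2 * (23 * (ρ * N)) := by
    intro b hb
    have hb' := mem_range.1 hb
    have hbB : (b : ℝ) + 1 ≤ B := by exact_mod_cast hb'
    have h1 := abs_selfConv_sub_le ha0 (b := fun i => κ * (1 + r i)) (c := 3 * κ)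
      (A := 2 * (ρ * N * κ)) (A' := ρ * N * κ) (i₀ := i₀) (i₁ := i₁) (s := k + b)
      (fun i => by
        rw [hr, cellDev]
        split_ifs with h
        · have := ha0 i
          have h2 : κ * (1 + (cellSum κ z (cellBd κ i₁) i / κ - 1)) = a i := by
            field_simp; ring
          rw [h2]; exact this
        · rw [add_zero, mul_one]; exact hκ.le)
      (by omega) (by omega)
      (fun i h1 h2 => by
        rw [hr, cellDev, if_pos ⟨h1, h2⟩]; field_simp; ring) hA hAi
      (by
        calc _ = ∑ i ∈ range i₀, κ := by
              refine sum_congr rfl fun i hi => ?_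
              have := mem_range.1 hi
              rw [hr, cellDev, if_neg (by omega), add_zero, mul_one]
          _ = i₀ * κ := by simp
          _ ≤ _ := by gcongr)
    rw [selfConv_mul_one_add] at h1
    have h2 := abs_sum_cellDev_le hκ hM hi (k + b + 1)
    rw [← hr, mul_div_assoc, mul_div_cancel_right₀ _ hκ.ne'] at h2
    push_cast at h1
    have h1' := abs_le.1 h1
    have h2' := abs_le.1 h2
    have hκ2 : 0 < κ ^ 2 := by positivity
    have h3 : |((k : ℝ) + b + 1 + 2 * ∑ i ∈ range (k + b + 1), r i + selfConv r (k + b)) -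
        (k + selfConv r (k + b))| ≤ 5 * (ρ * N) := by
      rw [abs_le]
      have := Nat.cast_nonneg (α := ℝ) b
      have : 0 < ρ * N := by positivity
      constructor <;> linarith
    have h4 : |κ ^ 2 * ((k : ℝ) + b + 1 + 2 * ∑ i ∈ range (k + b + 1), r i + selfConv r (k + b)) -
        κ ^ 2 * (k + selfConv r (k + b))| ≤ κ ^ 2 * (5 * (ρ * N)) := by
      rw [← mul_sub, abs_mul, abs_of_pos hκ2]; gcongr
    have h5 := abs_sub_le (selfConv a (k + b))
      (κ ^ 2 * ((k : ℝ) + b + 1 + 2 * ∑ i ∈ range (k + b + 1), r i + selfConv r (k + b)))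
      (κ ^ 2 * (k + selfConv r (k + b)))
    refine h5.trans ((add_le_add h1 h4).trans (le_of_eq ?_))
    ring
  have hsum : |∑ b ∈ range B, selfConv a (k + b) -
      κ ^ 2 * (B * k + ∑ b ∈ range B, selfConv r (k + b))| ≤ B * (κ ^ 2 * (23 * (ρ * N))) := by
    have : κ ^ 2 * (B * k + ∑ b ∈ range B, selfConv r (k + b)) =
        ∑ b ∈ range B, κ ^ 2 * (k + selfConv r (k + b)) := by
      rw [← mul_sum, sum_add_distrib]; simp
    rw [this, ← sum_sub_distrib]
    refine (abs_sum_le_sum_abs _ _).trans ((sum_le_sum hb).trans ?_)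
    simp
  have hsum' := abs_le.1 hsum
  have he1 := hedge (k - 1) (by omega) (by omega)
  have he2 := hedge (k + B - 1) (by omega) (by omega)
  have hκ2 : 0 < κ ^ 2 := by positivity
  have hNB : (N : ℝ) * κ ^ 2 ≤ ρ * B * (N * κ ^ 2) := le_mul_of_one_le_left (by positivity) hBρ
  have hBB : (B : ℝ) * κ * (∑ b ∈ range B, a (k + b)) ≤ 3 * (ρ * N) * B * κ ^ 2 := by
    calc (B : ℝ) * κ * (∑ b ∈ range B, a (k + b)) ≤ (ρ * N) * κ * (B * (3 * κ)) :=
          mul_le_mul (by gcongr) hale (sum_nonneg fun _ _ => ha0 _) (by positivity)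
      _ = _ := by ring
  have hka : (k : ℝ) * κ * ∑ b ∈ range B, a (k + b) =
      κ ^ 2 * (B * k + k * ∑ b ∈ range B, r (k + b)) := by rw [hashift]; ring
  have hfin : |κ ^ 2 * (k * ∑ b ∈ range B, r (k + b) + ∑ b ∈ range B, selfConv r (k + b))| ≤
      κ ^ 2 * (100 * ρ * N * B) := by
    have hpos : 0 ≤ ρ * N * B * κ ^ 2 := by positivity
    rw [abs_le]
    constructor <;> linarith [hS₁le.1, hS₁le.2]
  rw [abs_mul, abs_of_pos hκ2] at hfin
  exact le_of_mul_le_mul_left hfin hκ2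

end Cells

section LogIntervals

open scoped ArithmeticFunction.vonMangoldt

lemma abs_sum_roughMass_sub_le {z : ℕ} (hz : 1 ≤ z) {u : ℝ} (hu : 0 ≤ u) :
    |∑ n ∈ Ico 1 ⌈Real.exp u⌉₊, roughMass z n - u| ≤ 19 + 2 * Real.log z := by
  classical
  have hz' : (1 : ℝ) ≤ z := by exact_mod_cast hz
  have hlz := Real.log_nonneg hz'
  rcases hu.eq_or_lt with rfl | hu
  · simp; linarith
  have h1 : 1 < Real.exp u := Real.one_lt_exp_iff.2 hu
  have hc : 1 < ⌈Real.exp u⌉₊ := Nat.lt_ceil.2 (by simpa using h1)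
  obtain ⟨N, hN⟩ : ∃ N, ⌈Real.exp u⌉₊ = N + 1 := ⟨_, (Nat.succ_pred (by omega)).symm⟩
  have hN1 : 1 ≤ N := by omega
  have hN1' : (1 : ℝ) ≤ N := by exact_mod_cast hN1
  have hIco : Ico 1 ⌈Real.exp u⌉₊ = Ioc 0 N := by
    ext; simp only [mem_Ico, mem_Ioc]; omega
  have hlow : (N : ℝ) < Real.exp u := Nat.lt_ceil.1 (by omega)
  have hupp : Real.exp u ≤ N + 1 := by
    have := Nat.le_ceil (Real.exp u); rw [hN] at this; exact_mod_cast this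
  have l1 : Real.log N ≤ u := (Real.log_le_iff_le_exp (by linarith)).2 hlow.le
  have l2 : u ≤ Real.log N + 1 := by
    rw [← Real.exp_le_exp, Real.exp_add, Real.exp_log (by linarith)]
    nlinarith [Real.add_one_le_exp 1]
  have h2 := abs_le.1 (abs_sum_vonMangoldt_div_sub_log_le hN1)
  have h3 := sum_not_rough_vonMangoldt_div_le hz N
  have h4 : 0 ≤ ∑ n ∈ Ioc 0 N with ¬ Rough z n, Λ n / n :=
    sum_nonneg fun n _ => div_nonneg ArithmeticFunction.vonMangoldt_nonneg (Nat.cast_nonneg n)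
  have h5 : ∑ n ∈ Ioc 0 N, roughMass z n = ∑ n ∈ Ioc 0 N with Rough z n, Λ n / n := by
    rw [sum_filter]; rfl
  have h6 := sum_filter_add_sum_filter_not (Ioc 0 N) (fun n => Rough z n) (fun n => Λ n / (n : ℝ))
  rw [hIco, h5, abs_le]
  constructor <;> linarith

lemma exists_sum_roughMass_le_of_no_prime : ∃ C : ℝ, 0 < C ∧ ∀ (z P Q : ℕ), 1 ≤ P →
    (∀ p ∈ Ico P Q, ¬ p.Prime) → ∑ n ∈ Ico P Q, roughMass z n ≤ C * √Q / P := by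
  obtain ⟨C, hC⟩ := Chebyshev.psi_sub_theta_le_mul_sqrt
  refine ⟨max C 1, by positivity, fun z P Q hP hpr => ?_⟩
  have hP' : (0 : ℝ) < P := by exact_mod_cast hP
  have h1 : ∑ n ∈ Ico P Q, Λ n ≤ max C 1 * √Q := by
    refine le_trans ?_ ((hC Q).trans (by gcongr; exact le_max_left _ _))
    rw [Chebyshev.psi_sub_theta_eq_sum_not_prime, Nat.floor_natCast]
    refine sum_le_sum_of_subset_of_nonneg (fun n hn => ?_)
      fun _ _ _ => ArithmeticFunction.vonMangoldt_nonneg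
    have := mem_Ico.1 hn
    exact mem_filter.2 ⟨mem_Ioc.2 (by omega), hpr n hn⟩
  refine le_trans ?_ (div_le_div_of_nonneg_right h1 hP'.le)
  rw [sum_div]
  refine sum_le_sum fun n hn => ?_
  have hn' : (P : ℝ) ≤ n := by exact_mod_cast (mem_Ico.1 hn).1
  have h0 : 0 ≤ Λ n := ArithmeticFunction.vonMangoldt_nonneg
  unfold roughMass
  split_ifs
  · gcongr
  · positivity

set_option maxHeartbeats 1000000 in
lemma abs_sum_selberg_div_sub_le {ε L a : ℝ} {z : ℕ} (hε : 0 < ε) (hε1 : ε ≤ 1 / 8)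
    (hεL : 1 ≤ ε * L)
    (hS : ∀ X H : ℕ, Real.exp (ε * L) ≤ X → X ≤ Real.exp (2 * L) →
      X * Real.exp (-a) ≤ H → H ≤ X →
      |roughSelberg z X H - 2 * H * Real.log X| ≤ ε * H * L)
    {u d : ℝ} (hu : 2 * (ε * L) ≤ u) (hu2 : u ≤ 2 * L) (hd : 2 * Real.exp (-a) ≤ d) (hdε : d ≤ ε)
    (hud : Real.exp (-u) ≤ ε * d) :
    |∑ n ∈ Ico ⌈Real.exp u⌉₊ ⌈Real.exp (u + d)⌉₊ with Rough z n, selbergFn n / n - 2 * d * u| ≤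
      11 * ε * d * L := by
  have hL : 0 < L := by
    by_contra hc
    have := mul_nonpos_of_nonneg_of_nonpos hε.le (not_lt.1 hc)
    linarith
  have hd0 : 0 < d := by linarith [Real.exp_pos (-a)]
  have hu0 : 0 < u := by linarith
  have heu : 1 + u ≤ Real.exp u := by linarith [Real.add_one_le_exp u]
  have h1 : 1 < Real.exp u := by linarith
  have hc : 1 < ⌈Real.exp u⌉₊ := Nat.lt_ceil.2 (by simpa using h1)
  obtain ⟨X, hX⟩ : ∃ X, ⌈Real.exp u⌉₊ = X + 1 := ⟨_, (Nat.succ_pred (by omega)).symm⟩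
  obtain ⟨H, hH⟩ : ∃ H, ⌈Real.exp (u + d)⌉₊ = X + 1 + H :=
    ⟨_, (Nat.add_sub_cancel' (hX ▸ Nat.ceil_mono (Real.exp_le_exp.2 (by linarith)))).symm⟩
  have hIco : Ico ⌈Real.exp u⌉₊ ⌈Real.exp (u + d)⌉₊ = Ioc X (X + H) := by
    ext; simp only [mem_Ico, mem_Ioc]; omega
  have x1 : (X : ℝ) < Real.exp u := Nat.lt_ceil.1 (by omega)
  have x2 : Real.exp u ≤ X + 1 := by
    have := Nat.le_ceil (Real.exp u); rw [hX] at this; exact_mod_cast this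
  have y1 : (X : ℝ) + H < Real.exp (u + d) := by
    have := Nat.lt_ceil.1 (show X + H < ⌈Real.exp (u + d)⌉₊ by omega)
    exact_mod_cast this
  have y2 : Real.exp (u + d) ≤ X + 1 + H := by
    have := Nat.le_ceil (Real.exp (u + d)); rw [hH] at this; exact_mod_cast this
  have heinv : Real.exp (-u) * Real.exp u = 1 := by rw [← Real.exp_add]; simp
  have hed1 : 1 + d ≤ Real.exp d := by linarith [Real.add_one_le_exp d]
  have hed2 : Real.exp d ≤ 1 + d + d ^ 2 := by
    have := Real.abs_exp_sub_one_sub_id_le (x := d) (by rw [abs_of_pos hd0]; linarith)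
    linarith [(abs_le.1 this).2]
  have hεd : 1 ≤ ε * d * Real.exp u := by
    calc 1 = Real.exp (-u) * Real.exp u := heinv.symm
      _ ≤ _ := by gcongr
  have hE := Real.exp_pos u
  have hHl : Real.exp u * (d * (1 - ε)) ≤ H := by
    rw [Real.exp_add] at y2; nlinarith
  have hHu : (H : ℝ) ≤ Real.exp u * (d * (1 + 2 * ε)) := by
    rw [Real.exp_add] at y1
    have : d ^ 2 ≤ ε * d := by nlinarith
    nlinarith
  have hH0 : (0 : ℝ) ≤ H := Nat.cast_nonneg H
  have hX0 : (1 : ℝ) ≤ X := by exact_mod_cast (by omega : 1 ≤ X)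
  have hexp2 : Real.exp (ε * L) ≤ X := by
    have h2 : Real.exp (2 * (ε * L)) ≤ Real.exp u := Real.exp_le_exp.2 hu
    have h3 : Real.exp (2 * (ε * L)) = Real.exp (ε * L) * Real.exp (ε * L) := by
      rw [← Real.exp_add]; ring_nf
    have h4 : 2 ≤ Real.exp (ε * L) := by linarith [Real.add_one_le_exp (ε * L)]
    nlinarith
  have hbb := hS X H hexp2 (x1.le.trans (Real.exp_le_exp.2 hu2))
    (by
      have : Real.exp (-a) ≤ d * (1 - ε) := by nlinarith
      calc (X : ℝ) * Real.exp (-a) ≤ Real.exp u * (d * (1 - ε)) := by gcongr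
        _ ≤ H := hHl)
    (by
      have : (H : ℝ) ≤ X := by nlinarith
      exact_mod_cast this)
  have l1 : Real.log X ≤ u := (Real.log_le_iff_le_exp (by linarith)).2 x1.le
  have l2 : u ≤ Real.log X + 1 := by
    rw [← Real.exp_le_exp, Real.exp_add, Real.exp_log (by linarith)]
    nlinarith [Real.add_one_le_exp 1]
  have hbb' := abs_le.1 hbb
  set S := ∑ n ∈ Ioc X (X + H) with Rough z n, selbergFn n / n with hSd
  have hT0 : 0 ≤ roughSelberg z X H := sum_nonneg fun n _ => selbergFn_nonneg n
  have hS1 : S ≤ Real.exp (-u) * roughSelberg z X H := by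
    rw [hSd, roughSelberg, mul_sum]
    refine sum_le_sum fun n hn => ?_
    have hn' := mem_Ioc.1 (mem_filter.1 hn).1
    have hn1 : Real.exp u ≤ n := x2.trans (by exact_mod_cast hn'.1)
    rw [Real.exp_neg, ← div_eq_inv_mul]
    exact div_le_div_of_nonneg_left (selbergFn_nonneg n) hE hn1
  have hS2 : Real.exp (-(u + d)) * roughSelberg z X H ≤ S := by
    rw [hSd, roughSelberg, mul_sum]
    refine sum_le_sum fun n hn => ?_
    have hn' := mem_Ioc.1 (mem_filter.1 hn).1
    have hn0 : (0 : ℝ) < n := by exact_mod_cast (by omega : 0 < n)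
    have hn1 : (n : ℝ) ≤ Real.exp (u + d) := le_trans (by exact_mod_cast hn'.2) y1.le
    rw [Real.exp_neg, ← div_eq_inv_mul]
    exact div_le_div_of_nonneg_left (selbergFn_nonneg n) hn0 hn1
  have hS0 : 0 ≤ S := (by positivity : 0 ≤ Real.exp (-(u + d)) * roughSelberg z X H).trans hS2
  have hHu' : Real.exp (-u) * H ≤ d * (1 + 2 * ε) := by
    calc Real.exp (-u) * H ≤ Real.exp (-u) * (Real.exp u * (d * (1 + 2 * ε))) := by gcongr
      _ = _ := by rw [← mul_assoc, heinv, one_mul]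
  have hHl' : d * (1 - 2 * ε) ≤ Real.exp (-(u + d)) * H := by
    calc d * (1 - 2 * ε) ≤ (1 - d) * (d * (1 - ε)) := by nlinarith [mul_nonneg hd0.le hε.le]
      _ ≤ Real.exp (-d) * (d * (1 - ε)) := by
          have := Real.add_one_le_exp (-d)
          have : 0 ≤ d * (1 - ε) := mul_nonneg hd0.le (by linarith)
          gcongr; linarith
      _ = Real.exp (-u) * Real.exp u * (Real.exp (-d) * (d * (1 - ε))) := by rw [heinv, one_mul]
      _ = Real.exp (-(u + d)) * (Real.exp u * (d * (1 - ε))) := by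
          rw [neg_add, Real.exp_add]; ring
      _ ≤ _ := by gcongr
  have hεdL : 0 < ε * d * L := by positivity
  rw [hIco, abs_le]
  constructor
  · by_cases hneg : 2 * u - 3 * (ε * L) ≤ 0
    · have := mul_le_mul_of_nonneg_left hneg hd0.le
      linarith
    · have hlow : H * (2 * u - 3 * (ε * L)) ≤ roughSelberg z X H := by nlinarith
      have : d * (1 - 2 * ε) * (2 * u - 3 * (ε * L)) ≤ S := by
        calc _ ≤ Real.exp (-(u + d)) * H * (2 * u - 3 * (ε * L)) := by
              have := not_le.1 hneg
              gcongr
          _ ≤ Real.exp (-(u + d)) * roughSelberg z X H := by rw [mul_assoc]; gcongr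
          _ ≤ S := hS2
      have h7 : d * ε * u ≤ d * ε * (2 * L) := by gcongr
      have h8 : 0 ≤ d * ε * (ε * L) := by positivity
      linarith
  · have hup : roughSelberg z X H ≤ H * (2 * u + ε * L) := by nlinarith
    have : S ≤ d * (1 + 2 * ε) * (2 * u + ε * L) := by
      calc S ≤ Real.exp (-u) * (H * (2 * u + ε * L)) := hS1.trans (by gcongr)
        _ = Real.exp (-u) * H * (2 * u + ε * L) := by ring
        _ ≤ _ := by gcongr
    have h7 : d * ε * u ≤ d * ε * (2 * L) := by gcongr
    have h8 : ε * (ε * d * L) ≤ 1 / 8 * (ε * d * L) := by gcongr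
    linarith

end LogIntervals

section Coarse

variable {κ : ℝ}

lemma cellBd_two_mul (κ : ℝ) (m : ℕ) : cellBd (2 * κ) m = cellBd κ (2 * m) := by
  unfold cellBd
  push_cast
  ring_nf

lemma cellIdx_two_mul (κ : ℝ) (n : ℕ) : cellIdx (2 * κ) n = cellIdx κ n / 2 := by
  unfold cellIdx
  rw [← Nat.floor_div_ofNat, div_div, mul_comm κ]

lemma cellSum_two_mul (κ : ℝ) (z T i : ℕ) :
    cellSum (2 * κ) z T i = cellSum κ z T (2 * i) + cellSum κ z T (2 * i + 1) := by
  unfold cellSum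
  rw [← sum_union]
  · refine sum_congr ?_ fun _ _ => rfl
    ext n
    simp only [mem_filter, mem_union, cellIdx_two_mul]
    constructor
    · rintro ⟨h1, h2⟩
      have : cellIdx κ n = 2 * i ∨ cellIdx κ n = 2 * i + 1 := by omega
      tauto
    · rintro (⟨h1, h2⟩ | ⟨h1, h2⟩) <;> exact ⟨h1, by omega⟩
  · rw [disjoint_left]
    intro n h1 h2
    simp only [mem_filter] at h1 h2
    omega

lemma cellDev_two_mul (κ : ℝ) (z i₀ i₁ i : ℕ) :
    cellDev (2 * κ) z i₀ i₁ i =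
      (cellDev κ z (2 * i₀) (2 * i₁) (2 * i) + cellDev κ z (2 * i₀) (2 * i₁) (2 * i + 1)) / 2 := by
  unfold cellDev
  by_cases h : i₀ ≤ i ∧ i < i₁
  · rw [if_pos h, if_pos (by omega), if_pos (by omega), cellSum_two_mul, cellBd_two_mul]
    have e (x y : ℝ) : (x + y) / (2 * κ) = (x / κ + y / κ) / 2 := by
      rw [← add_div, div_div, mul_comm 2 κ]
    rw [e]; ring
  · rw [if_neg h, if_neg (by omega), if_neg (by omega)]; simp

end Coarse

section Hoheisel

open scoped ArithmeticFunction.vonMangoldt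

lemma cellSum_mul_le_sum_selberg {κ : ℝ} (hκ : 0 < κ) (z : ℕ) {i T : ℕ}
    (hT : cellBd κ (i + 1) ≤ T) :
    cellSum κ z T i * (i * κ) ≤
      ∑ n ∈ Ico (cellBd κ i) (cellBd κ (i + 1)) with Rough z n, selbergFn n / n := by
  have h := sum_shift_cellSum hκ (k := i) (B := 1) (z := z) hT
  rw [sum_range_one, add_zero] at h
  rw [h, sum_mul, sum_filter]
  refine sum_le_sum fun n hn => ?_
  have hn' := (mem_Ico.1 hn).1
  have hn1 : 1 ≤ n := (one_le_cellBd κ i).trans hn'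
  have hn0 : (0 : ℝ) < n := by exact_mod_cast hn1
  have hlog : i * κ ≤ Real.log n := (Real.le_log_iff_exp_le hn0).2 (Nat.ceil_le.1 hn')
  have h0 : 0 ≤ Λ n := ArithmeticFunction.vonMangoldt_nonneg
  unfold roughMass
  split_ifs
  · rw [div_mul_eq_mul_div]
    gcongr
    have : 0 ≤ (Λ * Λ) n := by
      rw [ArithmeticFunction.mul_apply]
      exact sum_nonneg fun _ _ => mul_nonneg ArithmeticFunction.vonMangoldt_nonneg
        ArithmeticFunction.vonMangoldt_nonneg
    have := mul_le_mul_of_nonneg_left hlog h0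
    unfold selbergFn
    linarith
  · simp

lemma cellDev_bounds {ε₀ ρ ε L κ : ℝ} {N B i₀ i₁ z : ℕ} (hz : 1 ≤ z) (hκ : 0 < κ) (hL : 0 < L)
    (hN : N * κ = L) (hρ : 0 < ρ) (hρε : 100 * ρ ≤ ε₀) (hε₀ : ε₀ ≤ 1)
    (hερ : 22 * ε ≤ ρ * ε₀) (hlogz : 19 + 2 * Real.log z ≤ ρ * L)
    (hS : ∀ u d, ρ * L / 2 ≤ u → u ≤ 2 * L → κ ≤ d → d ≤ B * κ →
      |∑ n ∈ Ico ⌈Real.exp u⌉₊ ⌈Real.exp (u + d)⌉₊ with Rough z n, selbergFn n / n - 2 * d * u| ≤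
        11 * ε * d * L)
    (hi₀ : i₀ ≤ ρ * N) (hi₀' : ρ * L / 2 ≤ i₀ * κ) (hB : B ≤ ρ * N) (hBρ : 1 ≤ ρ * B)
    (hi₁ : i₁ ≤ 2 * N) (hi : i₀ ≤ N) (hi' : N + B ≤ i₁)
    (hmass : ∑ n ∈ Ico (cellBd κ N) (cellBd κ (N + B)), roughMass z n ≤ ε₀ * B * κ) :
    (∀ i, |cellDev κ z i₀ i₁ i| ≤ 1 + ε₀) ∧
    (∀ m, |∑ i ∈ range m, cellDev κ z i₀ i₁ i| ≤ ε₀ * N) ∧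
    (∀ k, k + B ≤ i₁ → |k * ∑ b ∈ range B, cellDev κ z i₀ i₁ (k + b) +
      ∑ b ∈ range B, selfConv (cellDev κ z i₀ i₁) (k + b)| ≤ ε₀ * N * B) ∧
    ∑ b ∈ range B, cellDev κ z i₀ i₁ (N + b) ≤ (-1 + ε₀) * B := by
  have hBpos : 0 < B := by
    rcases Nat.eq_zero_or_pos B with rfl | h
    · norm_num at hBρ
    · exact h
  have hB1 : (1 : ℝ) ≤ B := by exact_mod_cast hBpos
  have hi₁' : (i₁ : ℝ) ≤ 2 * N := by exact_mod_cast hi₁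
  have hi₁L : i₁ * κ ≤ 2 * L := by rw [← hN]; nlinarith
  have hM : ∀ m ≤ i₁, |∑ n ∈ Ico 1 (cellBd κ m), roughMass z n - m * κ| ≤ ρ * N * κ := by
    intro m _
    rw [mul_assoc, hN]
    exact (abs_sum_roughMass_sub_le hz (by positivity)).trans hlogz
  have hcell : ∀ i, i₀ ≤ i → i < i₁ → cellSum κ z (cellBd κ i₁) i ≤ (1 + (1 + ε₀)) * κ := by
    intro i h1 h2
    have h1' : (i₀ : ℝ) ≤ i := by exact_mod_cast h1
    have h2' : (i : ℝ) ≤ i₁ := by exact_mod_cast h2.le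
    have hu : ρ * L / 2 ≤ i * κ := hi₀'.trans (by gcongr)
    have h3 := cellSum_mul_le_sum_selberg hκ z (i := i) (T := cellBd κ i₁) (cellBd_mono hκ h2)
    have h4 := hS (i * κ) κ hu (by nlinarith) le_rfl (by nlinarith)
    have h5 : i * κ + κ = ((i + 1 : ℕ) : ℝ) * κ := by push_cast; ring
    rw [h5] at h4
    have h6 : cellSum κ z (cellBd κ i₁) i * (i * κ) ≤ 2 * κ * (i * κ) + 11 * ε * κ * L := by
      refine h3.trans ?_
      have := (abs_le.1 h4).2
      simp only [cellBd]
      linarith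
    have hpos : 0 < i * κ := lt_of_lt_of_le (by positivity) hu
    have h7 : 11 * ε * κ * L ≤ ε₀ * κ * (i * κ) := by
      calc 11 * ε * κ * L = (22 * ε) * (κ * L / 2) := by ring
        _ ≤ (ρ * ε₀) * (κ * L / 2) := by gcongr
        _ = ε₀ * κ * (ρ * L / 2) := by ring
        _ ≤ _ := by
          have : 0 < ε₀ := by linarith
          gcongr
    refine le_of_mul_le_mul_right ?_ hpos
    linarith
  refine ⟨abs_cellDev_le hκ (by linarith) hcell, fun m => ?_, fun k hk => ?_, ?_⟩
  · refine (abs_sum_cellDev_le hκ hM (by omega) m).trans ?_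
    rw [div_le_iff₀ hκ]
    have : 0 ≤ N * κ := by positivity
    nlinarith
  · have hk' : (k : ℝ) + B ≤ i₁ := by exact_mod_cast hk
    have := abs_cellDev_selberg_le hκ (z := z) (N := N) (B := B) (i₀ := i₀) (i₁ := i₁) (k := k)
      hρ (by linarith) hM (fun hik => by
        have hik' : (i₀ : ℝ) ≤ k := by exact_mod_cast hik
        have h4 := hS (k * κ) (B * κ) (hi₀'.trans (by gcongr)) (by nlinarith) (by nlinarith) le_rfl
        have h5 : k * κ + B * κ = ((k + B : ℕ) : ℝ) * κ := by push_cast; ring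
        rw [h5] at h4
        refine h4.trans ?_
        rw [hN]
        have : 11 * ε ≤ ρ := by nlinarith
        calc 11 * ε * (B * κ) * L ≤ ρ * (B * κ) * L := by gcongr
          _ = _ := by ring)
      (fun i h1 h2 => (hcell i h1 h2).trans (by nlinarith)) hi₀ hB hBρ
      (by exact_mod_cast hi₁) (by omega) hk
    refine this.trans ?_
    have : (0 : ℝ) ≤ N * B := by positivity
    nlinarith
  · have h1 : ∀ b ∈ range B, cellDev κ z i₀ i₁ (N + b) =
        cellSum κ z (cellBd κ i₁) (N + b) / κ - 1 := by
      intro b hb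
      have := mem_range.1 hb
      unfold cellDev
      rw [if_pos (by omega)]
    rw [sum_congr rfl h1, sum_sub_distrib, ← sum_div,
      sum_shift_cellSum hκ (cellBd_mono hκ hi')]
    have : (∑ n ∈ Ico (cellBd κ N) (cellBd κ (N + B)), roughMass z n) / κ ≤ ε₀ * B := by
      rw [div_le_iff₀ hκ]; exact hmass
    simp only [sum_const, card_range, nsmul_eq_mul, mul_one]
    linarith

lemma exists_prime_exp_le {C L a : ℝ} {K z : ℕ} (hz : 1 ≤ z) (hC : 0 < C)
    (hprime : ∀ (z P Q : ℕ), 1 ≤ P → (∀ p ∈ Ico P Q, ¬ p.Prime) →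
      ∑ n ∈ Ico P Q, roughMass z n ≤ C * √Q / P)
    (hεL : 10 ^ 16 ≤ L) (hK : 10 ^ 17 ≤ K)
    (hS : ∀ X H : ℕ, Real.exp (1 / 10 ^ 16 * L) ≤ X → X ≤ Real.exp (2 * L) →
      X * Real.exp (-a) ≤ H → H ≤ X →
      |roughSelberg z X H - 2 * H * Real.log X| ≤ 1 / 10 ^ 16 * H * L)
    (hlogz : 19 + 2 * Real.log z ≤ 1 / 10 ^ 8 * L)
    (ha : 2 * Real.exp (-a) ≤ L / (2 * K)) (hκ : 2 * 10 ^ 8 * (L / (2 * K)) ≤ 1 / 10 ^ 16)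
    (hexp : Real.exp (-(1 / 10 ^ 8 * L / 2)) ≤ 1 / 10 ^ 16 * (L / (2 * K)))
    (hsq : C * Real.exp (1 - L / 2) ≤ 1 / 10 ^ 6 * (L / (2 * K))) :
    ∃ p : ℕ, p.Prime ∧ Real.exp L ≤ p ∧ p < Real.exp (L + 2 * 10 ^ 8 * (L / (2 * K))) := by
  by_contra hcon
  have hL : 0 < L := by linarith
  have hK' : (10 : ℝ) ^ 17 ≤ K := by exact_mod_cast hK
  have hK0 : (0 : ℝ) < K := by linarith
  set κ := L / (2 * K) with hκd
  have hκ0 : 0 < κ := by positivity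
  have hKκ : (K : ℝ) * (2 * κ) = L := by rw [hκd]; field_simp
  have hKκ' : ((2 * K : ℕ) : ℝ) * κ = L := by push_cast; rw [← hKκ]; ring
  have hnp : ∀ p ∈ Ico ⌈Real.exp L⌉₊ ⌈Real.exp (L + 2 * 10 ^ 8 * κ)⌉₊, ¬ p.Prime := by
    intro p hp hpp
    rw [mem_Ico] at hp
    exact hcon ⟨p, hpp, Nat.ceil_le.1 hp.1, Nat.lt_ceil.1 hp.2⟩
  have hmass : ∀ Q, Q ≤ ⌈Real.exp (L + 2 * 10 ^ 8 * κ)⌉₊ →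
      ∑ n ∈ Ico ⌈Real.exp L⌉₊ Q, roughMass z n ≤ 1 / 10 ^ 6 * κ := by
    intro Q hQ
    have hE := Real.exp_pos L
    have h1 := hprime z ⌈Real.exp L⌉₊ Q (Nat.ceil_pos.2 hE)
      (fun p hp => hnp p (by rw [mem_Ico] at hp ⊢; omega))
    refine (h1.trans ?_).trans hsq
    have hQ' : (Q : ℝ) ≤ Real.exp (L + 2) := by
      have h2 : (Q : ℝ) ≤ ⌈Real.exp (L + 2 * 10 ^ 8 * κ)⌉₊ := by exact_mod_cast hQ
      have h3 := Nat.ceil_lt_add_one (Real.exp_pos (L + 2 * 10 ^ 8 * κ)).le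
      have h4 : Real.exp (L + 2 * 10 ^ 8 * κ) ≤ Real.exp (L + 1) :=
        Real.exp_le_exp.2 (by linarith [show (1 : ℝ) / 10 ^ 16 ≤ 1 by norm_num])
      have h5 : Real.exp (L + 2) = Real.exp (L + 1) * Real.exp 1 := by
        rw [← Real.exp_add]; ring_nf
      have h6 : 1 ≤ Real.exp (L + 1) := Real.one_le_exp (by linarith)
      nlinarith [Real.add_one_le_exp 1]
    have hs : √Q ≤ Real.exp (L / 2 + 1) := by
      rw [Real.sqrt_le_left (Real.exp_pos _).le, ← Real.exp_nat_mul]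
      refine hQ'.trans (Real.exp_le_exp.2 (by push_cast; linarith))
    calc C * √Q / ⌈Real.exp L⌉₊ ≤ C * Real.exp (L / 2 + 1) / Real.exp L := by
          gcongr; exact Nat.le_ceil _
      _ = C * Real.exp (1 - L / 2) := by
          rw [mul_div_assoc, ← Real.exp_sub]; ring_nf
  have hSI : ∀ u d, 1 / 10 ^ 8 * L / 2 ≤ u → u ≤ 2 * L → κ ≤ d → d ≤ 2 * 10 ^ 8 * κ →
      |∑ n ∈ Ico ⌈Real.exp u⌉₊ ⌈Real.exp (u + d)⌉₊ with Rough z n, selbergFn n / n - 2 * d * u| ≤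
        11 * (1 / 10 ^ 16) * d * L := by
    intro u d h1 h2 h3 h4
    refine abs_sum_selberg_div_sub_le (by norm_num) (by norm_num) (by linarith) hS
      (le_trans (by linarith) h1) h2 (ha.trans h3) (h4.trans hκ) ?_
    calc Real.exp (-u) ≤ Real.exp (-(1 / 10 ^ 8 * L / 2)) := Real.exp_le_exp.2 (by linarith)
      _ ≤ 1 / 10 ^ 16 * κ := hexp
      _ ≤ _ := by gcongr
  set j := ⌊1 / 10 ^ 8 * (K : ℝ)⌋₊ with hj
  have hj1 : (j : ℝ) ≤ 1 / 10 ^ 8 * K := Nat.floor_le (by positivity)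
  have hj2 : 1 / 10 ^ 8 * (K : ℝ) < j + 1 := Nat.lt_floor_add_one _
  have hjK : j ≤ K := by
    have : (j : ℝ) ≤ K := by linarith
    exact_mod_cast this
  have hjκ : 1 / 10 ^ 8 * L / 2 ≤ j * (2 * κ) := by
    rw [← hKκ]
    nlinarith
  obtain ⟨B, hB⟩ : ∃ B : ℕ, B = 10 ^ 8 := ⟨_, rfl⟩
  have hBr : (B : ℝ) = 10 ^ 8 := by rw [hB]; norm_num
  obtain ⟨f1, -, f3, f4⟩ := cellDev_bounds (ε₀ := 1 / 10 ^ 6) (ρ := 1 / 10 ^ 8) (ε := 1 / 10 ^ 16)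
    (L := L) (κ := κ) (N := 2 * K) (B := B) (i₀ := 2 * j) (i₁ := 2 * (K + B)) (z := z) hz hκ0 hL
    hKκ' (by norm_num) (by norm_num) (by norm_num) (by norm_num) hlogz
    (fun u d h1 h2 h3 h4 => hSI u d h1 h2 h3 (by rw [hBr] at h4; linarith))
    (by push_cast; linarith) (by push_cast; linarith) (by push_cast; rw [hBr]; linarith)
    (by rw [hBr]; norm_num) (by omega) (by omega) (by omega)
    (by
      have : cellBd κ (2 * K) = ⌈Real.exp L⌉₊ := by unfold cellBd; rw [hKκ']
      rw [this]
      refine (hmass _ (Nat.ceil_mono (Real.exp_le_exp.2 ?_))).trans ?_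
      · push_cast at hKκ' ⊢; rw [hBr]; nlinarith
      · rw [hBr]; nlinarith)
  obtain ⟨g1, g2, g3, g4⟩ := cellDev_bounds (ε₀ := 1 / 10 ^ 6) (ρ := 1 / 10 ^ 8)
    (ε := 1 / 10 ^ 16) (L := L) (κ := 2 * κ) (N := K) (B := B) (i₀ := j) (i₁ := K + B)
    (z := z) hz (by positivity) hL
    hKκ (by norm_num) (by norm_num) (by norm_num) (by norm_num) hlogz
    (fun u d h1 h2 h3 h4 => hSI u d h1 h2 (by linarith) (by rw [hBr] at h4; linarith))
    hj1 hjκ (by rw [hBr]; linarith)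
    (by rw [hBr]; norm_num) (by omega) (by omega) (by omega)
    (by
      have : cellBd (2 * κ) K = ⌈Real.exp L⌉₊ := by unfold cellBd; rw [hKκ]
      rw [this]
      refine (hmass _ (Nat.ceil_mono (Real.exp_le_exp.2 ?_))).trans ?_
      · push_cast; rw [hBr]; nlinarith
      · rw [hBr]; nlinarith)
  have hfun : cellDev (2 * κ) z j (K + B) = fun i => (cellDev κ z (2 * j) (2 * (K + B)) (2 * i) +
      cellDev κ z (2 * j) (2 * (K + B)) (2 * i + 1)) / 2 := by
    funext i; exact cellDev_two_mul κ z j (K + B) i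
  rw [hfun] at g1 g2 g3 g4
  refine selberg_conv_contradiction (r := cellDev κ z (2 * j) (2 * (K + B))) (K := K) (B := B)
    (ε := 1 / 10 ^ 6) (by norm_num) (by norm_num) (by omega) (by rw [hBr]; linarith) f1
    (fun m _ => g2 m) (g3 K le_rfl) (fun k hk => ?_) g4 ?_
  · have := f3 k (by omega)
    push_cast at this
    exact this
  · exact f4

end Hoheisel

section Hoheisel

open Filter

lemma eventually_exp_neg_mul_le {c ε : ℝ} (hc : 0 < c) (hε : 0 < ε) :
    ∀ᶠ L : ℝ in atTop, Real.exp (-(c * L)) ≤ ε := by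
  have h : Tendsto (fun L : ℝ => Real.exp (-(c * L))) atTop (nhds 0) :=
    Real.tendsto_exp_neg_atTop_nhds_zero.comp (tendsto_id.const_mul_atTop hc)
  exact (h.eventually_lt_const hε).mono fun _ h => h.le

/-- Hoheisel's theorem: primes in intervals `[x, x + x ^ θ]` for some `θ < 1`, with `x = exp L`. -/
theorem exists_prime_short_interval : ∃ c : ℝ, 0 < c ∧ ∀ᶠ L : ℝ in atTop,
    ∃ p : ℕ, p.Prime ∧ Real.exp L ≤ p ∧ p ≤ Real.exp (L + Real.exp (-(c * L))) := by
  obtain ⟨t, ht0, ht1, -, ht2, ht3⟩ :=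
    exists_abs_roughSelberg_sub_le (ε := 1 / 10 ^ 16) (by norm_num) (by norm_num)
  obtain ⟨C, hC, hprime⟩ := exists_sum_roughMass_le_of_no_prime
  have hs0 : 0 < t ^ 4 / 2 := by positivity
  set s := t ^ 4 / 2 with hs
  have hs1 : s ≤ 1 / 10 ^ 16 := by linarith
  have ht5 : t ^ 5 ≤ 1 / 10 ^ 16 := by
    have : t ^ 5 = t * t ^ 4 := by ring
    have : t * t ^ 4 ≤ 1 * t ^ 4 := by gcongr; linarith
    linarith
  refine ⟨s / 2, by positivity, ?_⟩
  filter_upwards [ht3, eventually_ge_atTop (10 ^ 17), eventually_ge_atTop (1 / t ^ 5),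
    eventually_exp_neg_mul_le (half_pos hs0) (by norm_num : (0 : ℝ) < 1 / 10 ^ 8),
    eventually_exp_neg_mul_le hs0 (by norm_num : (0 : ℝ) < 1 / 10 ^ 24),
    eventually_exp_neg_mul_le (by norm_num : (0 : ℝ) < 1 / 10 ^ 9)
      (by norm_num : (0 : ℝ) < 1 / 10 ^ 17),
    eventually_exp_neg_mul_le (by norm_num : (0 : ℝ) < 1 / 4)
      (by positivity : (0 : ℝ) < 1 / (4 * 10 ^ 6) / (C * Real.exp 1))]
    with L hS hL hL5 e1 e2 e3 e4
  have hL0 : 0 < L := lt_of_lt_of_le (by norm_num) hL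
  have hz := log_ceil_exp_bounds (x := t ^ 5 * L)
    (by rwa [div_le_iff₀ (by positivity), mul_comm] at hL5)
  have hE1 : 1 ≤ Real.exp (s * L) := Real.one_le_exp (by positivity)
  set K := ⌈L * Real.exp (s * L)⌉₊ with hK
  have hK1 : L * Real.exp (s * L) ≤ K := Nat.le_ceil _
  have hK2 : (K : ℝ) ≤ 2 * (L * Real.exp (s * L)) := by
    have := Nat.ceil_lt_add_one (show 0 ≤ L * Real.exp (s * L) by positivity)
    nlinarith
  have hKL : L ≤ K := le_trans (le_mul_of_one_le_right hL0.le hE1) hK1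
  have hinv : Real.exp (-(s * L)) * Real.exp (s * L) = 1 := by rw [← Real.exp_add]; simp
  have hK0 : (0 : ℝ) < K := hL0.trans_le hKL
  have hE0 := Real.exp_pos (-(s * L))
  have κ1 : Real.exp (-(s * L)) / 4 ≤ L / (2 * K) := by
    rw [div_le_div_iff₀ (by norm_num) (by positivity)]
    calc Real.exp (-(s * L)) * (2 * K)
        ≤ Real.exp (-(s * L)) * (2 * (2 * (L * Real.exp (s * L)))) := by gcongr
      _ = L * 4 * (Real.exp (-(s * L)) * Real.exp (s * L)) := by ring
      _ = L * 4 := by rw [hinv, mul_one]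
  have κ2 : L / (2 * K) ≤ Real.exp (-(s * L)) / 2 := by
    rw [div_le_div_iff₀ (by positivity) (by norm_num)]
    calc L * 2 = Real.exp (-(s * L)) * (2 * (L * Real.exp (s * L))) := by linear_combination -2 * L * hinv
      _ ≤ _ := by gcongr
  have hsplit (x y : ℝ) : Real.exp (-((x + y) * L)) = Real.exp (-(x * L)) * Real.exp (-(y * L)) := by
    rw [← Real.exp_add]; ring_nf
  obtain ⟨p, hp, h1, h2⟩ := exists_prime_exp_le (C := C) (L := L) (a := t ^ 4 * L) (K := K)
    (z := ⌈Real.exp (t ^ 5 * L)⌉₊) (by linarith [hz.2.2.2]) hC hprime (le_trans (by norm_num) hL)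
    (by exact_mod_cast hL.trans hKL) hS
    (by
      have : t ^ 5 * L ≤ 1 / 10 ^ 16 * L := by gcongr
      linarith [hz.2.1])
    (by
      refine le_trans ?_ κ1
      have : t ^ 4 * L = (s + s) * L := by rw [hs]; ring
      rw [this, hsplit]
      nlinarith)
    (by linarith)
    (by
      refine le_trans ?_ (mul_le_mul_of_nonneg_left κ1 (by norm_num))
      have h1 : Real.exp (-(1 / 10 ^ 8 * L / 2)) ≤ Real.exp (-((1 / 10 ^ 9 + s) * L)) := by
        refine Real.exp_le_exp.2 ?_
        have : s * L ≤ 1 / 10 ^ 16 * L := by gcongr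
        linarith
      refine h1.trans ?_
      rw [hsplit]
      nlinarith)
    (by
      refine le_trans ?_ (mul_le_mul_of_nonneg_left κ1 (by norm_num))
      have h1 : Real.exp (1 - L / 2) ≤ Real.exp 1 * Real.exp (-((1 / 4 + s) * L)) := by
        rw [← Real.exp_add]
        refine Real.exp_le_exp.2 ?_
        have : s * L ≤ 1 / 10 ^ 16 * L := by gcongr
        linarith
      rw [hsplit] at h1
      rw [le_div_iff₀ (by positivity)] at e4
      calc C * Real.exp (1 - L / 2)
          ≤ C * (Real.exp 1 * (Real.exp (-(1 / 4 * L)) * Real.exp (-(s * L)))) := by gcongr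
        _ = (Real.exp (-(1 / 4 * L)) * (C * Real.exp 1)) * Real.exp (-(s * L)) := by ring
        _ ≤ 1 / (4 * 10 ^ 6) * Real.exp (-(s * L)) := by gcongr
        _ = _ := by ring)
  refine ⟨p, hp, h1, h2.le.trans (Real.exp_le_exp.2 ?_)⟩
  have : Real.exp (-(s * L)) = Real.exp (-(s / 2 * L)) * Real.exp (-(s / 2 * L)) := by
    rw [← hsplit, add_halves]
  have := Real.exp_pos (-(s / 2 * L))
  nlinarith

end Hoheisel

section Cube

open scoped BigOperators

open Classical in
/-- The `0`-`1` truth value of a proposition. -/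
noncomputable def ind (p : Prop) : ℝ := if p then 1 else 0

lemma ind_nonneg (p : Prop) : 0 ≤ ind p := by unfold ind; split_ifs <;> norm_num

lemma ind_le_one (p : Prop) : ind p ≤ 1 := by unfold ind; split_ifs <;> norm_num

lemma ind_mono {p q : Prop} (h : p → q) : ind p ≤ ind q := by
  unfold ind; split_ifs with h1 h2 <;> first | exact absurd (h h1) h2 | norm_num

lemma ind_and (p q : Prop) : ind (p ∧ q) = ind p * ind q := by
  unfold ind; split_ifs <;> simp_all

lemma ind_not (p : Prop) : ind (¬ p) = 1 - ind p := by
  unfold ind; split_ifs <;> simp_all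

lemma ind_of_true {p : Prop} (h : p) : ind p = 1 := if_pos h

lemma ind_of_false {p : Prop} (h : ¬ p) : ind p = 0 := if_neg h

variable {α : Type*} [Fintype α]

lemma uPr_eq_expect (E : α → Prop) : uPr E = 𝔼 x, ind (E x) := by
  classical
  unfold uPr ind
  rw [Fintype.expect_eq_sum_div_card, Finset.sum_boole, Nat.card_eq_fintype_card,
    Fintype.card_subtype]

lemma uPr_nonneg (E : α → Prop) : 0 ≤ uPr E := by unfold uPr; positivity

lemma uPr_mono {E F : α → Prop} (h : ∀ x, E x → F x) : uPr E ≤ uPr F := by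
  simp only [uPr_eq_expect]
  exact expect_le_expect fun x _ => ind_mono (h x)

lemma uPr_congr {E F : α → Prop} (h : ∀ x, E x ↔ F x) : uPr E = uPr F :=
  le_antisymm (uPr_mono fun x => (h x).1) (uPr_mono fun x => (h x).2)

lemma uPr_not [Nonempty α] (E : α → Prop) : uPr (fun x => ¬ E x) = 1 - uPr E := by
  simp only [uPr_eq_expect, ind_not, expect_sub_distrib, Fintype.expect_const]

lemma uPr_and_not (E F : α → Prop) :
    uPr (fun x => E x ∧ ¬ F x) = uPr E - uPr (fun x => E x ∧ F x) := by
  simp only [uPr_eq_expect, ind_and, ind_not, mul_sub, mul_one, expect_sub_distrib]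

lemma uPr_true [Nonempty α] {E : α → Prop} (h : ∀ x, E x) : uPr E = 1 := by
  simp only [uPr_eq_expect, ind_of_true (h _), Fintype.expect_const]

lemma uPr_exists_le {β : Type*} (s : Finset β) (E : β → α → Prop) :
    uPr (fun x => ∃ b ∈ s, E b x) ≤ ∑ b ∈ s, uPr (E b) := by
  simp only [uPr_eq_expect]
  rw [← expect_sum_comm]
  refine expect_le_expect fun x _ => ?_
  by_cases h : ∃ b ∈ s, E b x
  · rw [ind_of_true h]
    obtain ⟨b, hb, hx⟩ := h
    rw [← ind_of_true hx]
    exact single_le_sum (f := fun b => ind (E b x)) (fun _ _ => ind_nonneg _) hb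
  · rw [ind_of_false h]
    exact sum_nonneg fun _ _ => ind_nonneg _

variable {ι : Type*}

lemma antitone_ind {E : (ι → Bool) → Prop} (hE : Antitone E) : Antitone fun x => ind (E x) :=
  fun _ _ h => ind_mono (hE h)

lemma monotone_ind {E : (ι → Bool) → Prop} (hE : Monotone E) : Monotone fun x => ind (E x) :=
  fun _ _ h => ind_mono (hE h)

variable [Fintype ι] [DecidableEq ι]

lemma expect_mul_expect_le_of_monotone {f g : (ι → Bool) → ℝ} (hf0 : 0 ≤ f) (hg0 : 0 ≤ g)
    (hf : Monotone f) (hg : Monotone g) :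
    (𝔼 x, f x) * (𝔼 x, g x) ≤ 𝔼 x, f x * g x := by
  have h := fkg (μ := fun _ => (1 : ℝ)) f g (fun _ => zero_le_one) hf0 hg0 hf hg
    (fun _ _ => le_rfl)
  simp only [one_mul, sum_const, card_univ, nsmul_eq_mul, mul_one] at h
  have hc : (0 : ℝ) < Fintype.card (ι → Bool) := by exact_mod_cast Fintype.card_pos
  simp only [Fintype.expect_eq_sum_div_card]
  rw [div_mul_div_comm, div_le_div_iff₀ (by positivity) hc]
  nlinarith

lemma expect_mul_expect_le_of_antitone {f g : (ι → Bool) → ℝ} (hf0 : 0 ≤ f) (hg0 : 0 ≤ g)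
    (hf : Antitone f) (hg : Antitone g) :
    (𝔼 x, f x) * (𝔼 x, g x) ≤ 𝔼 x, f x * g x := by
  have e (h : (ι → Bool) → ℝ) : 𝔼 x, h x = 𝔼 x : ι → Bool, h (fun i => !x i) :=
    (Fintype.expect_equiv (Equiv.piCongrRight fun _ : ι => Equiv.boolNot) _ _ fun _ => rfl).symm
  rw [e f, e g, e fun x => f x * g x]
  have hn : Antitone fun (x : ι → Bool) i => !x i := by
    intro x y hxy i
    have h := hxy i
    show (!y i) ≤ !x i
    revert h
    cases x i <;> cases y i <;> simp
  exact expect_mul_expect_le_of_monotone (fun x => hf0 fun i => !x i)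
    (fun x => hg0 fun i => !x i) (hf.comp hn) (hg.comp hn)

lemma uPr_mul_le_of_antitone {E F : (ι → Bool) → Prop} (hE : Antitone E) (hF : Antitone F) :
    uPr E * uPr F ≤ uPr (fun x => E x ∧ F x) := by
  simp only [uPr_eq_expect, ind_and]
  exact expect_mul_expect_le_of_antitone (fun _ => ind_nonneg _) (fun _ => ind_nonneg _)
    (antitone_ind hE) (antitone_ind hF)

lemma uPr_mul_le_of_monotone {E F : (ι → Bool) → Prop} (hE : Monotone E) (hF : Monotone F) :
    uPr E * uPr F ≤ uPr (fun x => E x ∧ F x) := by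
  simp only [uPr_eq_expect, ind_and]
  exact expect_mul_expect_le_of_monotone (fun _ => ind_nonneg _) (fun _ => ind_nonneg _)
    (monotone_ind hE) (monotone_ind hF)

lemma uPr_and_le_mul {E F : (ι → Bool) → Prop} (hE : Antitone E) (hF : Monotone F) :
    uPr (fun x => E x ∧ F x) ≤ uPr E * uPr F := by
  have h := uPr_mul_le_of_antitone hE (F := fun x => ¬ F x) fun x y hxy h hx => h (hF hxy hx)
  rw [uPr_not, uPr_and_not] at h
  linarith

/-- The assignment `x` with the coordinates in `S` set to `true`. -/
def fillTrue (S : Finset ι) (x : ι → Bool) : ι → Bool := fun i => if i ∈ S then true else x i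

lemma expect_ind_single_mul (a : ι) (g : (ι → Bool) → ℝ) :
    𝔼 x, ind (x a = true) * g x = 1 / 2 * 𝔼 x, g (fillTrue {a} x) := by
  have e : 𝔼 x : ι → Bool, ind (x a = true) * g x =
      𝔼 x : ι → Bool, ind (x a = false) * g (fillTrue {a} x) := by
    have hinv : Function.Involutive fun x : ι → Bool => Function.update x a (!x a) := by
      intro x; ext i; simp
    refine Fintype.expect_equiv hinv.toPerm _ _ fun x => ?_
    show _ = ind (Function.update x a (!x a) a = false) * _
    rw [Function.update_self]
    show _ = _ * g (fillTrue {a} (Function.update x a (!x a)))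
    by_cases h : x a = true
    · congr 2
      · simp
      · ext i
        by_cases hi : i = a
        · subst hi; simp [fillTrue, h]
        · simp [fillTrue, hi]
    · rw [ind_of_false h, ind_of_false (by simpa using h)]; simp
  have e2 : 𝔼 x : ι → Bool, ind (x a = true) * g x =
      𝔼 x : ι → Bool, ind (x a = true) * g (fillTrue {a} x) := by
    refine expect_congr rfl fun x _ => ?_
    by_cases h : x a = true
    · congr 2
      ext i
      by_cases hi : i = a
      · subst hi; simp [fillTrue, h]
      · simp [fillTrue, hi]
    · rw [ind_of_false h]; simp
  have e3 : 𝔼 x : ι → Bool, g (fillTrue {a} x) =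
      𝔼 x : ι → Bool, ind (x a = true) * g (fillTrue {a} x) +
      𝔼 x : ι → Bool, ind (x a = false) * g (fillTrue {a} x) := by
    rw [← expect_add_distrib]
    refine expect_congr rfl fun x _ => ?_
    cases h : x a <;> simp [ind]
  linarith

lemma expect_ind_mul (S : Finset ι) (g : (ι → Bool) → ℝ) :
    𝔼 x, ind (∀ i ∈ S, x i = true) * g x = (1 / 2) ^ #S * 𝔼 x, g (fillTrue S x) := by
  induction S using Finset.induction_on generalizing g with
  | empty =>
    have h (x : ι → Bool) : fillTrue ∅ x = x := by ext i; simp [fillTrue]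
    simp [ind, h]
  | insert a S ha ih =>
    have h1 : ∀ x : ι → Bool, ind (∀ i ∈ insert a S, x i = true) * g x =
        ind (x a = true) * (ind (∀ i ∈ S, x i = true) * g x) := by
      intro x
      rw [forall_mem_insert, ind_and, mul_assoc]
    have h2 : ∀ x : ι → Bool, ind (∀ i ∈ S, fillTrue {a} x i = true) =
        ind (∀ i ∈ S, x i = true) := by
      intro x
      congr 1
      refine propext (forall₂_congr fun i hi => ?_)
      have : i ≠ a := fun h => ha (h ▸ hi)
      simp [fillTrue, this]
    have h3 : ∀ x : ι → Bool, fillTrue {a} (fillTrue S x) = fillTrue (insert a S) x := by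
      intro x; ext i
      by_cases hi : i = a <;> simp [fillTrue, hi]
    simp only [h1, expect_ind_single_mul, h2, ih, h3, card_insert_of_notMem ha]
    ring

lemma uPr_forall_and (S : Finset ι) (E : (ι → Bool) → Prop) :
    uPr (fun x => (∀ i ∈ S, x i = true) ∧ E x) = (1 / 2) ^ #S * uPr (fun x => E (fillTrue S x)) := by
  simp only [uPr_eq_expect, ind_and, expect_ind_mul S fun x => ind (E x)]

lemma uPr_forall (S : Finset ι) : uPr (fun x : ι → Bool => ∀ i ∈ S, x i = true) = (1 / 2) ^ #S := by
  have h := uPr_forall_and S fun _ => True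
  simpa [uPr_true] using h

end Cube

section Tribes

open scoped BigOperators

variable {ι κ β : Type*}

/-- No block `P j` with `j ∈ s` is all `true`. -/
def Avoids (P : κ → Finset ι) (s : Finset κ) (x : ι → Bool) : Prop :=
  ∀ j ∈ s, ¬ ∀ i ∈ P j, x i = true

lemma antitone_avoids (P : κ → Finset ι) (s : Finset κ) : Antitone (Avoids P s) := by
  intro x y hxy h j hj hx
  exact h j hj fun i hi => Bool.eq_true_of_true_le ((hx i hi).symm.le.trans (hxy i))

variable [DecidableEq ι]

lemma avoids_fillTrue_iff {P : κ → Finset ι} {s : Finset κ} {S : Finset ι}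
    (h : ∀ j ∈ s, Disjoint (P j) S) (x : ι → Bool) :
    Avoids P s (fillTrue S x) ↔ Avoids P s x := by
  refine forall₂_congr fun j hj => not_congr (forall₂_congr fun i hi => ?_)
  rw [fillTrue, if_neg (disjoint_left.1 (h j hj) hi)]

variable [Fintype ι]

lemma uPr_avoids_insert [DecidableEq κ] (P : κ → Finset ι) (s : Finset κ) (j : κ) :
    uPr (Avoids P (insert j s)) =
      uPr (Avoids P s) - (1 / 2) ^ #(P j) * uPr (fun x => Avoids P s (fillTrue (P j) x)) := by
  rw [← uPr_forall_and, uPr_congr (F := fun x => Avoids P s x ∧ ¬ ∀ i ∈ P j, x i = true)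
    fun x => by rw [Avoids, forall_mem_insert, and_comm]; rfl, uPr_and_not]
  simp only [and_comm]

lemma uPr_avoids_eq_prod [DecidableEq κ] {P : κ → Finset ι} {s : Finset κ}
    (h : ∀ i ∈ s, ∀ j ∈ s, i ≠ j → Disjoint (P i) (P j)) :
    uPr (Avoids P s) = ∏ j ∈ s, (1 - (1 / 2) ^ #(P j)) := by
  induction s using Finset.induction_on with
  | empty =>
    rw [prod_empty]
    exact uPr_true fun x j hj => absurd hj (notMem_empty j)
  | insert a s ha ih =>
    rw [prod_insert ha, uPr_avoids_insert, uPr_congr (avoids_fillTrue_iff fun j hj =>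
      h j (mem_insert_of_mem hj) a (mem_insert_self _ _) fun e => ha (e ▸ hj)),
      ← ih fun i hi j hj => h i (mem_insert_of_mem hi) j (mem_insert_of_mem hj)]
    ring

/-- One step of Janson's inequality. -/
lemma uPr_avoids_insert_le [DecidableEq κ] (P : κ → Finset ι) (s : Finset κ) (j : κ) {η : ℝ}
    (hη1 : η ≤ 1)
    (hη : ∑ i ∈ s with ¬ Disjoint (P i) (P j), (1 / 2 : ℝ) ^ #(P i \ P j) ≤ η) :
    uPr (Avoids P (insert j s)) ≤ (1 - (1 / 2) ^ #(P j) * (1 - η)) * uPr (Avoids P s) := by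
  rw [uPr_avoids_insert]
  set N := s.filter fun i => ¬ Disjoint (P i) (P j) with hN
  set s₀ := s.filter fun i => Disjoint (P i) (P j) with hs₀
  have h1 : uPr (Avoids P s) ≤ uPr (Avoids P s₀) :=
    uPr_mono fun x hx i hi => hx i (mem_of_mem_filter i hi)
  have h2 : uPr (fun x => Avoids P s₀ x ∧ ¬ ∃ i ∈ N, ∀ k ∈ P i \ P j, x k = true) ≤
      uPr (fun x => Avoids P s (fillTrue (P j) x)) := by
    refine uPr_mono fun x hx i hi hall => ?_
    by_cases hd : Disjoint (P i) (P j)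
    · exact hx.1 i (mem_filter.2 ⟨hi, hd⟩) fun k hk => by
        have := hall k hk
        rwa [fillTrue, if_neg (disjoint_left.1 hd hk)] at this
    · refine hx.2 ⟨i, mem_filter.2 ⟨hi, hd⟩, fun k hk => ?_⟩
      rw [mem_sdiff] at hk
      have := hall k hk.1
      rwa [fillTrue, if_neg hk.2] at this
  rw [uPr_and_not] at h2
  have h3 : uPr (fun x => Avoids P s₀ x ∧ ∃ i ∈ N, ∀ k ∈ P i \ P j, x k = true) ≤
      uPr (Avoids P s₀) * η := by
    refine (uPr_and_le_mul (antitone_avoids P s₀) ?_).trans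
      (mul_le_mul_of_nonneg_left ?_ (uPr_nonneg _))
    · rintro x y hxy ⟨i, hi, h⟩
      exact ⟨i, hi, fun k hk => Bool.eq_true_of_true_le ((h k hk).symm.le.trans (hxy k))⟩
    · refine (uPr_exists_le N fun i (x : ι → Bool) => ∀ k ∈ P i \ P j, x k = true).trans ?_
      simpa only [uPr_forall] using hη
  have h4 : (0 : ℝ) < (1 / 2) ^ #(P j) := by positivity
  have h5 : (1 - η) * uPr (Avoids P s) ≤ uPr (fun x => Avoids P s (fillTrue (P j) x)) := by
    have := mul_le_mul_of_nonneg_left h1 (sub_nonneg.2 hη1)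
    linarith
  have := mul_le_mul_of_nonneg_left h5 h4.le
  linarith

lemma uPr_avoids_and_avoids_le [Fintype κ] [DecidableEq κ] {P P' : κ → Finset ι} {w l : ℕ}
    (hP : ∀ i, #(P i) = w) (hP' : ∀ i, #(P' i) = w)
    (hd : ∀ i j, i ≠ j → Disjoint (P i) (P j)) (hd' : ∀ i j, i ≠ j → Disjoint (P' i) (P' j))
    (hl : ∀ i j, #(P i ∩ P' j) ≤ l) (hw : (w : ℝ) * (2 ^ l * (1 / 2) ^ w) ≤ 1) :
    uPr (fun x => Avoids P univ x ∧ Avoids P' univ x) ≤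
      (1 - (1 / 2) ^ w) ^ Fintype.card κ *
        (1 - (1 / 2) ^ w * (1 - w * (2 ^ l * (1 / 2) ^ w))) ^ Fintype.card κ := by
  set η : ℝ := w * (2 ^ l * (1 / 2) ^ w) with hη
  set F : κ ⊕ κ → Finset ι := Sum.elim P P' with hF
  have key : ∀ t : Finset κ, uPr (Avoids F (disjSum univ t)) ≤
      (1 - (1 / 2) ^ w) ^ Fintype.card κ * (1 - (1 / 2) ^ w * (1 - η)) ^ #t := by
    intro t
    induction t using Finset.induction_on with
    | empty =>
      rw [uPr_congr (F := Avoids P univ), uPr_avoids_eq_prod fun i _ j _ h => hd i j h]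
      · simp [hP]
      · intro x
        simp [Avoids, hF]
    | insert a t ha ih =>
      have e : disjSum univ (insert a t) = insert (Sum.inr a) (disjSum (univ : Finset κ) t) := by
        ext x; cases x <;> simp
      rw [e, card_insert_of_notMem ha, pow_succ', mul_left_comm]
      have h1 : ∑ i ∈ disjSum univ t with ¬ Disjoint (F i) (F (Sum.inr a)),
          (1 / 2 : ℝ) ^ #(F i \ F (Sum.inr a)) ≤ η := by
        rw [sum_filter, sum_disjSum]
        have z : ∑ i ∈ t, (if ¬ Disjoint (F (Sum.inr i)) (F (Sum.inr a)) then
            (1 / 2 : ℝ) ^ #(F (Sum.inr i) \ F (Sum.inr a)) else 0) = 0 := by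
          refine sum_eq_zero fun i hi => if_neg (not_not.2 (hd' i a ?_))
          rintro rfl; exact ha hi
        rw [z, add_zero, ← sum_filter]
        set N := univ.filter fun i => ¬ Disjoint (F (Sum.inl i)) (F (Sum.inr a)) with hN
        have hcard : #N ≤ w := by
          have h2 : #N ≤ ∑ i ∈ N, #(P i ∩ P' a) := by
            rw [card_eq_sum_ones]
            refine sum_le_sum fun i hi => ?_
            rw [Nat.one_le_iff_ne_zero, Ne, card_eq_zero, ← disjoint_iff_inter_eq_empty]
            exact (mem_filter.1 hi).2
          rw [← card_biUnion fun i _ j _ hij => (hd i j hij).mono inter_subset_left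
            inter_subset_left] at h2
          refine h2.trans ((card_le_card ?_).trans (hP' a).le)
          exact biUnion_subset.2 fun i _ => inter_subset_right
        have hterm : ∀ i ∈ N, (1 / 2 : ℝ) ^ #(F (Sum.inl i) \ F (Sum.inr a)) ≤
            2 ^ l * (1 / 2) ^ w := by
          intro i _
          have h3 : #(P i \ P' a) + #(P i ∩ P' a) = w := by rw [card_sdiff_add_card_inter, hP]
          have h4 := hl i a
          show (1 / 2 : ℝ) ^ #(P i \ P' a) ≤ _
          rw [← h3, pow_add]
          have h5 : (1 : ℝ) ≤ 2 ^ l * (1 / 2) ^ #(P i ∩ P' a) := by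
            calc (1 : ℝ) = 2 ^ l * (1 / 2) ^ l := by rw [← mul_pow]; norm_num
              _ ≤ _ := by
                gcongr ?_ * ?_
                exact pow_le_pow_of_le_one (by norm_num) (by norm_num) h4
          have h6 : (0 : ℝ) < (1 / 2) ^ #(P i \ P' a) := by positivity
          nlinarith
        refine (sum_le_card_nsmul N _ _ hterm).trans ?_
        rw [nsmul_eq_mul, hη]
        gcongr
      refine (uPr_avoids_insert_le F _ _ hw h1).trans ?_
      have h2 : #(F (Sum.inr a)) = w := hP' a
      rw [h2]
      refine mul_le_mul_of_nonneg_left ih ?_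
      have : (1 / 2 : ℝ) ^ w ≤ 1 := pow_le_one₀ (by norm_num) (by norm_num)
      have h0 : 0 ≤ η := by positivity
      have : (0 : ℝ) < (1 / 2) ^ w := by positivity
      nlinarith
  have h := key univ
  rw [card_univ] at h
  refine le_trans (uPr_mono fun x hx => ?_) h
  rintro (i | i) hi
  · exact hx.1 i (mem_univ i)
  · exact hx.2 i (mem_univ i)

lemma pow_le_uPr_forall_not [DecidableEq β] {B : β → (ι → Bool) → Prop}
    (hB : ∀ y, Antitone (B y)) {p : ℝ} (hp : ∀ y, uPr (B y) = p) (s : Finset β) :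
    (1 - p) ^ #s ≤ uPr (fun x => ∀ y ∈ s, ¬ B y x) := by
  induction s using Finset.induction_on with
  | empty => simp [uPr_true]
  | insert a s ha ih =>
    have h0 : 0 ≤ 1 - p := by rw [← hp a, ← uPr_not]; exact uPr_nonneg _
    rw [card_insert_of_notMem ha, pow_succ']
    refine (mul_le_mul_of_nonneg_left ih h0).trans ?_
    rw [← hp a, ← uPr_not]
    refine (uPr_mul_le_of_monotone (fun x y hxy h h' => h (hB a hxy h'))
      fun x y hxy h b hb h' => h b hb (hB b hxy h')).trans (uPr_mono fun x hx => ?_)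
    exact (forall_mem_insert _ _ _).2 hx

lemma uPr_forall_not_le [DecidableEq β] {B : β → (ι → Bool) → Prop}
    (hB : ∀ y, Antitone (B y)) {p c : ℝ} (hc : 0 ≤ c) (hp : ∀ y, uPr (B y) = p)
    (hpair : ∀ y y', y ≠ y' → uPr (fun x => B y x ∧ B y' x) ≤ p ^ 2 + c) (s : Finset β) :
    uPr (fun x => ∀ y ∈ s, ¬ B y x) ≤ (1 - p) ^ #s + #s ^ 2 * c := by
  induction s using Finset.induction_on with
  | empty => simp [uPr_true]
  | insert a s ha ih =>
    have h0 : 0 ≤ 1 - p := by rw [← hp a, ← uPr_not]; exact uPr_nonneg _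
    have hp0 : 0 ≤ p := by rw [← hp a]; exact uPr_nonneg _
    set N : (ι → Bool) → Prop := fun x => ∀ y ∈ s, ¬ B y x with hN
    have hanti : Antitone fun x => ind (N x) + ∑ y ∈ s, ind (B y x) := by
      intro x x' hxx
      have hsum : ∑ y ∈ s, ind (B y x') ≤ ∑ y ∈ s, ind (B y x) :=
        sum_le_sum fun y _ => ind_mono (hB y hxx)
      by_cases h1 : N x
      · have : ind (N x') ≤ ind (N x) := by rw [ind_of_true h1]; exact ind_le_one _
        show _ + _ ≤ _ + _
        linarith
      · show _ + _ ≤ _ + _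
        have h2 := h1
        simp only [hN, not_forall, not_not] at h2
        obtain ⟨y, hy, hyx⟩ := h2
        by_cases h3 : N x'
        · have hz : ∑ y ∈ s, ind (B y x') = 0 := sum_eq_zero fun y hy => ind_of_false (h3 y hy)
          have : 1 ≤ ∑ y ∈ s, ind (B y x) := by
            rw [← ind_of_true hyx]
            exact single_le_sum (f := fun y => ind (B y x)) (fun _ _ => ind_nonneg _) hy
          rw [hz, ind_of_true h3, ind_of_false h1]
          linarith
        · rw [ind_of_false h3, ind_of_false h1]
          linarith
    have h1 := expect_mul_expect_le_of_antitone (f := fun x => ind (B a x))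
      (fun _ => ind_nonneg _)
      (fun x => add_nonneg (ind_nonneg _) (sum_nonneg fun _ _ => ind_nonneg _))
      (antitone_ind (hB a)) hanti
    simp only [mul_add, mul_sum, expect_add_distrib, expect_sum_comm, ← ind_and,
      ← uPr_eq_expect, hp, sum_const, nsmul_eq_mul] at h1
    have h2 : ∑ y ∈ s, uPr (fun x => B a x ∧ B y x) ≤ #s * (p ^ 2 + c) := by
      refine (sum_le_card_nsmul s _ (p ^ 2 + c) fun y hy => hpair a y ?_).trans
        (nsmul_eq_mul _ _).le
      rintro rfl; exact ha hy
    have h3 : uPr (fun x => ∀ y ∈ insert a s, ¬ B y x) = uPr N - uPr (fun x => B a x ∧ N x) := by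
      rw [uPr_congr (F := fun x => N x ∧ ¬ B a x) fun x => by rw [forall_mem_insert, and_comm],
        uPr_and_not]
      simp only [and_comm]
    rw [h3, card_insert_of_notMem ha]
    have h4 : uPr N - uPr (fun x => B a x ∧ N x) ≤ (1 - p) * uPr N + #s * c := by linarith
    have h5 := mul_le_mul_of_nonneg_left ih h0
    have h6 : (1 - p) * (#s ^ 2 * c) ≤ 1 * (#s ^ 2 * c) := by gcongr; linarith
    have h7 : (0 : ℝ) ≤ #s * c := by positivity
    push_cast
    rw [pow_succ (1 - p)]
    linarith

end Tribes

section Influence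

variable {n : ℕ} {κ β : Type*} [Fintype κ] [Fintype β]

lemma exists_of_undet {P : β → κ → Finset (Fin n)} {Q : Finset (Fin n)} {x : Fin n → Bool}
    (h : Undet (fun x => ∀ y, ∃ i, ∀ k ∈ P y i, x k = true) Q x) :
    ∃ y, ∃ i, ¬ Disjoint (P y i) Q ∧ (∀ k ∈ P y i \ Q, x k = true) ∧
      Avoids (P y) {j | Disjoint (P y j) Q} x := by
  obtain ⟨u, v, hu, hv, huv⟩ : ∃ u v : Fin n → Bool, (∀ i ∉ Q, u i = x i) ∧
      (∀ i ∉ Q, v i = x i) ∧ (¬ ∀ y, ∃ i, ∀ k ∈ P y i, u k = true) ∧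
        ∀ y, ∃ i, ∀ k ∈ P y i, v k = true := by
    obtain ⟨u, v, hu, hv, huv⟩ := h
    by_cases h : ∀ y, ∃ i, ∀ k ∈ P y i, u k = true
    · exact ⟨v, u, hv, hu, fun h' => huv ⟨fun _ => h', fun _ => h⟩, h⟩
    · exact ⟨u, v, hu, hv, h, by_contra fun h' => huv ⟨fun a => absurd a h, fun a => absurd a h'⟩⟩
  obtain ⟨hu', hv'⟩ := huv
  simp only [not_forall, not_exists] at hu'
  obtain ⟨y, hy⟩ := hu'
  obtain ⟨i, hi⟩ := hv' y
  refine ⟨y, i, fun hd => ?_, fun k hk => ?_, fun j hj hall => ?_⟩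
  · obtain ⟨k, hk, hk'⟩ := hy i
    have hkQ := disjoint_left.1 hd hk
    exact hk' (by rw [hu k hkQ, ← hv k hkQ, hi k hk])
  · rw [mem_sdiff] at hk
    rw [← hv k hk.2, hi k hk.1]
  · obtain ⟨k, hk, hk'⟩ := hy j
    exact hk' (by rw [hu k (disjoint_left.1 (mem_filter.1 hj).2 hk), hall k hk])

lemma uPr_undet_le [DecidableEq κ] {P : β → κ → Finset (Fin n)} {w l q : ℕ}
    (hP : ∀ y i, #(P y i) = w) (hd : ∀ y i j, i ≠ j → Disjoint (P y i) (P y j))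
    {Q : Finset (Fin n)} (hQ : #Q ≤ q)
    (hcount : #{z : β × κ | l < #(P z.1 z.2 ∩ Q)} ≤ q ^ (l + 1))
    (hq : (q : ℝ) * (1 / 2) ^ w ≤ 1 / 2) :
    uPr (Undet (fun x => ∀ y, ∃ i, ∀ k ∈ P y i, x k = true) Q) ≤
      2 * (1 / 2) ^ w * (1 - (1 / 2) ^ w) ^ Fintype.card κ *
        (Fintype.card β * (2 ^ l * q) + 2 ^ w * q ^ (l + 1)) := by
  set p : ℝ := (1 - (1 / 2) ^ w) ^ Fintype.card κ with hp
  have ht0 : (0 : ℝ) < (1 / 2) ^ w := by positivity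
  have ht1 : (1 / 2 : ℝ) ^ w ≤ 1 := pow_le_one₀ (by norm_num) (by norm_num)
  have hp0 : 0 ≤ p := pow_nonneg (by linarith) _
  have hmeet : ∀ y, #{j | ¬ Disjoint (P y j) Q} ≤ q := by
    intro y
    refine le_trans ?_ hQ
    have h2 : #{j | ¬ Disjoint (P y j) Q} ≤ ∑ i with ¬ Disjoint (P y i) Q, #(P y i ∩ Q) := by
      rw [card_eq_sum_ones]
      refine sum_le_sum fun i hi => ?_
      rw [Nat.one_le_iff_ne_zero, Ne, card_eq_zero, ← disjoint_iff_inter_eq_empty]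
      exact (mem_filter.1 hi).2
    rw [← card_biUnion fun i _ j _ hij => (hd y i j hij).mono inter_subset_left
      inter_subset_left] at h2
    exact h2.trans (card_le_card (biUnion_subset.2 fun i _ => inter_subset_right))
  have havoid : ∀ y, uPr (Avoids (P y) {j | Disjoint (P y j) Q}) ≤ 2 * p := by
    intro y
    rw [uPr_avoids_eq_prod fun i _ j _ h => hd y i j h]
    simp only [hP, prod_const]
    set a := #{j | Disjoint (P y j) Q}
    set b := #{j | ¬ Disjoint (P y j) Q}
    have hab : a + b = Fintype.card κ := card_filter_add_card_filter_not _
    have h1 : (1 / 2 : ℝ) ≤ (1 - (1 / 2) ^ w) ^ b := by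
      have h2 := one_add_mul_le_pow (a := -(1 / 2 : ℝ) ^ w) (by linarith) b
      have h3 : (b : ℝ) * (1 / 2) ^ w ≤ q * (1 / 2) ^ w := by
        gcongr; exact hmeet y
      rw [← sub_eq_add_neg] at h2
      linarith
    have h2 : 0 ≤ (1 - (1 / 2 : ℝ) ^ w) ^ a := pow_nonneg (by linarith) _
    rw [hp, ← hab, pow_add]
    nlinarith
  have hpair : ∀ y i, uPr (fun x : Fin n → Bool => ¬ Disjoint (P y i) Q ∧
      (∀ k ∈ P y i \ Q, x k = true) ∧ Avoids (P y) {j | Disjoint (P y j) Q} x) ≤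
      2 * (1 / 2) ^ w * p * ((if ¬ Disjoint (P y i) Q then 2 ^ l else 0) +
        if l < #(P y i ∩ Q) then 2 ^ w else 0) := by
    intro y i
    by_cases hdis : Disjoint (P y i) Q
    · have hz : uPr (fun x : Fin n → Bool => ¬ Disjoint (P y i) Q ∧
        (∀ k ∈ P y i \ Q, x k = true) ∧ Avoids (P y) {j | Disjoint (P y j) Q} x) ≤
          uPr fun _ : Fin n → Bool => False := uPr_mono fun x hx => hx.1 hdis
      refine hz.trans ?_
      have : uPr (fun _ : Fin n → Bool => False) = 0 := by simp [uPr]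
      rw [this]
      positivity
    · have h1 : uPr (fun x : Fin n → Bool => ¬ Disjoint (P y i) Q ∧
          (∀ k ∈ P y i \ Q, x k = true) ∧ Avoids (P y) {j | Disjoint (P y j) Q} x) ≤
          (1 / 2) ^ #(P y i \ Q) * (2 * p) := by
        refine (uPr_mono fun x hx => hx.2).trans ?_
        rw [uPr_forall_and, uPr_congr (avoids_fillTrue_iff fun j hj => ?_)]
        · exact mul_le_mul_of_nonneg_left (havoid y) (by positivity)
        · refine (hd y j i ?_).mono_right sdiff_subset
          rintro rfl
          exact hdis (mem_filter.1 hj).2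
      refine h1.trans ?_
      have h3 : #(P y i \ Q) + #(P y i ∩ Q) = w := by rw [card_sdiff_add_card_inter, hP]
      have h4 : (1 / 2 : ℝ) ^ #(P y i \ Q) = (1 / 2) ^ w * 2 ^ #(P y i ∩ Q) := by
        rw [← h3, pow_add, mul_assoc, ← mul_pow]; norm_num
      have h5 : (2 : ℝ) ^ #(P y i ∩ Q) ≤ (if ¬ Disjoint (P y i) Q then 2 ^ l else 0) +
          if l < #(P y i ∩ Q) then 2 ^ w else 0 := by
        rw [if_pos hdis]
        split_ifs with h6
        · have : (2 : ℝ) ^ #(P y i ∩ Q) ≤ 2 ^ w := pow_le_pow_right₀ (by norm_num) (by omega)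
          have : (0 : ℝ) < 2 ^ l := by positivity
          linarith
        · rw [add_zero]
          exact pow_le_pow_right₀ (by norm_num) (by omega)
      rw [h4]
      calc (1 / 2 : ℝ) ^ w * 2 ^ #(P y i ∩ Q) * (2 * p)
          = 2 * (1 / 2) ^ w * p * 2 ^ #(P y i ∩ Q) := by ring
        _ ≤ _ := by gcongr
  have h1 : uPr (Undet (fun x => ∀ y, ∃ i, ∀ k ∈ P y i, x k = true) Q) ≤
      ∑ z : β × κ, 2 * (1 / 2) ^ w * p * ((if ¬ Disjoint (P z.1 z.2) Q then (2 : ℝ) ^ l else 0) +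
        if l < #(P z.1 z.2 ∩ Q) then 2 ^ w else 0) := by
    refine le_trans (uPr_mono fun x hx => ?_) ((uPr_exists_le (univ : Finset (β × κ))
      fun z (x : Fin n → Bool) => ¬ Disjoint (P z.1 z.2) Q ∧ (∀ k ∈ P z.1 z.2 \ Q, x k = true) ∧
        Avoids (P z.1) {j | Disjoint (P z.1 j) Q} x).trans
        (sum_le_sum fun z _ => hpair z.1 z.2))
    obtain ⟨y, i, h⟩ := exists_of_undet hx
    exact ⟨(y, i), mem_univ _, h⟩
  refine h1.trans ?_
  rw [← mul_sum, sum_add_distrib]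
  refine mul_le_mul_of_nonneg_left (add_le_add ?_ ?_) (by positivity)
  · rw [Fintype.sum_prod_type, ← card_univ, ← nsmul_eq_mul]
    refine sum_le_card_nsmul _ _ _ fun y _ => ?_
    rw [← sum_filter, sum_const, nsmul_eq_mul, mul_comm]
    gcongr
    exact hmeet y
  · rw [← sum_filter, sum_const, nsmul_eq_mul, mul_comm]
    gcongr
    exact_mod_cast hcount

end Influence

section ReedSolomon

variable {v w l : ℕ}

lemma div_lt_of_fin (m : Fin (v * w)) : m.1 / v < w := Nat.div_lt_of_lt_mul m.2

lemma mem_blockP_iff [NeZero v] {α : Fin w → ZMod v} {i : Fin v} {m : Fin (v * w)} :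
    m ∈ blockP α i ↔ ((m.1 : ℕ) : ZMod v) = (i.1 : ZMod v) - α ⟨m.1 / v, div_lt_of_fin m⟩ := by
  have hv : 0 < v := NeZero.pos v
  unfold blockP
  rw [mem_image]
  constructor
  · rintro ⟨k, -, hk⟩
    have hm : m.1 = k.1 * v + (((i.1 : ZMod v) - α k).val) % v := by rw [← hk]
    have hlt : (((i.1 : ZMod v) - α k).val) % v < v := Nat.mod_lt _ hv
    have hdiv : m.1 / v = k.1 := by
      rw [hm, mul_comm, Nat.mul_add_div hv, Nat.div_eq_of_lt hlt, add_zero]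
    have : (⟨m.1 / v, div_lt_of_fin m⟩ : Fin w) = k := Fin.ext hdiv
    rw [this, hm]
    push_cast
    simp
  · intro h
    refine ⟨⟨m.1 / v, div_lt_of_fin m⟩, mem_univ _, Fin.ext ?_⟩
    show m.1 / v * v + (((i.1 : ZMod v) - α ⟨m.1 / v, div_lt_of_fin m⟩).val) % v = m.1
    rw [← h, ZMod.val_natCast, Nat.mod_mod, mul_comm, Nat.div_add_mod]

lemma blockP_eq_of_div_eq [NeZero v] {α : Fin w → ZMod v} {i : Fin v} {m m' : Fin (v * w)}
    (hm : m ∈ blockP α i) (hm' : m' ∈ blockP α i) (h : m.1 / v = m'.1 / v) : m = m' := by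
  rw [mem_blockP_iff] at hm hm'
  have h1 : ((m.1 : ℕ) : ZMod v) = ((m'.1 : ℕ) : ZMod v) := by
    rw [hm, hm']; congr 3
  have h2 := (ZMod.natCast_eq_natCast_iff' _ _ _).1 h1
  apply Fin.ext
  rw [← Nat.div_add_mod m.1 v, ← Nat.div_add_mod m'.1 v, h, h2]

lemma card_blockP [NeZero v] (α : Fin w → ZMod v) (i : Fin v) : #(blockP α i) = w := by
  have hv : 0 < v := NeZero.pos v
  unfold blockP
  rw [card_image_of_injective, card_univ, Fintype.card_fin]
  intro k k' h
  have h1 := congrArg (fun m : Fin (v * w) => m.1 / v) h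
  simp only [mul_comm _ v, Nat.mul_add_div hv, Nat.div_eq_of_lt (Nat.mod_lt _ hv), add_zero] at h1
  exact Fin.ext h1

lemma natCast_fin_injective {i j : Fin v} (h : (i.1 : ZMod v) = (j.1 : ZMod v)) :
    i = j := by
  have := (ZMod.natCast_eq_natCast_iff' _ _ _).1 h
  rw [Nat.mod_eq_of_lt i.2, Nat.mod_eq_of_lt j.2] at this
  exact Fin.ext this

lemma disjoint_blockP [NeZero v] (α : Fin w → ZMod v) {i j : Fin v} (h : i ≠ j) :
    Disjoint (blockP α i) (blockP α j) := by
  rw [disjoint_left]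
  intro m hi hj
  rw [mem_blockP_iff] at hi hj
  exact h (natCast_fin_injective (sub_left_injective (hi.symm.trans hj)))

open Polynomial in
/-- Two Reed–Solomon blocks sharing more than `l` points coincide. -/
lemma eq_of_lt_card_blockP_inter [Fact v.Prime] (hwv : w < v) {y y' : Fin l → ZMod v}
    {i j : Fin v} (h : l < #(blockP (alphaRS w y) i ∩ blockP (alphaRS w y') j)) :
    y = y' ∧ i = j := by
  classical
  set T := blockP (alphaRS w y) i ∩ blockP (alphaRS w y') j with hT
  set D : (ZMod v)[X] := C ((i.1 : ZMod v) - (j.1 : ZMod v)) -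
    ∑ t : Fin l, C (y t - y' t) * X ^ (t.1 + 1) with hD
  have hcoeff : ∀ t : Fin l, D.coeff (t.1 + 1) = -(y t - y' t) := by
    intro t
    rw [hD, coeff_sub, coeff_C_succ, finsetSum_coeff, sum_eq_single t]
    · rw [coeff_C_mul, coeff_X_pow_self, mul_one, zero_sub]
    · intro s _ hs
      rw [coeff_C_mul, coeff_X_pow, if_neg, mul_zero]
      exact fun e => hs (Fin.ext (by omega))
    · simp
  have hcoeff0 : D.coeff 0 = (i.1 : ZMod v) - (j.1 : ZMod v) := by
    rw [hD, coeff_sub, coeff_C_zero, finsetSum_coeff, sum_eq_zero, sub_zero]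
    intro s _
    rw [coeff_C_mul, coeff_X_pow, if_neg (by omega), mul_zero]
  have hdeg : D.natDegree ≤ l := by
    refine (natDegree_sub_le _ _).trans (max_le ?_ ?_)
    · rw [natDegree_C]; exact Nat.zero_le _
    refine natDegree_sum_le_of_forall_le _ _ fun t _ => ?_
    exact (natDegree_C_mul_X_pow_le _ _).trans t.2
  have hzero : D = 0 := by
    refine eq_zero_of_natDegree_lt_card_of_eval_eq_zero' D
      (T.image fun m => ((m.1 / v + 1 : ℕ) : ZMod v)) ?_ ?_
    · intro a ha
      obtain ⟨m, hm, rfl⟩ := mem_image.1 ha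
      rw [hT, mem_inter, mem_blockP_iff, mem_blockP_iff] at hm
      have h1 := hm.1.symm.trans hm.2
      unfold alphaRS at h1
      rw [hD, eval_sub, eval_C, eval_finsetSum]
      simp only [eval_mul, eval_C, eval_pow, eval_X, sub_mul, sum_sub_distrib]
      linear_combination h1
    · rw [card_image_of_injOn]
      · exact hdeg.trans_lt h
      · intro m hm m' hm' e
        have hm1 := mem_inter.1 (mem_coe.1 hm)
        have hm1' := mem_inter.1 (mem_coe.1 hm')
        refine blockP_eq_of_div_eq hm1.1 hm1'.1 ?_
        have e' := (ZMod.natCast_eq_natCast_iff' _ _ _).1 e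
        have := div_lt_of_fin m
        have := div_lt_of_fin m'
        rw [Nat.mod_eq_of_lt (by omega), Nat.mod_eq_of_lt (by omega)] at e'
        omega
  constructor
  · funext t
    have := hcoeff t
    rw [hzero, coeff_zero] at this
    linear_combination this
  · rw [hzero, coeff_zero] at hcoeff0
    exact natCast_fin_injective (sub_eq_zero.1 hcoeff0.symm)

lemma card_lt_card_blockP_inter_le [Fact v.Prime] (hwv : w < v) {q : ℕ} {Q : Finset (Fin (v * w))}
    (hQ : #Q ≤ q) :
    #{z : (Fin l → ZMod v) × Fin v | l < #(blockP (alphaRS w z.1) z.2 ∩ Q)} ≤ q ^ (l + 1) := by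
  classical
  have hex : ∀ z : (Fin l → ZMod v) × Fin v, ∃ S : Finset (Fin (v * w)),
      l < #(blockP (alphaRS w z.1) z.2 ∩ Q) →
        S ⊆ blockP (alphaRS w z.1) z.2 ∩ Q ∧ #S = l + 1 := by
    intro z
    by_cases h : l < #(blockP (alphaRS w z.1) z.2 ∩ Q)
    · obtain ⟨S, hS⟩ := exists_subset_card_eq (Nat.succ_le_of_lt h)
      exact ⟨S, fun _ => hS⟩
    · exact ⟨∅, fun h' => absurd h' h⟩
  choose S hS using hex
  calc _ ≤ #(powersetCard (l + 1) Q) := by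
        refine card_le_card_of_injOn S (fun z hz => ?_) fun z hz z' hz' e => ?_
        · have := hS z (mem_filter.1 hz).2
          exact mem_powersetCard.2 ⟨this.1.trans inter_subset_right, this.2⟩
        · have h1 := hS z (mem_filter.1 (mem_coe.1 hz)).2
          have h2 := hS z' (mem_filter.1 (mem_coe.1 hz')).2
          have h3 : l < #(blockP (alphaRS w z.1) z.2 ∩ blockP (alphaRS w z'.1) z'.2) := by
            have : S z ⊆ blockP (alphaRS w z.1) z.2 ∩ blockP (alphaRS w z'.1) z'.2 :=
              subset_inter (h1.1.trans inter_subset_left)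
                (e ▸ h2.1.trans inter_subset_left)
            have := card_le_card this
            omega
          obtain ⟨h4, h5⟩ := eq_of_lt_card_blockP_inter hwv h3
          exact Prod.ext h4 h5
    _ = (#Q).choose (l + 1) := card_powersetCard _ _
    _ ≤ #Q ^ (l + 1) := Nat.choose_le_pow _ _
    _ ≤ _ := Nat.pow_le_pow_left hQ _

end ReedSolomon

section Resilient

variable {v w l : ℕ}

lemma fRS_iff_not_avoids [NeZero v] (x : Fin (v * w) → Bool) :
    fRS v l w x ↔ ∀ y ∈ (univ : Finset (Fin l → ZMod v)),
      ¬ Avoids (blockP (alphaRS w y)) univ x := by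
  simp [fRS, Avoids]

lemma uPr_avoids_blockP [NeZero v] (α : Fin w → ZMod v) :
    uPr (Avoids (blockP α) univ) = (1 - (1 / 2) ^ w) ^ v := by
  rw [uPr_avoids_eq_prod fun i _ j _ h => disjoint_blockP α h]
  simp [card_blockP]

lemma pow_le_uPr_fRS [NeZero v] :
    (1 - (1 - (1 / 2 : ℝ) ^ w) ^ v) ^ v ^ l ≤ uPr (fRS v l w) := by
  have h := pow_le_uPr_forall_not (B := fun y : Fin l → ZMod v => Avoids (blockP (alphaRS w y)) univ)
    (fun y => antitone_avoids _ _) (fun y => uPr_avoids_blockP _) univ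
  rw [uPr_congr fRS_iff_not_avoids]
  simpa [ZMod.card] using h

lemma uPr_fRS_le [Fact v.Prime] (hwv : w < v) (hw : 1 ≤ w)
    (hwl : (w : ℝ) * (2 ^ l * (1 / 2) ^ w) ≤ 1)
    (hvt : 2 * (v * w * 2 ^ l * ((1 / 2) ^ w) ^ 2) ≤ (1 : ℝ)) :
    uPr (fRS v l w) ≤ (1 - (1 - (1 / 2 : ℝ) ^ w) ^ v) ^ v ^ l +
      ((v ^ l : ℕ) * (1 - (1 / 2 : ℝ) ^ w) ^ v) ^ 2 * (4 * (v * w * 2 ^ l * ((1 / 2) ^ w) ^ 2)) := by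
  set t : ℝ := (1 / 2) ^ w with ht
  set p : ℝ := (1 - t) ^ v with hp
  set s : ℝ := v * w * 2 ^ l * t ^ 2 with hs
  have ht0 : 0 < t := by positivity
  have ht1 : t ≤ 1 / 2 := by
    calc t ≤ (1 / 2) ^ 1 := pow_le_pow_of_le_one (by norm_num) (by norm_num) hw
      _ = 1 / 2 := pow_one _
  have hs0 : 0 ≤ s := by positivity
  have hp0 : 0 ≤ p := pow_nonneg (by linarith) _
  have hpair : ∀ y y' : Fin l → ZMod v, y ≠ y' →
      uPr (fun x => Avoids (blockP (alphaRS w y)) univ x ∧ Avoids (blockP (alphaRS w y')) univ x) ≤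
        p ^ 2 + p ^ 2 * (4 * s) := by
    intro y y' hy
    refine (uPr_avoids_and_avoids_le (w := w) (l := l) (card_blockP _) (card_blockP _)
      (fun i j h => disjoint_blockP _ h) (fun i j h => disjoint_blockP _ h)
      (fun i j => le_of_not_gt fun h => hy (eq_of_lt_card_blockP_inter hwv h).1) hwl).trans ?_
    rw [Fintype.card_fin, ← ht, ← hp]
    have h1 : 1 - t * (1 - w * (2 ^ l * t)) ≤ (1 - t) * (1 + 2 * (t * (w * (2 ^ l * t)))) := by
      have : 0 ≤ t * (w * (2 ^ l * t)) := by positivity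
      nlinarith
    have h2 : 0 ≤ 1 - t * (1 - w * (2 ^ l * t)) := by
      have : 0 ≤ t * (w * (2 ^ l * t)) := by positivity
      nlinarith
    have h3 : (1 + 2 * (t * (w * (2 ^ l * t)))) ^ v ≤ Real.exp (2 * s) := by
      calc (1 + 2 * (t * (w * (2 ^ l * t)))) ^ v
          ≤ Real.exp (2 * (t * (w * (2 ^ l * t)))) ^ v := by
            gcongr
            linarith [Real.add_one_le_exp (2 * (t * (w * (2 ^ l * t))))]
        _ = Real.exp (2 * s) := by rw [← Real.exp_nat_mul, hs]; ring_nf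
    have h4 : Real.exp (2 * s) ≤ 1 + 4 * s := by
      have := Real.abs_exp_sub_one_le (x := 2 * s) (by rw [abs_of_nonneg (by positivity)]; exact hvt)
      rw [abs_of_nonneg (by positivity : 0 ≤ 2 * s)] at this
      linarith [(abs_le.1 this).2]
    calc p * (1 - t * (1 - w * (2 ^ l * t))) ^ v
        ≤ p * ((1 - t) * (1 + 2 * (t * (w * (2 ^ l * t))))) ^ v := by gcongr
      _ = p ^ 2 * (1 + 2 * (t * (w * (2 ^ l * t)))) ^ v := by rw [mul_pow, ← hp]; ring
      _ ≤ p ^ 2 * (1 + 4 * s) := by gcongr; exact h3.trans h4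
      _ = _ := by ring
  have h := uPr_forall_not_le
    (B := fun y : Fin l → ZMod v => Avoids (blockP (alphaRS w y)) univ)
    (fun y => antitone_avoids _ _) (by positivity) (fun y => uPr_avoids_blockP _) hpair univ
  rw [uPr_congr fRS_iff_not_avoids]
  have hc : #(univ : Finset (Fin l → ZMod v)) = v ^ l := by simp [ZMod.card]
  rw [hc] at h
  refine h.trans (le_of_eq ?_)
  ring

lemma uPr_undet_fRS_le [Fact v.Prime] (hwv : w < v) {q : ℕ} {Q : Finset (Fin (v * w))}
    (hQ : #Q ≤ q) (hq : (q : ℝ) * (1 / 2) ^ w ≤ 1 / 2) :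
    uPr (Undet (fRS v l w) Q) ≤ 2 * (1 / 2) ^ w * (1 - (1 / 2) ^ w) ^ v *
      ((v ^ l : ℕ) * (2 ^ l * q) + 2 ^ w * q ^ (l + 1)) := by
  have h := uPr_undet_le (P := fun (y : Fin l → ZMod v) (i : Fin v) => blockP (alphaRS w y) i)
    (w := w) (l := l) (fun y i => card_blockP _ i) (fun y i j h => disjoint_blockP _ h) hQ
    (card_lt_card_blockP_inter_le hwv hQ) hq
  have hc : Fintype.card (Fin l → ZMod v) = v ^ l := by simp [ZMod.card]
  rw [hc, Fintype.card_fin] at h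
  exact h

/-- `(1 - p) ^ M` is close to `1 / 2` when `p * M` is close to `log 2`. -/
lemma abs_one_sub_pow_sub_half_le {p τ : ℝ} {M : ℕ} (hp0 : 0 ≤ p) (hp : p ≤ 1 / 2) (hτ0 : 0 ≤ τ)
    (hτ : τ ≤ 1) (hM1 : M * p ≤ 1) (hM : |M * p - Real.log 2| ≤ τ) :
    |(1 - p) ^ M - 1 / 2| ≤ τ + 2 * p := by
  have hM' := abs_le.1 hM
  have hM0 : (0 : ℝ) ≤ M := Nat.cast_nonneg M
  have hhalf : Real.exp (-Real.log 2) = 1 / 2 := by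
    rw [Real.exp_neg, Real.exp_log two_pos]; norm_num
  have hup : (1 - p) ^ M ≤ 1 / 2 + τ := by
    calc (1 - p) ^ M ≤ Real.exp (-p) ^ M := by
          have := Real.add_one_le_exp (-p)
          gcongr
          · linarith
          · linarith
      _ = Real.exp (-(M * p)) := by rw [← Real.exp_nat_mul]; ring_nf
      _ ≤ Real.exp (-Real.log 2 + τ) := Real.exp_le_exp.2 (by linarith)
      _ = 1 / 2 * Real.exp τ := by rw [Real.exp_add, hhalf]
      _ ≤ 1 / 2 * (1 + 2 * τ) := by
          have := Real.abs_exp_sub_one_le (x := τ) (by rwa [abs_of_nonneg hτ0])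
          rw [abs_of_nonneg hτ0] at this
          linarith [(abs_le.1 this).2]
      _ = _ := by ring
  have hlow : 1 / 2 - (τ + 2 * p) ≤ (1 - p) ^ M := by
    have h1 : Real.exp (-(p + 2 * p ^ 2)) ≤ 1 - p := by
      rw [Real.exp_neg]
      refine inv_le_of_inv_le₀ (by linarith) ?_
      have h2 := Real.add_one_le_exp (p + 2 * p ^ 2)
      refine le_trans ?_ h2
      rw [inv_le_iff_one_le_mul₀ (by linarith)]
      nlinarith [mul_nonneg hp0 hp0]
    calc 1 / 2 - (τ + 2 * p) ≤ 1 / 2 * (1 - (τ + 2 * p)) := by linarith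
      _ ≤ 1 / 2 * Real.exp (-(τ + 2 * p)) := by
          linarith [Real.add_one_le_exp (-(τ + 2 * p))]
      _ = Real.exp (-Real.log 2 + -(τ + 2 * p)) := by rw [Real.exp_add, hhalf]
      _ ≤ Real.exp (M * -(p + 2 * p ^ 2)) := by
          refine Real.exp_le_exp.2 ?_
          nlinarith
      _ = Real.exp (-(p + 2 * p ^ 2)) ^ M := by rw [← Real.exp_nat_mul]
      _ ≤ _ := by gcongr
  rw [abs_le]
  constructor <;> linarith

end Resilient

section
open Filter

lemma eventually_mul_pow_mul_exp_le (C : ℝ) {c : ℝ} (hc : 0 < c) (k : ℕ) :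
    ∀ᶠ w : ℕ in atTop, C * (w : ℝ) ^ k * Real.exp (-(c * w)) ≤ 1 := by
  have h : Tendsto (fun x : ℝ => C * (x ^ k * Real.exp (-(c * x)))) atTop (nhds (C * 0)) := by
    refine Tendsto.const_mul C ?_
    have := tendsto_rpow_mul_exp_neg_mul_atTop_nhds_zero (k : ℝ) c hc
    simpa [neg_mul] using this
  rw [mul_zero] at h
  filter_upwards [(h.comp tendsto_natCast_atTop_atTop).eventually (ge_mem_nhds one_pos)]
    with w hw
  simpa [mul_assoc] using hw

end

lemma half_pow_eq_exp (w : ℕ) : (1 / 2 : ℝ) ^ w = Real.exp (-(Real.log 2 * w)) := by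
  rw [← Real.exp_log (by positivity : (0 : ℝ) < (1 / 2) ^ w), Real.log_pow, one_div, Real.log_inv]
  congr 1
  ring

lemma two_pow_mul_half_pow (w : ℕ) : (2 : ℝ) ^ w * (1 / 2) ^ w = 1 := by
  rw [← mul_pow]; norm_num

lemma neg_log_one_sub_mem {t : ℝ} (h0 : 0 < t) (h1 : t ≤ 1 / 2) :
    t ≤ -Real.log (1 - t) ∧ -Real.log (1 - t) ≤ 2 * t := by
  constructor
  · linarith [Real.log_le_sub_one_of_pos (by linarith : (0 : ℝ) < 1 - t)]
  · have h := Real.one_sub_inv_le_log_of_pos (by linarith : (0 : ℝ) < 1 - t)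
    have h2 : (1 - t)⁻¹ ≤ 1 + 2 * t := by
      rw [inv_le_iff_one_le_mul₀ (by linarith)]
      nlinarith
    linarith

lemma neg_one_le_log_log_two : -1 ≤ Real.log (Real.log 2) := by
  have h2 := Real.log_two_gt_d9
  have h := Real.one_sub_inv_le_log_of_pos (by linarith : (0 : ℝ) < Real.log 2)
  have : (Real.log 2)⁻¹ ≤ 2 := by
    rw [inv_le_iff_one_le_mul₀ (by linarith)]
    linarith
  linarith

lemma exists_log_sub_eq {l w : ℕ} (hl : 3 ≤ l) (hw : 4 ≤ w)
    (hlog : Real.log (2 * l * w) ≤ w) :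
    ∃ V : ℝ, (w : ℝ) * 2 ^ w ≤ V ∧ V ≤ 2 * l * w * 2 ^ w ∧
      l * Real.log V + V * Real.log (1 - (1 / 2) ^ w) = Real.log (Real.log 2) := by
  have hl' : (3 : ℝ) ≤ l := by exact_mod_cast hl
  have hw' : (4 : ℝ) ≤ w := by exact_mod_cast hw
  have hlg := Real.log_two_gt_d9
  have hlg' := Real.log_two_lt_d9
  have ht := two_pow_mul_half_pow w
  have ht0 : (0 : ℝ) < (1 / 2) ^ w := by positivity
  have htw : ((1 : ℝ) / 2) ^ w ≤ 1 / 2 :=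
    pow_le_of_le_one (by norm_num) (by norm_num) (by omega)
  obtain ⟨hlam1, hlam2⟩ := neg_log_one_sub_mem ht0 htw
  have hP : (0 : ℝ) < 2 ^ w := by positivity
  have hA : (0 : ℝ) < w * 2 ^ w := by positivity
  have hcont : ContinuousOn
      (fun V : ℝ => l * Real.log V + V * Real.log (1 - (1 / 2) ^ w))
      (Set.Icc ((w : ℝ) * 2 ^ w) (2 * l * w * 2 ^ w)) := by
    refine ContinuousOn.add (continuousOn_const.mul (Real.continuousOn_log.mono ?_))
      (continuousOn_id.mul continuousOn_const)
    intro x hx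
    exact (lt_of_lt_of_le hA hx.1).ne'
  have hle : (w : ℝ) * 2 ^ w ≤ 2 * l * w * 2 ^ w := by
    have : (w : ℝ) ≤ 2 * l * w := by nlinarith
    gcongr
  have hmem : Real.log (Real.log 2) ∈ Set.Icc
      (l * Real.log (2 * l * w * 2 ^ w) + (2 * l * w * 2 ^ w) * Real.log (1 - (1 / 2) ^ w))
      (l * Real.log (w * 2 ^ w) + (w * 2 ^ w) * Real.log (1 - (1 / 2) ^ w)) := by
    constructor
    · rw [Real.log_mul (by positivity) (by positivity), Real.log_pow]
      have h1 : (2 * l * w * 2 ^ w) * Real.log (1 - (1 / 2) ^ w) ≤ -(2 * l * w) := by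
        have : (2 * l * w * 2 ^ w) * (1 / 2 : ℝ) ^ w ≤
            (2 * l * w * 2 ^ w) * -Real.log (1 - (1 / 2) ^ w) := by gcongr
        have h3 : (2 * l * w * 2 ^ w) * (1 / 2 : ℝ) ^ w = 2 * l * w := by
          rw [mul_assoc, ht, mul_one]
        linarith
      have h2 : (l : ℝ) * (Real.log (2 * l * w) + w * Real.log 2) ≤
          l * (w + w * 0.7) := by
        gcongr
        linarith
      have h4 := neg_one_le_log_log_two
      have h5 : (12 : ℝ) ≤ l * w := by nlinarith
      nlinarith
    · have hlog1 : Real.log (Real.log 2) ≤ 0 := Real.log_nonpos (by linarith) (by linarith)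
      rw [Real.log_mul (by positivity) (by positivity), Real.log_pow]
      have h1 : (w * 2 ^ w) * -Real.log (1 - (1 / 2) ^ w) ≤ (w * 2 ^ w) * (2 * (1 / 2 : ℝ) ^ w) := by
        gcongr
      have h3 : (w * 2 ^ w) * (2 * (1 / 2 : ℝ) ^ w) = 2 * w := by
        linear_combination (2 * w : ℝ) * ht
      have h4 : 0 ≤ Real.log w := Real.log_nonneg (by linarith)
      have h5 : (3 : ℝ) * (w * 0.69) ≤ l * (Real.log w + w * Real.log 2) := by
        have : (w : ℝ) * 0.69 ≤ Real.log w + w * Real.log 2 := by nlinarith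
        gcongr
      nlinarith
  obtain ⟨V, hV, hVeq⟩ := intermediate_value_Icc' hle hcont hmem
  exact ⟨V, hV.1, hV.2, hVeq⟩

lemma abs_pow_mul_pow_sub_log_two_le {l w v : ℕ} {V h : ℝ} (hw : 1 ≤ w) (hl : 1 ≤ l)
    (hV0 : 0 < V)
    (hV : V ≤ 2 * l * w * 2 ^ w)
    (hroot : l * Real.log V + V * Real.log (1 - (1 / 2) ^ w) = Real.log (Real.log 2))
    (hVv : V ≤ v) (hvV : (v : ℝ) ≤ V * Real.exp h) (hh1 : 8 * l * w * h ≤ 1) :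
    |((v ^ l : ℕ) : ℝ) * (1 - (1 / 2) ^ w) ^ v - Real.log 2| ≤ 16 * l * w * h := by
  have hl' : (1 : ℝ) ≤ l := by exact_mod_cast hl
  have hw' : (1 : ℝ) ≤ w := by exact_mod_cast hw
  have hlw : (1 : ℝ) ≤ l * w := by nlinarith
  have hv0 : (0 : ℝ) < v := hV0.trans_le hVv
  have hlv : Real.log v ≤ Real.log V + h := by
    have := Real.log_le_log hv0 hvV
    rwa [Real.log_mul hV0.ne' (Real.exp_pos h).ne', Real.log_exp] at this
  have hVlv : Real.log V ≤ Real.log v := Real.log_le_log hV0 hVv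
  have hh0 : 0 ≤ h := by linarith
  have hhle : h ≤ 1 := by nlinarith
  have ht := two_pow_mul_half_pow w
  have ht0 : (0 : ℝ) < (1 / 2) ^ w := by positivity
  have htw : ((1 : ℝ) / 2) ^ w ≤ 1 / 2 :=
    pow_le_of_le_one (by norm_num) (by norm_num) (by omega)
  obtain ⟨hlam1, hlam2⟩ := neg_log_one_sub_mem ht0 htw
  have hlg := Real.log_two_gt_d9
  have hlg' := Real.log_two_lt_d9
  set lam := -Real.log (1 - (1 / 2 : ℝ) ^ w) with hlam
  set x : ℝ := l * (Real.log v - Real.log V) - lam * (v - V) with hx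
  have hval : ((v ^ l : ℕ) : ℝ) * (1 - (1 / 2) ^ w) ^ v = Real.log 2 * Real.exp x := by
    have e1 : ((v ^ l : ℕ) : ℝ) = Real.exp (l * Real.log v) := by
      rw [Real.exp_nat_mul, Real.exp_log hv0]; push_cast; rfl
    have e2 : (1 - (1 / 2 : ℝ) ^ w) ^ v = Real.exp (v * -lam) := by
      rw [Real.exp_nat_mul, hlam, neg_neg, Real.exp_log (by linarith)]
    have e3 : Real.log 2 = Real.exp (Real.log (Real.log 2)) := by
      rw [Real.exp_log (by linarith)]
    rw [e1, e2, ← Real.exp_add]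
    nth_rewrite 1 [e3]
    rw [← Real.exp_add, ← hroot]
    congr 1
    rw [hx, hlam]
    ring
  have hexp : Real.exp h ≤ 1 + 2 * h := by
    have := (abs_le.1 (Real.abs_exp_sub_one_le (abs_le.2 ⟨by linarith, hhle⟩))).2
    rw [abs_of_nonneg hh0] at this
    linarith
  have hlamV : lam * V ≤ 4 * l * w := by
    calc lam * V ≤ (2 * (1 / 2) ^ w) * (2 * l * w * 2 ^ w) := by gcongr
      _ = 4 * l * w := by linear_combination (4 * l * w : ℝ) * ht
  have hvV' : v - V ≤ V * (2 * h) := by nlinarith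
  have hlow : lam * (v - V) ≤ 8 * l * w * h := by
    calc lam * (v - V) ≤ lam * (V * (2 * h)) := by
          apply mul_le_mul_of_nonneg_left hvV'; linarith
      _ = lam * V * (2 * h) := by ring
      _ ≤ 4 * l * w * (2 * h) := by gcongr
      _ = _ := by ring
  have hlow0 : 0 ≤ lam * (v - V) := mul_nonneg (by linarith) (by linarith)
  have hup : l * (Real.log v - Real.log V) ≤ 8 * l * w * h := by
    calc l * (Real.log v - Real.log V) ≤ l * h := by gcongr; linarith
      _ ≤ 8 * l * w * h := by
        have : (l : ℝ) * 1 ≤ l * (8 * w) := by gcongr; linarith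
        nlinarith
  have hup0 : 0 ≤ l * (Real.log v - Real.log V) := mul_nonneg (by linarith) (by linarith)
  have hxabs : |x| ≤ 8 * l * w * h := abs_le.2 ⟨by linarith, by linarith⟩
  have hex := Real.abs_exp_sub_one_le (hxabs.trans hh1)
  rw [hval, show Real.log 2 * Real.exp x - Real.log 2 = Real.log 2 * (Real.exp x - 1) by ring,
    abs_mul, abs_of_pos (by linarith)]
  calc Real.log 2 * |Real.exp x - 1| ≤ 1 * (2 * |x|) := by gcongr; linarith
    _ ≤ 16 * l * w * h := by linarith

section
open Filter

lemma exists_prime_balanced {l : ℕ} (hl : 3 ≤ l) :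
    ∃ c : ℝ, 0 < c ∧ ∀ᶠ w : ℕ in atTop, ∃ v : ℕ, v.Prime ∧
      (w : ℝ) * 2 ^ w ≤ v ∧ (v : ℝ) ≤ 4 * l * w * 2 ^ w ∧
      |((v ^ l : ℕ) : ℝ) * (1 - (1 / 2) ^ w) ^ v - Real.log 2| ≤ Real.exp (-(c * w)) := by
  obtain ⟨c, hc, hprime⟩ := exists_prime_short_interval
  have hlg := Real.log_two_gt_d9
  have hlg' := Real.log_two_lt_d9
  have hcl : 0 < c * Real.log 2 / 2 := by positivity
  refine ⟨c * Real.log 2 / 2, hcl, ?_⟩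
  obtain ⟨L₀, hL₀⟩ := eventually_atTop.1 hprime
  have htend : Tendsto (fun w : ℕ => (w : ℝ) * Real.log 2) atTop atTop :=
    tendsto_natCast_atTop_atTop.atTop_mul_const (by linarith)
  filter_upwards [eventually_ge_atTop 4, htend.eventually_ge_atTop L₀,
    eventually_mul_pow_mul_exp_le (2 * l) one_pos 1,
    eventually_mul_pow_mul_exp_le (16 * l) hcl 1] with w hw hwL h1 h2
  have hl' : (3 : ℝ) ≤ l := by exact_mod_cast hl
  have hw' : (4 : ℝ) ≤ w := by exact_mod_cast hw
  have hlw : (12 : ℝ) ≤ l * w := by nlinarith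
  have hlog : Real.log (2 * l * w) ≤ w := by
    rw [Real.log_le_iff_le_exp (by positivity)]
    rw [Real.exp_neg, ← div_eq_mul_inv, div_le_one (Real.exp_pos _)] at h1
    simpa using h1
  obtain ⟨V, hV1, hV2, hroot⟩ := exists_log_sub_eq hl hw hlog
  have hV0 : 0 < V := lt_of_lt_of_le (by positivity) hV1
  have hLV : (w : ℝ) * Real.log 2 ≤ Real.log V := by
    rw [← Real.log_pow]
    apply Real.log_le_log (by positivity)
    refine le_trans ?_ hV1
    have : (0 : ℝ) < 2 ^ w := by positivity
    nlinarith
  obtain ⟨v, hvp, hv1, hv2⟩ := hL₀ (Real.log V) (hwL.trans hLV)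
  rw [Real.exp_add, Real.exp_log hV0] at hv2
  rw [Real.exp_log hV0] at hv1
  set E := Real.exp (-(c * Real.log 2 / 2 * w)) with hE
  have hE0 : 0 < E := Real.exp_pos _
  have hE1 : E ≤ 1 := Real.exp_le_one_iff.2 (by
    have : 0 ≤ c * Real.log 2 / 2 * w := by positivity
    linarith)
  have hh : Real.exp (-(c * Real.log V)) ≤ E * E := by
    rw [hE, ← Real.exp_add]
    apply Real.exp_le_exp.2
    nlinarith
  set h := Real.exp (-(c * Real.log V)) with hhdef
  have hh0 : 0 < h := Real.exp_pos _
  rw [pow_one] at h2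
  have hhE : 16 * l * w * h ≤ E := by
    calc 16 * l * w * h ≤ 16 * l * w * (E * E) := by gcongr
      _ = 16 * l * w * E * E := by ring
      _ ≤ 1 * E := by gcongr
      _ = E := one_mul E
  have hexp : Real.exp h ≤ 2 := by
    have : h ≤ 1 / 2 := by nlinarith
    have h3 := (abs_le.1 (Real.abs_exp_sub_one_le
      (abs_le.2 ⟨by linarith, by linarith⟩ : |h| ≤ 1))).2
    rw [abs_of_pos hh0] at h3
    linarith
  refine ⟨v, hvp, hV1.trans hv1, ?_, ?_⟩
  · calc (v : ℝ) ≤ V * Real.exp h := hv2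
      _ ≤ (2 * l * w * 2 ^ w) * 2 := by gcongr
      _ = _ := by ring
  · refine (abs_pow_mul_pow_sub_log_two_le (by omega) (by omega) hV0 hV2 hroot hv1 hv2 ?_).trans hhE
    nlinarith

end

lemma abs_uPr_fRS_sub_half_le {v l w : ℕ} [Fact v.Prime] {τ : ℝ} (hw : 2 ≤ w) (hl : 1 ≤ l)
    (hv1 : (w : ℝ) * 2 ^ w ≤ v) (hv2 : (v : ℝ) ≤ 4 * l * w * 2 ^ w)
    (hM : |((v ^ l : ℕ) : ℝ) * (1 - (1 / 2) ^ w) ^ v - Real.log 2| ≤ τ) (hτ : τ ≤ 0.3)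
    (hS : 16 * l * 2 ^ l * (w : ℝ) ^ 2 * (1 / 2) ^ w ≤ 1) :
    |uPr (fRS v l w) - 1 / 2| ≤
      τ + 2 * (1 / 2) ^ w + 16 * l * 2 ^ l * (w : ℝ) ^ 2 * (1 / 2) ^ w := by
  have hl' : (1 : ℝ) ≤ l := by exact_mod_cast hl
  have hw' : (2 : ℝ) ≤ w := by exact_mod_cast hw
  have hlg' := Real.log_two_lt_d9
  have hP : (1 : ℝ) ≤ 2 ^ w := one_le_pow₀ (by norm_num)
  have ht := two_pow_mul_half_pow w
  have ht0 : (0 : ℝ) < (1 / 2) ^ w := by positivity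
  have htw : ((1 : ℝ) / 2) ^ w ≤ 1 / 2 :=
    pow_le_of_le_one (by norm_num) (by norm_num) (by omega)
  have hvP : (2 : ℝ) ^ w ≤ v := by nlinarith
  have hwv : w < v := by
    have : (w : ℝ) < v := by
      have : (2 : ℝ) ≤ 2 ^ w := le_self_pow₀ (by norm_num) (by omega)
      nlinarith
    exact_mod_cast this
  have hMv : (v : ℝ) ≤ ((v ^ l : ℕ) : ℝ) := by
    exact_mod_cast Nat.le_self_pow (by omega) v
  have hM1 : ((v ^ l : ℕ) : ℝ) * (1 - (1 / 2) ^ w) ^ v ≤ 1 := by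
    linarith [(abs_le.1 hM).2]
  have hp0 : 0 ≤ (1 - (1 / 2 : ℝ) ^ w) ^ v := pow_nonneg (by linarith) v
  have hpt : (1 - (1 / 2 : ℝ) ^ w) ^ v ≤ (1 / 2) ^ w := by
    have h1 : 2 ^ w * (1 - (1 / 2 : ℝ) ^ w) ^ v ≤ 1 :=
      le_trans (mul_le_mul_of_nonneg_right (hvP.trans hMv) hp0) hM1
    nlinarith
  have hvS : v * w * 2 ^ l * ((1 / 2 : ℝ) ^ w) ^ 2 ≤ 4 * l * 2 ^ l * (w : ℝ) ^ 2 * (1 / 2) ^ w := by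
    calc v * w * 2 ^ l * ((1 / 2 : ℝ) ^ w) ^ 2
        ≤ (4 * l * w * 2 ^ w) * w * 2 ^ l * ((1 / 2 : ℝ) ^ w) ^ 2 := by gcongr
      _ = 4 * l * 2 ^ l * (w : ℝ) ^ 2 * (1 / 2) ^ w := by
        linear_combination (4 * l * 2 ^ l * (w : ℝ) ^ 2 * (1 / 2) ^ w) * ht
  have hwl : (w : ℝ) * (2 ^ l * (1 / 2) ^ w) ≤ 1 := by
    refine le_trans ?_ hS
    have h1 : (1 : ℝ) * w ≤ (16 * l * w) * w := by
      gcongr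
      nlinarith
    calc (w : ℝ) * (2 ^ l * (1 / 2) ^ w) = 1 * w * (2 ^ l * (1 / 2) ^ w) := by ring
      _ ≤ (16 * l * w) * w * (2 ^ l * (1 / 2) ^ w) := by gcongr
      _ = _ := by ring
  have hτ0 : 0 ≤ τ := (abs_nonneg _).trans hM
  have hmain := abs_le.1 (abs_one_sub_pow_sub_half_le hp0 (hpt.trans htw) hτ0 (by linarith) hM1 hM)
  have hlow := pow_le_uPr_fRS (v := v) (l := l) (w := w)
  have hup := uPr_fRS_le (v := v) (l := l) (w := w) hwv (by omega) hwl (by linarith)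
  have herr : (((v ^ l : ℕ) : ℝ) * (1 - (1 / 2 : ℝ) ^ w) ^ v) ^ 2 *
      (4 * (v * w * 2 ^ l * ((1 / 2 : ℝ) ^ w) ^ 2)) ≤
      1 * (4 * (v * w * 2 ^ l * ((1 / 2 : ℝ) ^ w) ^ 2)) := by
    gcongr
    exact pow_le_one₀ (by positivity) hM1
  have hS0 : 0 ≤ 16 * l * 2 ^ l * (w : ℝ) ^ 2 * (1 / 2) ^ w := by positivity
  exact abs_le.2 ⟨by linarith [hmain.1], by linarith [hmain.2]⟩

lemma uPr_undet_fRS_le_const_mul {v l w q : ℕ} [Fact v.Prime] (hwv : w < v)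
    (hM1 : ((v ^ l : ℕ) : ℝ) * (1 - (1 / 2) ^ w) ^ v ≤ 1)
    (hq : (q : ℝ) * (1 / 2) ^ w ≤ 1 / 2) (hqv : (2 : ℝ) ^ w * q ^ l ≤ ((v ^ l : ℕ) : ℝ))
    {Q : Finset (Fin (v * w))} (hQ : #Q ≤ q) :
    uPr (Undet (fRS v l w) Q) ≤ 2 * (2 ^ l + 1) * (1 / 2) ^ w * q := by
  have ht1 : ((1 : ℝ) / 2) ^ w ≤ 1 := pow_le_one₀ (by norm_num) (by norm_num)
  have hp0 : 0 ≤ (1 - (1 / 2 : ℝ) ^ w) ^ v := pow_nonneg (by linarith) v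
  refine (uPr_undet_fRS_le hwv hQ hq).trans ?_
  calc 2 * (1 / 2 : ℝ) ^ w * (1 - (1 / 2) ^ w) ^ v *
        (((v ^ l : ℕ) : ℝ) * (2 ^ l * q) + 2 ^ w * q ^ (l + 1))
      = 2 * (1 / 2 : ℝ) ^ w * (1 - (1 / 2) ^ w) ^ v *
        (((v ^ l : ℕ) : ℝ) * (2 ^ l * q) + (2 ^ w * q ^ l) * q) := by ring
    _ ≤ 2 * (1 / 2 : ℝ) ^ w * (1 - (1 / 2) ^ w) ^ v *
        (((v ^ l : ℕ) : ℝ) * (2 ^ l * q) + ((v ^ l : ℕ) : ℝ) * q) := by gcongr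
    _ = 2 * (2 ^ l + 1) * (1 / 2) ^ w * q * (((v ^ l : ℕ) : ℝ) * (1 - (1 / 2) ^ w) ^ v) := by ring
    _ ≤ 2 * (2 ^ l + 1) * (1 / 2) ^ w * q * 1 := by gcongr
    _ = _ := mul_one _

lemma mul_half_pow_le_half_and_two_pow_mul_pow_le {δ : ℝ} (hδ : 0 < δ) {l w q : ℕ}
    (hl : 1 / δ ≤ l) (hlw : l ≤ w) (hq : (q : ℝ) ≤ (2 : ℝ) ^ ((w : ℝ) * (1 - δ))) :
    (q : ℝ) * (1 / 2) ^ w ≤ 1 / 2 ∧ (2 : ℝ) ^ w * q ^ l ≤ (2 ^ w) ^ l := by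
  have hlδ : 1 ≤ l * δ := by rwa [div_le_iff₀ hδ] at hl
  have hlw' : (l : ℝ) ≤ w := by exact_mod_cast hlw
  have hw0 : (0 : ℝ) ≤ w := by positivity
  constructor
  · have h1 : (2 : ℝ) ^ ((w : ℝ) * (1 - δ)) ≤ 2 ^ ((w : ℝ) - 1) := by
      apply Real.rpow_le_rpow_of_exponent_le (by norm_num)
      nlinarith
    rw [Real.rpow_sub_one (by norm_num), Real.rpow_natCast] at h1
    have ht := two_pow_mul_half_pow w
    calc (q : ℝ) * (1 / 2) ^ w ≤ (2 ^ w / 2) * (1 / 2) ^ w := by gcongr; exact hq.trans h1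
      _ = 1 / 2 := by linear_combination (1 / 2 : ℝ) * ht
  · calc (2 : ℝ) ^ w * q ^ l ≤ 2 ^ w * ((2 : ℝ) ^ ((w : ℝ) * (1 - δ))) ^ l := by gcongr
      _ = (2 : ℝ) ^ ((w : ℝ) + w * (1 - δ) * l) := by
        rw [Real.rpow_add (by norm_num), Real.rpow_mul_natCast (by norm_num), Real.rpow_natCast]
      _ ≤ (2 : ℝ) ^ ((w * l : ℕ) : ℝ) := by
        apply Real.rpow_le_rpow_of_exponent_le (by norm_num)
        push_cast
        nlinarith
      _ = (2 ^ w) ^ l := by rw [Real.rpow_natCast, pow_mul]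

theorem statement13 (δ : ℝ) (hδ0 : 0 < δ) (hδ1 : δ < 1) :
    ∃ cδ c' : ℝ, 1 ≤ cδ ∧ 0 < c' ∧ ∃ w0 : ℕ, ∀ w : ℕ, w0 ≤ w →
      2 * (max 3 ⌈1/δ⌉₊) ≤ w →
      ∃ v : ℕ, v.Prime ∧ ((w:ℝ) * 2^w / cδ ≤ v) ∧ ((v:ℝ) ≤ cδ * w * 2^w) ∧
        (|uPr (fRS v (max 3 ⌈1/δ⌉₊) w) - 1/2| ≤ (2:ℝ) ^ (-(c' * w)) ∧
         ∀ q : ℕ, 1 ≤ q → (q:ℝ) ≤ (2:ℝ) ^ ((w:ℝ) * (1 - δ)) →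
           ∀ Q : Finset (Fin (v * w)), Q.card ≤ q →
             uPr (Undet (fRS v (max 3 ⌈1/δ⌉₊) w) Q) ≤ cδ * (1/2:ℝ)^w * q) := by
  set l := max 3 ⌈1 / δ⌉₊ with hldef
  have hl3 : 3 ≤ l := le_max_left _ _
  have hlδ : 1 / δ ≤ l := (Nat.le_ceil _).trans (by exact_mod_cast le_max_right _ _)
  have hl' : (3 : ℝ) ≤ l := by exact_mod_cast hl3
  clear_value l
  obtain ⟨c, hc, hev⟩ := exists_prime_balanced hl3
  have hlg := Real.log_two_gt_d9
  have hlg' := Real.log_two_lt_d9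
  set b := min c (1 / 2) with hb
  have hb0 : 0 < b := lt_min hc (by norm_num)
  have hbc : b ≤ c := min_le_left _ _
  have hb1 : b ≤ 1 / 2 := min_le_right _ _
  have hb2 : 0 < b / 2 := by positivity
  have hC1 : (1 : ℝ) ≤ 4 * l + 2 * (2 ^ l + 1) := by
    have : (0 : ℝ) < 2 ^ l := by positivity
    linarith
  obtain ⟨w0, hw0⟩ := Filter.eventually_atTop.1 (hev.and
    ((eventually_mul_pow_mul_exp_le 10 hb2 0).and
      (eventually_mul_pow_mul_exp_le (5 * (16 * l * 2 ^ l)) hb2 2)))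
  refine ⟨4 * l + 2 * (2 ^ l + 1), b / 2, hC1, hb2, w0, fun w hw hlw => ?_⟩
  obtain ⟨⟨v, hvp, hv1, hv2, hM⟩, h1, h2⟩ := hw0 w hw
  have : Fact v.Prime := ⟨hvp⟩
  have hw' : (6 : ℝ) ≤ w := by exact_mod_cast (by omega : 6 ≤ w)
  have hP : (1 : ℝ) ≤ 2 ^ w := one_le_pow₀ (by norm_num)
  have ht0 : (0 : ℝ) < (1 / 2) ^ w := by positivity
  set E := Real.exp (-(b / 2 * w)) with hE
  have hE0 : 0 < E := Real.exp_pos _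
  have hE1 : 10 * E ≤ 1 := by simpa using h1
  have hEb : Real.exp (-(b * w)) = E * E := by
    rw [hE, ← Real.exp_add]
    congr 1
    ring
  have hτ : Real.exp (-(c * w)) ≤ E * E := by
    rw [← hEb]
    apply Real.exp_le_exp.2
    nlinarith
  have ht : (1 / 2 : ℝ) ^ w ≤ E * E := by
    rw [← hEb, half_pow_eq_exp]
    apply Real.exp_le_exp.2
    nlinarith
  have hS : 5 * (16 * l * 2 ^ l * (w : ℝ) ^ 2 * (1 / 2) ^ w) ≤ E := by
    calc 5 * (16 * l * 2 ^ l * (w : ℝ) ^ 2 * (1 / 2) ^ w)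
        ≤ 5 * (16 * l * 2 ^ l * (w : ℝ) ^ 2 * (E * E)) := by gcongr
      _ = 5 * (16 * l * 2 ^ l) * (w : ℝ) ^ 2 * E * E := by ring
      _ ≤ 1 * E := by gcongr
      _ = E := one_mul E
  have hEE : 10 * (E * E) ≤ E := by nlinarith
  have hM1 : ((v ^ l : ℕ) : ℝ) * (1 - (1 / 2) ^ w) ^ v ≤ 1 := by
    linarith [(abs_le.1 hM).2]
  have hwP : (0 : ℝ) < w * 2 ^ w := by positivity
  have hvP : (2 : ℝ) ^ w ≤ v := (le_mul_of_one_le_left (by positivity) (by linarith)).trans hv1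
  refine ⟨v, hvp, (div_le_self hwP.le hC1).trans hv1, ?_, ?_, fun q _ hq Q hQ => ?_⟩
  · refine hv2.trans ?_
    gcongr
    have : (0 : ℝ) < 2 ^ l := by positivity
    linarith
  · refine (abs_uPr_fRS_sub_half_le (by omega) (by omega) hv1 hv2 hM (by linarith)
      (by linarith)).trans ?_
    have hfin : E ≤ (2 : ℝ) ^ (-(b / 2 * w)) := by
      rw [Real.rpow_def_of_pos (by norm_num), hE]
      apply Real.exp_le_exp.2
      have : 0 ≤ b / 2 * w := by positivity
      nlinarith
    refine le_trans ?_ hfin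
    linarith
  · obtain ⟨hq1, hq2⟩ := mul_half_pow_le_half_and_two_pow_mul_pow_le hδ0 hlδ (by omega) hq
    have hwv : w < v := by
      have : 2 ^ w ≤ v := by exact_mod_cast hvP
      exact Nat.lt_two_pow_self.trans_le this
    refine (uPr_undet_fRS_le_const_mul hwv hM1 hq1 ?_ hQ).trans ?_
    · push_cast
      exact hq2.trans (pow_le_pow_left₀ (by positivity) hvP l)
    · refine mul_le_mul_of_nonneg_right (mul_le_mul_of_nonneg_right ?_ ht0.le) (Nat.cast_nonneg q)
      linarith
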